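/- Let (R, m) be a Noetherian local ring, N a finitely generated R-module of Krull dimension d, and I an ideal of R. If there exists a multiplicatively closed subset S of R with m ∩ S ≠ ∅ such that the topologies defined by {S((I^n)^{(N)}_a)}_{n≥1} and {(I^n)^{(N)}_a}_{n≥1} are equivalent (i.e. for every n ≥ 1 there exists k ≥ 1 with S((I^k)^{(N)}_a) ⊆ (I^n)^{(N)}_a), then the top local cohomology module H^d_I(N) vanishes. Conversely, if N is quasi-unmixed and H^d_I(N) = 0, then such a multiplicatively closed subset S exists. -/

import Mathlib

open Pointwise

section Defs

variable {R : Type} [CommRing R]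

/-- `x` is integrally dependent on the ideal `I` relative to the module `N`:
`x ^ n • N ⊆ ∑_{i=1}^n x^(n-i) • (I^i • N)` for some `n ≥ 1`. -/
def Ideal.RelIntDep (I : Ideal R) (N : Type) [AddCommGroup N] [Module R N] (x : R) : Prop :=
  ∃ n : ℕ, 0 < n ∧ ∀ m : N, x ^ n • m ∈
    ⨆ i ∈ Finset.Icc 1 n, x ^ (n - i) • (I ^ i • (⊤ : Submodule R N))

/-- The integral closure `I^{(N)}_a` of `I` relative to `N`, as a subset of `R`. -/
def Ideal.relIntClosure (I : Ideal R) (N : Type) [AddCommGroup N] [Module R N] : Set R :=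
  {x | I.RelIntDep N x}

/-- The classical integral closure `I_a` of an ideal, as a subset of `R`. -/
def Ideal.intClosure (I : Ideal R) : Set R :=
  {x | ∃ n : ℕ, 0 < n ∧ ∃ r : ℕ → R, (∀ i ∈ Finset.Icc 1 n, r i ∈ I ^ i) ∧
    x ^ n + ∑ i ∈ Finset.Icc 1 n, r i * x ^ (n - i) = 0}

/-- `mAss_R N`: the set of minimal members of `Ass_R N`. -/
def mAss (R : Type) [CommRing R] (N : Type) [AddCommGroup N] [Module R N] : Set (Ideal R) :=
  {p | Minimal (· ∈ associatedPrimes R N) p}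

/-- `Ass_R (R/J)` for a subset `J ⊆ R`: primes of the form `(J :_R x)`. -/
def assQuot (J : Set R) : Set (Ideal R) :=
  {p | p.IsPrime ∧ ∃ x : R, (p : Set R) = {r : R | r * x ∈ J}}

/-- `Ass_R (J/K)` for subsets `K ⊆ J` of `R`: primes of the form `(K :_R x)` with `x ∈ J`. -/
def assQuot₂ (J K : Set R) : Set (Ideal R) :=
  {p | p.IsPrime ∧ ∃ x ∈ J, (p : Set R) = {r : R | r * x ∈ K}}

/-- `S(J) = ∪_{s ∈ S} (J :_R s)`. -/
def sat (S : Set R) (J : Set R) : Set R := {x | ∃ s ∈ S, s * x ∈ J}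

/-- `(J :_R K)` for subsets of `R`. -/
def setColon (J K : Set R) : Set R := {x | ∀ y ∈ K, x * y ∈ J}

/-- `(J :_R ⟨K⟩) = ∪_{n ≥ 1} (J :_R K^n)`. -/
def colonPow (J : Set R) (K : Ideal R) : Set R :=
  {x | ∃ n : ℕ, 0 < n ∧ ∀ y ∈ K ^ n, x * y ∈ J}

end Defs
section Quint

variable {R : Type} [CommRing R]

/-- Auxiliary: the quintasymptotic condition at a prime `p`: there is a minimal associated
prime `q` of the completion `N̂ₚ` of `Nₚ` over the completion `R̂ₚ` of `Rₚ` with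
`Rad(I·R̂ₚ + q) = p·R̂ₚ`. -/
def Ideal.quintAux (I p : Ideal R) (N : Type) [AddCommGroup N] [Module R N] [p.IsPrime] : Prop :=
  ∃ q : Ideal (AdicCompletion (IsLocalRing.maximalIdeal (Localization.AtPrime p))
      (Localization.AtPrime p)),
    q ∈ mAss (AdicCompletion (IsLocalRing.maximalIdeal (Localization.AtPrime p))
        (Localization.AtPrime p))
      (AdicCompletion (IsLocalRing.maximalIdeal (Localization.AtPrime p))
        (LocalizedModule p.primeCompl N)) ∧
    (I.map ((algebraMap (Localization.AtPrime p)
        (AdicCompletion (IsLocalRing.maximalIdeal (Localization.AtPrime p))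
          (Localization.AtPrime p))).comp (algebraMap R (Localization.AtPrime p))) ⊔ q).radical =
      p.map ((algebraMap (Localization.AtPrime p)
        (AdicCompletion (IsLocalRing.maximalIdeal (Localization.AtPrime p))
          (Localization.AtPrime p))).comp (algebraMap R (Localization.AtPrime p)))

/-- `p ∈ Q̄*(I, N)`: `p` is a quintasymptotic prime of `I` with respect to `N`. -/
def Ideal.IsQuintasymptotic (I p : Ideal R) (N : Type) [AddCommGroup N] [Module R N] : Prop :=
  ∃ hp : p.IsPrime, @Ideal.quintAux R _ I p N _ _ hp

end Quint
/-- `N` is quasi-unmixed over the Noetherian local ring `R`: for every minimal associated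
prime `q` of the `𝔪`-adic completion `N̂` over `R̂`, `dim R̂/q = dim N`. -/
def QuasiUnmixed (R : Type) [CommRing R] [IsLocalRing R] (N : Type) [AddCommGroup N]
    [Module R N] : Prop :=
  ∀ q : Ideal (AdicCompletion (IsLocalRing.maximalIdeal R) R),
    q ∈ mAss (AdicCompletion (IsLocalRing.maximalIdeal R) R)
        (AdicCompletion (IsLocalRing.maximalIdeal R) N) →
      ringKrullDim (AdicCompletion (IsLocalRing.maximalIdeal R) R ⧸ q) =
        Order.krullDim (Module.support R N)

set_option linter.unusedSectionVars false

namespace TorsionCohomology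

section

open CategoryTheory

section Basic

variable {A : Type} [CommRing A] {ι : Type} (x : ι → A)
variable (M : Type) [AddCommGroup M] [Module A M]
variable {M' M'' : Type} [AddCommGroup M'] [Module A M'] [AddCommGroup M''] [Module A M'']

/-- The product of the localizations of `M` at the elements `x j`. -/
abbrev Loc : Type := ∀ j, LocalizedModule (Submonoid.powers (x j)) M

/-- The canonical map `M → ∏ M_{x j}`. -/
noncomputable def toLoc : M →ₗ[A] Loc x M :=
  LinearMap.pi fun j => LocalizedModule.mkLinearMap (Submonoid.powers (x j)) M

/-- The submodule of `(x)`-power torsion elements. -/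
noncomputable def torsionPart : Submodule A M := LinearMap.ker (toLoc x M)

/-- The cokernel of `M → ∏ M_{x j}`. -/
abbrev LocQuot : Type := Loc x M ⧸ LinearMap.range (toLoc x M)

variable {M}

lemma mem_torsionPart {m : M} : m ∈ torsionPart x M ↔ ∀ j, ∃ n : ℕ, x j ^ n • m = 0 := by
  rw [torsionPart, LinearMap.mem_ker, funext_iff]
  refine forall_congr' fun j => ?_
  simp only [toLoc, LinearMap.pi_apply, Pi.zero_apply]
  rw [IsLocalizedModule.eq_zero_iff (Submonoid.powers (x j))]
  constructor
  · rintro ⟨⟨_, n, rfl⟩, h⟩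
    exact ⟨n, h⟩
  · rintro ⟨n, h⟩
    exact ⟨⟨_, n, rfl⟩, h⟩

/-- The map induced on products of localizations. -/
noncomputable def locMap (f : M →ₗ[A] M') : Loc x M →ₗ[A] Loc x M' :=
  LinearMap.pi fun j => (IsLocalizedModule.map (Submonoid.powers (x j))
    (LocalizedModule.mkLinearMap (Submonoid.powers (x j)) M)
    (LocalizedModule.mkLinearMap (Submonoid.powers (x j)) M') f).comp (LinearMap.proj j)

lemma locMap_apply (f : M →ₗ[A] M') (u : Loc x M) (j : ι) :
    locMap x f u j = IsLocalizedModule.map (Submonoid.powers (x j))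
      (LocalizedModule.mkLinearMap (Submonoid.powers (x j)) M)
      (LocalizedModule.mkLinearMap (Submonoid.powers (x j)) M') f (u j) := rfl

lemma locMap_toLoc (f : M →ₗ[A] M') (m : M) : locMap x f (toLoc x M m) = toLoc x M' (f m) := by
  funext j
  rw [locMap_apply]
  exact IsLocalizedModule.map_apply _ _ _ f m

lemma locMap_comp (f : M →ₗ[A] M') (g : M' →ₗ[A] M'') (u : Loc x M) :
    locMap x (g.comp f) u = locMap x g (locMap x f u) := by
  funext j
  simp only [locMap_apply]
  rw [IsLocalizedModule.map_comp' (Submonoid.powers (x j)) _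
    (LocalizedModule.mkLinearMap (Submonoid.powers (x j)) M') _ f g]
  rfl

lemma locMap_id (u : Loc x M) : locMap x (LinearMap.id : M →ₗ[A] M) u = u := by
  funext j
  rw [locMap_apply, IsLocalizedModule.map_id]
  rfl

lemma locMap_smul (a : A) (f : M →ₗ[A] M') (u : Loc x M) :
    locMap x (a • f) u = a • locMap x f u := by
  funext j
  rw [Pi.smul_apply, locMap_apply, locMap_apply, map_smul]
  rfl

lemma locMap_exact {f : M →ₗ[A] M'} {g : M' →ₗ[A] M''} (h : Function.Exact f g) :
    Function.Exact (locMap x f) (locMap x g) := by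
  have key := fun j => IsLocalizedModule.map_exact (Submonoid.powers (x j))
    (LocalizedModule.mkLinearMap (Submonoid.powers (x j)) M)
    (LocalizedModule.mkLinearMap (Submonoid.powers (x j)) M')
    (LocalizedModule.mkLinearMap (Submonoid.powers (x j)) M'') f g h
  intro u
  constructor
  · intro hu
    choose v hv using fun j => (key j (u j)).1 (by rw [← locMap_apply, hu]; rfl)
    exact ⟨v, funext hv⟩
  · rintro ⟨v, rfl⟩
    funext j
    exact (key j _).2 ⟨v j, rfl⟩

lemma locMap_injective {f : M →ₗ[A] M'} (h : Function.Injective f) :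
    Function.Injective (locMap x f) := fun _ _ huv => funext fun j =>
  IsLocalizedModule.map_injective (Submonoid.powers (x j)) _ _ f h (congr_fun huv j)

lemma locMap_surjective {f : M →ₗ[A] M'} (h : Function.Surjective f) :
    Function.Surjective (locMap x f) := by
  intro u
  choose v hv using fun j => IsLocalizedModule.map_surjective (Submonoid.powers (x j))
    (LocalizedModule.mkLinearMap (Submonoid.powers (x j)) M)
    (LocalizedModule.mkLinearMap (Submonoid.powers (x j)) M') f h (u j)
  exact ⟨v, funext hv⟩

lemma map_mem_torsionPart (f : M →ₗ[A] M') {m : M} (hm : m ∈ torsionPart x M) :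
    f m ∈ torsionPart x M' := by
  rw [torsionPart, LinearMap.mem_ker] at hm ⊢
  rw [← locMap_toLoc, hm, map_zero]

/-- The map induced on torsion parts. -/
noncomputable def torsionMap (f : M →ₗ[A] M') : torsionPart x M →ₗ[A] torsionPart x M' :=
  f.restrict fun _ => map_mem_torsionPart x f

/-- The map induced on the cokernels of `M → ∏ M_{x j}`. -/
noncomputable def locQuotMap (f : M →ₗ[A] M') : LocQuot x M →ₗ[A] LocQuot x M' :=
  Submodule.mapQ _ _ (locMap x f) (by
    rintro _ ⟨m, rfl⟩
    exact ⟨f m, (locMap_toLoc x f m).symm⟩)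

@[simp] lemma locQuotMap_mk (f : M →ₗ[A] M') (u : Loc x M) :
    locQuotMap x f (Submodule.Quotient.mk u) = Submodule.Quotient.mk (locMap x f u) := rfl

lemma locQuotMap_surjective {f : M →ₗ[A] M'} (h : Function.Surjective f) :
    Function.Surjective (locQuotMap x f) := by
  intro u
  obtain ⟨u, rfl⟩ := Submodule.Quotient.mk_surjective _ u
  obtain ⟨v, rfl⟩ := locMap_surjective x h u
  exact ⟨Submodule.Quotient.mk v, rfl⟩

lemma subsingleton_locQuot (h : torsionPart x M = ⊤) : Subsingleton (LocQuot x M) := by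
  have : Subsingleton (Loc x M) := by
    refine subsingleton_of_forall_eq 0 fun u => funext fun j => ?_
    induction u j using LocalizedModule.induction_on with
    | h m s =>
      obtain ⟨n, hn⟩ := (mem_torsionPart x).1 (h ▸ Submodule.mem_top : m ∈ torsionPart x M) j
      rw [Pi.zero_apply, ← LocalizedModule.zero_mk 1, LocalizedModule.mk_eq]
      exact ⟨⟨_, n, rfl⟩, by simpa [Submonoid.smul_def] using hn⟩
  exact Quotient.instSubsingletonQuotient _

lemma locQuotMap_exact {f : M →ₗ[A] M'} {g : M' →ₗ[A] M''} (hfg : Function.Exact f g)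
    (hg : Function.Surjective g) :
    Function.Exact (locQuotMap x f) (locQuotMap x g) := by
  intro u
  obtain ⟨u, rfl⟩ := Submodule.Quotient.mk_surjective _ u
  rw [locQuotMap_mk, Submodule.Quotient.mk_eq_zero]
  constructor
  · rintro ⟨m, hm⟩
    obtain ⟨m, rfl⟩ := hg m
    have : locMap x g (u - toLoc x M' m) = 0 := by rw [map_sub, locMap_toLoc, hm, sub_self]
    obtain ⟨v, hv⟩ := (locMap_exact x hfg _).1 this
    refine ⟨Submodule.Quotient.mk v, ?_⟩
    rw [locQuotMap_mk, hv, Submodule.Quotient.mk_sub, sub_eq_self, Submodule.Quotient.mk_eq_zero]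
    exact ⟨m, rfl⟩
  · rintro ⟨v, hv⟩
    obtain ⟨v, rfl⟩ := Submodule.Quotient.mk_surjective _ v
    rw [locQuotMap_mk, ← sub_eq_zero, ← Submodule.Quotient.mk_sub,
      Submodule.Quotient.mk_eq_zero] at hv
    obtain ⟨m, hm⟩ := hv
    refine ⟨-g m, ?_⟩
    rw [map_neg, ← locMap_toLoc, hm, map_sub, (locMap_exact x hfg).apply_apply_eq_zero, zero_sub,
      neg_neg]

/-- The connecting map, with the exactness statements it satisfies. -/
lemma exists_connecting {f : M →ₗ[A] M'} {g : M' →ₗ[A] M''} (hf : Function.Injective f)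
    (hfg : Function.Exact f g) (hg : Function.Surjective g) :
    ∃ δ : torsionPart x M'' →ₗ[A] LocQuot x M,
      Function.Exact (torsionMap x g) δ ∧ Function.Exact δ (locQuotMap x f) := by
  have sq1 : (locMap x f).comp (toLoc x M) = (toLoc x M').comp f :=
    LinearMap.ext fun m => locMap_toLoc x f m
  have sq2 : (locMap x g).comp (toLoc x M') = (toLoc x M'').comp g :=
    LinearMap.ext fun m => locMap_toLoc x g m
  have e2 : Function.Exact (torsionPart x M').subtype (toLoc x M') :=
    LinearMap.exact_subtype_ker_map _
  have e3 : Function.Exact (torsionPart x M'').subtype (toLoc x M'') :=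
    LinearMap.exact_subtype_ker_map _
  have q1 : Function.Exact (toLoc x M) (LinearMap.range (toLoc x M)).mkQ :=
    LinearMap.exact_map_mkQ_range _
  have q2 : Function.Exact (toLoc x M') (LinearMap.range (toLoc x M')).mkQ :=
    LinearMap.exact_map_mkQ_range _
  refine ⟨SnakeLemma.δ' (toLoc x M) (toLoc x M') (toLoc x M'') f g hfg (locMap x f) (locMap x g)
    (locMap_exact x hfg) sq1 sq2 _ e3 _ q1 hg (locMap_injective x hf), ?_, ?_⟩
  · exact SnakeLemma.exact_δ'_right (toLoc x M) (toLoc x M') (toLoc x M'') f g hfg (locMap x f)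
      (locMap x g) (locMap_exact x hfg) sq1 sq2 _ e2 _ e3 _ q1 hg (locMap_injective x hf)
      (torsionMap x g) rfl Subtype.val_injective
  · exact SnakeLemma.exact_δ'_left (toLoc x M) (toLoc x M') (toLoc x M'') f g hfg (locMap x f)
      (locMap x g) (locMap_exact x hfg) sq1 sq2 _ e3 _ q1 _ q2 hg (locMap_injective x hf)
      (locQuotMap x f) rfl (Submodule.mkQ_surjective _)

end Basic

end

section Cohomology

variable {A : Type} [CommRing A] {ι : Type} (x : ι → A)

/-- Bundled auxiliary version of `Coh`. -/
noncomputable def cohAux : ℕ → ModuleCat.{0} A → ModuleCat.{0} A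
  | 0, M => ModuleCat.of A (torsionPart x M)
  | i + 1, M => cohAux i (ModuleCat.of A (LocQuot x M))

/-- Bundled auxiliary version of `cohMap`. -/
noncomputable def cohMapAux : (i : ℕ) → {M M' : ModuleCat.{0} A} → (M →ₗ[A] M') →
    (cohAux x i M →ₗ[A] cohAux x i M')
  | 0, _, _, f => torsionMap x f
  | i + 1, M, M', f => cohMapAux i (M := ModuleCat.of A (LocQuot x M))
      (M' := ModuleCat.of A (LocQuot x M')) (locQuotMap x f)

variable (M : Type) [AddCommGroup M] [Module A M]
variable {M' M'' : Type} [AddCommGroup M'] [Module A M'] [AddCommGroup M''] [Module A M'']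

/-- The `i`-th local cohomology module of `M` with support in the ideal generated by a finite
family `x`, computed by iterating the cokernel of `M → ∏ M_{x j}`. -/
abbrev Coh (i : ℕ) : Type := cohAux x i (ModuleCat.of A M)

variable {M}

/-- Functoriality of `Coh`. -/
noncomputable abbrev cohMap (i : ℕ) (f : M →ₗ[A] M') : Coh x M i →ₗ[A] Coh x M' i :=
  cohMapAux x i (M := ModuleCat.of A M) (M' := ModuleCat.of A M') f

lemma cohMap_smul (i : ℕ) : ∀ {M M' : Type} [AddCommGroup M] [Module A M] [AddCommGroup M']
    [Module A M'] (a : A) (f : M →ₗ[A] M'), cohMap x i (a • f) = a • cohMap x i f := by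
  induction i with
  | zero => intros; rfl
  | succ i ih =>
    intro M M' _ _ _ _ a f
    have : locQuotMap x (a • f) = a • locQuotMap x f := by
      refine LinearMap.ext fun u => ?_
      obtain ⟨u, rfl⟩ := Submodule.Quotient.mk_surjective _ u
      rw [LinearMap.smul_apply, locQuotMap_mk, locMap_smul]
      rfl
    change cohMap x i (locQuotMap x (a • f)) = a • cohMap x i (locQuotMap x f)
    rw [this, ih]

lemma cohMap_id (i : ℕ) : ∀ {M : Type} [AddCommGroup M] [Module A M],
    cohMap x i (LinearMap.id : M →ₗ[A] M) = LinearMap.id := by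
  induction i with
  | zero => intros; rfl
  | succ i ih =>
    intro M _ _
    have : locQuotMap x (LinearMap.id : M →ₗ[A] M) = LinearMap.id := by
      refine LinearMap.ext fun u => ?_
      obtain ⟨u, rfl⟩ := Submodule.Quotient.mk_surjective _ u
      rw [locQuotMap_mk, locMap_id]
      rfl
    change cohMap x i (locQuotMap x LinearMap.id) = _
    rw [this]
    exact ih

lemma cohMap_comp (i : ℕ) : ∀ {M M' M'' : Type} [AddCommGroup M] [Module A M] [AddCommGroup M']
    [Module A M'] [AddCommGroup M''] [Module A M''] (f : M →ₗ[A] M') (g : M' →ₗ[A] M''),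
    cohMap x i (g.comp f) = (cohMap x i g).comp (cohMap x i f) := by
  induction i with
  | zero => intros; rfl
  | succ i ih =>
    intro M M' M'' _ _ _ _ _ _ f g
    have : locQuotMap x (g.comp f) = (locQuotMap x g).comp (locQuotMap x f) := by
      refine LinearMap.ext fun u => ?_
      obtain ⟨u, rfl⟩ := Submodule.Quotient.mk_surjective _ u
      rw [LinearMap.comp_apply, locQuotMap_mk, locMap_comp]
      rfl
    change cohMap x i (locQuotMap x (g.comp f)) = (cohMap x i (locQuotMap x g)).comp
      (cohMap x i (locQuotMap x f))
    rw [this, ih]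

lemma cohMap_lsmul (i : ℕ) (a : A) : cohMap x i (a • (LinearMap.id : M →ₗ[A] M)) =
    a • LinearMap.id := by
  rw [cohMap_smul, cohMap_id]

lemma smul_coh_eq_zero (i : ℕ) {a : A} (h : ∀ m : M, a • m = 0) (u : Coh x M i) : a • u = 0 := by
  have h0 : a • (LinearMap.id : M →ₗ[A] M) = (0 : A) • LinearMap.id := by
    ext m
    simpa using h m
  have := cohMap_lsmul x (M := M) i a
  rw [h0, cohMap_lsmul, zero_smul] at this
  exact (LinearMap.congr_fun this u).symm

/-- Functoriality of `Coh` for isomorphisms. -/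
noncomputable def cohCongr (i : ℕ) (e : M ≃ₗ[A] M') : Coh x M i ≃ₗ[A] Coh x M' i :=
  LinearEquiv.ofLinearMap (cohMap x i e.toLinearMap) (cohMap x i e.symm.toLinearMap)
    (by rw [← cohMap_comp, LinearEquiv.comp_symm, cohMap_id])
    (by rw [← cohMap_comp, LinearEquiv.symm_comp, cohMap_id])

lemma exists_pow_smul_coh_eq_zero (i : ℕ) : ∀ {M : Type} [AddCommGroup M] [Module A M]
    (u : Coh x M i) (j : ι), ∃ n : ℕ, x j ^ n • u = 0 := by
  induction i with
  | zero =>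
    intro M _ _ u j
    obtain ⟨n, hn⟩ := (mem_torsionPart x).1 u.2 j
    exact ⟨n, Subtype.ext hn⟩
  | succ i ih =>
    intro M _ _ u j
    exact ih (M := LocQuot x M) u j

lemma le_radical_torsionOf (i : ℕ) (u : Coh x M i) :
    Ideal.span (Set.range x) ≤ (Ideal.torsionOf A (Coh x M i) u).radical := by
  rw [Ideal.span_le]
  rintro _ ⟨j, rfl⟩
  obtain ⟨n, hn⟩ := exists_pow_smul_coh_eq_zero x i u j
  exact ⟨n, (Ideal.mem_torsionOf_iff _ _).2 hn⟩

lemma exists_pow_smul_eq_zero (i : ℕ) (u : Coh x M i) {a : A}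
    (ha : a ∈ Ideal.span (Set.range x)) : ∃ n : ℕ, a ^ n • u = 0 := by
  obtain ⟨n, hn⟩ := le_radical_torsionOf x i u ha
  exact ⟨n, (Ideal.mem_torsionOf_iff _ _).1 hn⟩

lemma subsingleton_coh (i : ℕ) : ∀ {M : Type} [AddCommGroup M] [Module A M] [Subsingleton M],
    Subsingleton (Coh x M i) := by
  induction i with
  | zero =>
    intro M _ _ _
    exact inferInstanceAs (Subsingleton (torsionPart x M))
  | succ i ih =>
    intro M _ _ _
    have := subsingleton_locQuot x (M := M) (Subsingleton.elim _ _)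
    exact ih (M := LocQuot x M)

lemma subsingleton_coh_succ (i : ℕ) (h : torsionPart x M = ⊤) :
    Subsingleton (Coh x M (i + 1)) := by
  have := subsingleton_locQuot x h
  exact subsingleton_coh x i (M := LocQuot x M)

lemma nontrivial_coh_zero (h : torsionPart x M = ⊤) [Nontrivial M] :
    Nontrivial (Coh x M 0) := by
  obtain ⟨m, hm⟩ := exists_ne (0 : M)
  exact ⟨⟨⟨m, h ▸ Submodule.mem_top⟩, 0, fun h => hm (congr_arg Subtype.val h)⟩⟩

/-- The exactness of the segment of the long exact sequence in degrees `i` and `i + 1`. -/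
structure SegmentExact (i : ℕ) (f : M →ₗ[A] M') (g : M' →ₗ[A] M'') : Prop where
  exact_mid : Function.Exact (cohMap x i f) (cohMap x i g)
  exists_connecting : ∃ δ : Coh x M'' i →ₗ[A] Coh x M (i + 1),
    Function.Exact (cohMap x i g) δ ∧ Function.Exact δ (cohMap x (i + 1) f)

lemma range_le_torsionPart {N : Type} [AddCommGroup N] [Module A N]
    (δ : torsionPart x N →ₗ[A] M) : LinearMap.range δ ≤ torsionPart x M := by
  rintro _ ⟨u, rfl⟩
  rw [mem_torsionPart]
  intro j
  obtain ⟨n, hn⟩ := (mem_torsionPart x).1 u.2 j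
  refine ⟨n, ?_⟩
  rw [← map_smul, show x j ^ n • u = 0 from Subtype.ext hn, map_zero]

lemma torsionMap_exact {f : M →ₗ[A] M'} {g : M' →ₗ[A] M''} (hf : Function.Injective f)
    (hfg : Function.Exact f g) : Function.Exact (torsionMap x f) (torsionMap x g) := by
  intro u
  constructor
  · intro hu
    obtain ⟨v, hv⟩ := (hfg u).1 (congr_arg Subtype.val hu)
    refine ⟨⟨v, ?_⟩, Subtype.ext hv⟩
    rw [mem_torsionPart]
    intro j
    obtain ⟨n, hn⟩ := (mem_torsionPart x).1 u.2 j
    refine ⟨n, hf ?_⟩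
    rw [map_smul, hv, hn, map_zero]
  · rintro ⟨v, rfl⟩
    exact Subtype.ext (hfg.apply_apply_eq_zero v)

lemma torsionMap_surjective {f : M →ₗ[A] M'} {g : M' →ₗ[A] M''} (hf : Function.Injective f)
    (hfg : Function.Exact f g) (hg : Function.Surjective g) (h : torsionPart x M = ⊤) :
    Function.Surjective (torsionMap x g) := by
  obtain ⟨δ, h1, -⟩ := exists_connecting x hf hfg hg
  have := subsingleton_locQuot x h
  exact fun u => (h1 u).1 (Subsingleton.elim _ _)

lemma locQuotMap_bijective {f : M →ₗ[A] M'} {g : M' →ₗ[A] M''}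
    (hfg : Function.Exact f g) (hg : Function.Surjective g) (h : torsionPart x M = ⊤) :
    Function.Bijective (locQuotMap x g) := by
  refine ⟨?_, locQuotMap_surjective x hg⟩
  have := subsingleton_locQuot x h
  rw [injective_iff_map_eq_zero]
  intro u hu
  obtain ⟨v, rfl⟩ := (locQuotMap_exact x hfg hg u).1 hu
  rw [Subsingleton.elim v 0, map_zero]

lemma cohMap_bijective_of_bijective (i : ℕ) {f : M →ₗ[A] M'} (hf : Function.Bijective f) :
    Function.Bijective (cohMap x i f) :=
  (cohCongr x i (LinearEquiv.ofBijective f hf)).bijective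

lemma segmentExact_zero {f : M →ₗ[A] M'} {g : M' →ₗ[A] M''} (hf : Function.Injective f)
    (hfg : Function.Exact f g) (hg : Function.Surjective g) : SegmentExact x 0 f g := by
  refine ⟨torsionMap_exact x hf hfg, ?_⟩
  obtain ⟨δ, h1, h2⟩ := exists_connecting x hf hfg hg
  have hr := range_le_torsionPart x δ
  refine ⟨δ.codRestrict (torsionPart x (LocQuot x M)) fun u => hr ⟨u, rfl⟩, ?_, ?_⟩
  · intro u
    exact Iff.trans Subtype.ext_iff (h1 u)
  · intro u
    constructor
    · intro hu
      obtain ⟨v, hv⟩ := (h2 u.1).1 (congr_arg Subtype.val hu)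
      exact ⟨v, Subtype.ext hv⟩
    · rintro ⟨v, rfl⟩
      exact Subtype.ext (h2.apply_apply_eq_zero v)

theorem segmentExact (i : ℕ) : ∀ {M M' M'' : Type} [AddCommGroup M] [Module A M]
    [AddCommGroup M'] [Module A M'] [AddCommGroup M''] [Module A M'']
    {f : M →ₗ[A] M'} {g : M' →ₗ[A] M''}, Function.Injective f →
    Function.Exact f g → Function.Surjective g → SegmentExact x i f g := by
  induction i with
  | zero => exact fun hf hfg hg => segmentExact_zero x hf hfg hg
  | succ i ih =>
    intro M M' M'' _ _ _ _ _ _ f g hf hfg hg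
    suffices h : SegmentExact x i (locQuotMap x f) (locQuotMap x g) from ⟨h.1, h.2⟩
    obtain ⟨δ, -, h2⟩ := exists_connecting x hf hfg hg
    set T : Submodule A (LocQuot x M) := LinearMap.range δ
    have hker : T = LinearMap.ker (locQuotMap x f) := (LinearMap.exact_iff.1 h2).symm
    let f' : (LocQuot x M ⧸ T) →ₗ[A] LocQuot x M' := T.liftQ (locQuotMap x f) hker.le
    have hf' : Function.Injective f' := by
      rw [← LinearMap.ker_eq_bot]
      exact Submodule.ker_liftQ_eq_bot _ _ _ hker.ge
    have hcomp : f'.comp T.mkQ = locQuotMap x f := Submodule.liftQ_mkQ _ _ _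
    have hfg' : Function.Exact f' (locQuotMap x g) := by
      rw [LinearMap.exact_iff, Submodule.range_liftQ]
      exact LinearMap.exact_iff.1 (locQuotMap_exact x hfg hg)
    have hT : torsionPart x T = ⊤ := by
      rw [eq_top_iff]
      rintro ⟨u, hu⟩ -
      rw [mem_torsionPart]
      intro j
      obtain ⟨n, hn⟩ := (mem_torsionPart x).1 (range_le_torsionPart x δ hu) j
      exact ⟨n, Subtype.ext hn⟩
    have hTe : Function.Exact T.subtype T.mkQ := by
      rw [LinearMap.exact_iff, Submodule.ker_mkQ, Submodule.range_subtype]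
    have hsurj : Function.Surjective (cohMap x i T.mkQ) := by
      cases i with
      | zero =>
        exact torsionMap_surjective x T.subtype_injective hTe T.mkQ_surjective hT
      | succ i =>
        exact (cohMap_bijective_of_bijective x i
          (locQuotMap_bijective x hTe T.mkQ_surjective hT)).2
    have hbij : Function.Bijective (cohMap x (i + 1) T.mkQ) :=
      cohMap_bijective_of_bijective x i (locQuotMap_bijective x hTe T.mkQ_surjective hT)
    obtain ⟨hmid, δ', hδ1, hδ2⟩ := ih hf' hfg' (locQuotMap_surjective x hg)
    have hc : ∀ k, cohMap x k (locQuotMap x f) = (cohMap x k f').comp (cohMap x k T.mkQ) := by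
      intro k
      rw [← cohMap_comp, hcomp]
    refine ⟨?_, (LinearEquiv.ofBijective _ hbij).symm.toLinearMap.comp δ', ?_, ?_⟩
    · rw [hc]
      intro u
      rw [hmid u]
      constructor
      · rintro ⟨v, rfl⟩
        obtain ⟨w, rfl⟩ := hsurj v
        exact ⟨w, rfl⟩
      · rintro ⟨w, rfl⟩
        exact ⟨_, rfl⟩
    · intro u
      rw [← hδ1 u]
      simp
    · rw [hc]
      intro u
      rw [LinearMap.comp_apply, hδ2]
      constructor
      · rintro ⟨v, hv⟩
        refine ⟨v, ?_⟩
        rw [LinearMap.comp_apply, hv]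
        exact LinearEquiv.symm_apply_apply (LinearEquiv.ofBijective _ hbij) u
      · rintro ⟨v, rfl⟩
        exact ⟨v, (LinearEquiv.apply_symm_apply (LinearEquiv.ofBijective _ hbij) _).symm⟩

end Cohomology

section

open CategoryTheory Abelian

section ExtVanish

variable {R : Type} [CommRing R] (I : Ideal R)

/-- The quotient `R ⧸ I ^ n` as an object of `ModuleCat R`. -/
abbrev powQuot (n : ℕ) : ModuleCat.{0} R := ModuleCat.of R (R ⧸ I ^ n)

/-- The transition map `R ⧸ I ^ m ⟶ R ⧸ I ^ n`. -/
noncomputable def powQuotMap {n m : ℕ} (h : n ≤ m) : powQuot I m ⟶ powQuot I n :=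
  ModuleCat.ofHom (Submodule.factor (Ideal.pow_le_pow_right h))

lemma powQuotMap_comp {n m k : ℕ} (h : n ≤ m) (h' : m ≤ k) :
    powQuotMap I h' ≫ powQuotMap I h = powQuotMap I (h.trans h') := by
  apply ModuleCat.hom_ext
  ext
  rfl

/-- Every class in `Ext (R ⧸ I ^ n) M i` dies in `Ext (R ⧸ I ^ m) M i` for some `m ≥ n`. -/
def ExtVanish (i : ℕ) (M : ModuleCat.{0} R) : Prop :=
  ∀ (n : ℕ) (α : Ext (powQuot I n) M i), ∃ (m : ℕ) (h : n ≤ m),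
    (Ext.mk₀ (powQuotMap I h)).comp α (zero_add i) = 0

variable {I}

lemma ExtVanish.mid {S : ShortComplex (ModuleCat.{0} R)} (hS : S.ShortExact) {i : ℕ}
    (h₁ : ExtVanish I i S.X₁) (h₃ : ExtVanish I i S.X₃) : ExtVanish I i S.X₂ := by
  intro n α
  obtain ⟨m, hm, h⟩ := h₃ n (α.comp (Ext.mk₀ S.g) (add_zero i))
  rw [← Ext.comp_assoc_of_third_deg_zero] at h
  obtain ⟨β, hβ⟩ := Ext.covariant_sequence_exact₂ _ hS _ h
  obtain ⟨k, hk, h'⟩ := h₁ m β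
  refine ⟨k, hm.trans hk, ?_⟩
  rw [← powQuotMap_comp I hm hk, ← Ext.mk₀_comp_mk₀_assoc, ← hβ,
    ← Ext.comp_assoc_of_third_deg_zero, h', Ext.zero_comp]

lemma ExtVanish.right {S : ShortComplex (ModuleCat.{0} R)} (hS : S.ShortExact) {i : ℕ}
    (h₂ : ExtVanish I i S.X₂) (h₁ : ExtVanish I (i + 1) S.X₁) : ExtVanish I i S.X₃ := by
  intro n α
  obtain ⟨m, hm, h⟩ := h₁ n (α.comp hS.extClass rfl)
  rw [← Ext.comp_assoc _ α hS.extClass (zero_add i) rfl (by omega)] at h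
  obtain ⟨β, hβ⟩ := Ext.covariant_sequence_exact₃ _ hS _ rfl h
  obtain ⟨k, hk, h'⟩ := h₂ m β
  refine ⟨k, hm.trans hk, ?_⟩
  rw [← powQuotMap_comp I hm hk, ← Ext.mk₀_comp_mk₀_assoc, ← hβ,
    ← Ext.comp_assoc_of_third_deg_zero, h', Ext.zero_comp]

lemma ExtVanish.left {S : ShortComplex (ModuleCat.{0} R)} (hS : S.ShortExact) {i : ℕ}
    (h₃ : ExtVanish I i S.X₃) (h₂ : ExtVanish I (i + 1) S.X₂) : ExtVanish I (i + 1) S.X₁ := by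
  intro n α
  obtain ⟨m, hm, h⟩ := h₂ n (α.comp (Ext.mk₀ S.f) (add_zero _))
  rw [← Ext.comp_assoc_of_third_deg_zero] at h
  obtain ⟨β, hβ⟩ := Ext.covariant_sequence_exact₁ _ hS _ h rfl
  obtain ⟨k, hk, h'⟩ := h₃ m β
  refine ⟨k, hm.trans hk, ?_⟩
  rw [← powQuotMap_comp I hm hk, ← Ext.mk₀_comp_mk₀_assoc, ← hβ,
    ← Ext.comp_assoc _ β hS.extClass (zero_add i) rfl (by omega), h', Ext.zero_comp]

/-- The short complex attached to an exact pair of linear maps. -/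
noncomputable abbrev shortCpx {M M' M'' : Type} [AddCommGroup M] [Module R M] [AddCommGroup M']
    [Module R M'] [AddCommGroup M''] [Module R M''] (f : M →ₗ[R] M') (g : M' →ₗ[R] M'')
    (hfg : Function.Exact f g) : ShortComplex (ModuleCat.{0} R) :=
  ShortComplex.mk (ModuleCat.ofHom f) (ModuleCat.ofHom g)
    (ModuleCat.hom_ext hfg.linearMap_comp_eq_zero)

lemma shortCpx_shortExact {M M' M'' : Type} [AddCommGroup M] [Module R M] [AddCommGroup M']
    [Module R M'] [AddCommGroup M''] [Module R M''] {f : M →ₗ[R] M'} {g : M' →ₗ[R] M''}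
    (hf : Function.Injective f) (hfg : Function.Exact f g) (hg : Function.Surjective g) :
    (shortCpx f g hfg).ShortExact where
  exact := (ShortComplex.ShortExact.moduleCat_exact_iff_function_exact _).2 hfg
  mono_f := (ModuleCat.mono_iff_injective _).2 hf
  epi_g := (ModuleCat.epi_iff_surjective _).2 hg

lemma ext_powQuot_eq_zero {M : ModuleCat.{0} R} {a : R} (ha : a ∈ I)
    (h : IsUnit (algebraMap R (Module.End R M) a)) {n i : ℕ} (α : Ext (powQuot I n) M i) :
    α = 0 := by
  have h0 : a ^ n • α = 0 := by
    rw [← Ext.mk₀_id_comp (a ^ n • α), Ext.comp_smul, ← Ext.smul_comp, ← Ext.mk₀_smul]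
    have : a ^ n • 𝟙 (powQuot I n) = 0 := by
      apply ModuleCat.hom_ext
      refine LinearMap.ext fun u => ?_
      obtain ⟨u, rfl⟩ := Ideal.Quotient.mk_surjective u
      change a ^ n • Ideal.Quotient.mk (I ^ n) u = 0
      rw [← Ideal.Quotient.mk_eq_mk, ← Submodule.Quotient.mk_smul, Submodule.Quotient.mk_eq_zero]
      exact Ideal.mul_mem_right _ _ (Ideal.pow_mem_pow ha n)
    rw [this, Ext.mk₀_zero, Ext.zero_comp]
  obtain ⟨b, hb⟩ := (h.pow n).exists_left_inv
  rw [Ext.smul_eq_comp_mk₀] at h0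
  have h1 : (a ^ n • 𝟙 M) ≫ ModuleCat.ofHom b = 𝟙 M := by
    apply ModuleCat.hom_ext
    refine LinearMap.ext fun u => ?_
    have := LinearMap.congr_fun hb u
    rw [← map_pow] at this
    exact this
  rw [← Ext.comp_mk₀_id α, ← h1, ← Ext.mk₀_comp_mk₀, ← Ext.comp_assoc_of_third_deg_zero, h0,
    Ext.zero_comp]

lemma extVanish_loc {ι : Type} [Finite ι] (x : ι → R) (hx : ∀ j, x j ∈ I) (i : ℕ)
    (M : Type) [AddCommGroup M] [Module R M] : ExtVanish I i (ModuleCat.of R (Loc x M)) := by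
  classical
  have := Fintype.ofFinite ι
  intro n α
  refine ⟨n, le_rfl, ?_⟩
  have hα : α = 0 := by
    have hid : 𝟙 (ModuleCat.of R (Loc x M)) =
        ∑ j, ModuleCat.ofHom (LinearMap.proj j : Loc x M →ₗ[R] _) ≫
          ModuleCat.ofHom (LinearMap.single R (fun j => LocalizedModule (Submonoid.powers (x j)) M) j) := by
      apply ModuleCat.hom_ext
      refine LinearMap.ext fun u => ?_
      rw [ModuleCat.hom_sum, LinearMap.sum_apply]
      exact (Finset.univ_sum_single u).symm
    rw [← Ext.comp_mk₀_id α, hid, Ext.mk₀_sum, Ext.comp_sum]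
    refine Finset.sum_eq_zero fun j _ => ?_
    rw [← Ext.mk₀_comp_mk₀, ← Ext.comp_assoc_of_third_deg_zero]
    rw [ext_powQuot_eq_zero (hx j) _ (α.comp _ _), Ext.zero_comp]
    exact IsLocalizedModule.map_units
      (LocalizedModule.mkLinearMap (Submonoid.powers (x j)) M) ⟨x j, Submonoid.mem_powers _⟩
  rw [hα, Ext.comp_zero]

section

variable [IsNoetherianRing R] {ι : Type} (x : ι → R)

lemma exists_pow_le_torsionOf {M : Type} [AddCommGroup M] [Module R M] {m : M}
    (hm : m ∈ torsionPart x M) :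
    ∃ n, Ideal.span (Set.range x) ^ n ≤ Ideal.torsionOf R M m := by
  refine Ideal.exists_pow_le_of_le_radical_of_fg ?_ (IsNoetherian.noetherian _)
  rw [Ideal.span_le]
  rintro _ ⟨j, rfl⟩
  obtain ⟨n, hn⟩ := (mem_torsionPart x).1 hm j
  exact ⟨n, (Ideal.mem_torsionOf_iff _ _).2 hn⟩

lemma mem_torsionPart_of_pow_le {M : Type} [AddCommGroup M] [Module R M] {m : M} {n : ℕ}
    (h : Ideal.span (Set.range x) ^ n ≤ Ideal.torsionOf R M m) : m ∈ torsionPart x M := by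
  rw [mem_torsionPart]
  exact fun j => ⟨n, (Ideal.mem_torsionOf_iff _ _).1
    (h (Ideal.pow_mem_pow (Ideal.subset_span (Set.mem_range_self j)) n))⟩

/-- A map from a finitely generated ideal into a torsion module is killed on a high power. -/
lemma exists_pow_inf_ker {E : Type} [AddCommGroup E] [Module R E]
    (J : Ideal R) (f : J →ₗ[R] torsionPart x E) :
    ∃ m, ∀ a (ha : a ∈ J), a ∈ Ideal.span (Set.range x) ^ m → f ⟨a, ha⟩ = 0 := by
  set I := Ideal.span (Set.range x)
  let F : ℕ →o Submodule R J :=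
    { toFun := fun n =>
        { carrier := {j | ∀ a ∈ I ^ n, a • f j = 0}
          add_mem' := fun {u v} hu hv a ha => by rw [map_add, smul_add, hu a ha, hv a ha, add_zero]
          zero_mem' := fun a _ => by rw [map_zero, smul_zero]
          smul_mem' := fun c u hu a ha => by rw [map_smul, smul_comm, hu a ha, smul_zero] }
      monotone' := fun n m hnm j hj a ha => hj a (Ideal.pow_le_pow_right hnm ha) }
  obtain ⟨n, hn⟩ := monotone_stabilizes_iff_noetherian.2 (inferInstanceAs (IsNoetherian R J)) F
  have hF : ∀ j : J, ∀ a ∈ I ^ n, a • f j = 0 := by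
    intro j
    obtain ⟨k, hk⟩ := exists_pow_le_torsionOf x (f j).2
    have : j ∈ F (n + k) := fun a ha => Subtype.ext ((Ideal.mem_torsionOf_iff _ _).1
      (hk (Ideal.pow_le_pow_right (Nat.le_add_left k n) ha)))
    rw [← hn (n + k) (Nat.le_add_right n k)] at this
    exact this
  obtain ⟨k, hk⟩ := Ideal.exists_pow_inf_eq_pow_smul I (M := R) J
  refine ⟨n + k, fun a ha ham => ?_⟩
  have h1 : a ∈ I ^ n • J := by
    have h2 := hk (n + k) (Nat.le_add_left k n)
    rw [Nat.add_sub_cancel] at h2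
    refine (h2.le.trans (Submodule.smul_mono le_rfl inf_le_right)) ⟨?_, ha⟩
    simpa using ham
  have h3 : (⟨a, ha⟩ : J) ∈ I ^ n • (⊤ : Submodule R J) := by
    have : Submodule.map J.subtype (I ^ n • (⊤ : Submodule R J)) = I ^ n • J := by
      rw [Submodule.map_smul'', Submodule.map_subtype_top]
    rw [← this] at h1
    obtain ⟨b, hb, hba⟩ := h1
    rwa [show (⟨a, ha⟩ : J) = b from Subtype.ext hba.symm]
  refine Submodule.smul_induction_on h3 (fun r hr j _ => ?_) (fun u v hu hv => ?_)
  · rw [map_smul, hF j r hr]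
  · rw [map_add, hu, hv, add_zero]

lemma injective_torsionPart (E : Type) [AddCommGroup E] [Module R E] [Module.Injective R E] :
    Module.Injective R (torsionPart x E) := by
  refine Module.Baer.injective fun J f => ?_
  set I := Ideal.span (Set.range x) with hI
  obtain ⟨m, hm⟩ := exists_pow_inf_ker x J f
  let K : Submodule R J := Submodule.comap J.subtype (I ^ m)
  let f₁ : (J ⧸ K) →ₗ[R] E := K.liftQ ((torsionPart x E).subtype.comp f) (by
    rintro ⟨a, ha⟩ h
    rw [LinearMap.mem_ker, LinearMap.comp_apply, hm a ha h, map_zero])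
  let g : (J ⧸ K) →ₗ[R] (R ⧸ I ^ m) := K.mapQ (I ^ m) J.subtype le_rfl
  have hg : Function.Injective g := by
    rw [← LinearMap.ker_eq_bot]
    exact Submodule.ker_liftQ_eq_bot _ _ _ (by
      intro a ha
      rw [LinearMap.mem_ker, LinearMap.comp_apply, Submodule.mkQ_apply,
        Submodule.Quotient.mk_eq_zero] at ha
      exact ha)
  obtain ⟨h, hh⟩ := Module.Injective.out g hg f₁
  refine ⟨(h.comp (I ^ m).mkQ).codRestrict (torsionPart x E) fun r => ?_, fun a ha => ?_⟩
  · refine mem_torsionPart_of_pow_le x (n := m) fun b hb => ?_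
    rw [Ideal.mem_torsionOf_iff, ← map_smul, LinearMap.comp_apply,
      show (I ^ m).mkQ (b • r) = 0 from
        (Submodule.Quotient.mk_eq_zero _).2 (Ideal.mul_mem_right _ _ hb), map_zero]
  · exact Subtype.ext (hh (Submodule.Quotient.mk ⟨a, ha⟩))

end

end ExtVanish

end

section

open CategoryTheory Abelian

section ExtVanishIff

variable {R : Type} [CommRing R] [IsNoetherianRing R] {ι : Type} (x : ι → R)

lemma extVanish_of_injective (E : ModuleCat.{0} R) [Injective E] (I : Ideal R) (i : ℕ) :
    ExtVanish I (i + 1) E := fun n α => by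
  refine ⟨n, le_rfl, ?_⟩
  rw [Ext.eq_zero_of_injective α, Ext.comp_zero]

/-- The map `R ⧸ I ^ n ⟶ M` given by an element killed by `I ^ n`. -/
noncomputable def powQuotDesc {I : Ideal R} {n : ℕ} {M : Type} [AddCommGroup M] [Module R M]
    (m : M) (h : I ^ n ≤ Ideal.torsionOf R M m) : powQuot I n ⟶ ModuleCat.of R M :=
  ModuleCat.ofHom ((I ^ n).liftQ (LinearMap.toSpanSingleton R M m)
    (by simpa [Ideal.torsionOf] using h))

lemma powQuot_hom_ext {I : Ideal R} {n : ℕ} {M : ModuleCat.{0} R} {f g : powQuot I n ⟶ M}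
    (h : f.hom (Submodule.Quotient.mk 1) = g.hom (Submodule.Quotient.mk 1)) : f = g := by
  apply ModuleCat.hom_ext
  refine LinearMap.ext fun u => ?_
  obtain ⟨u, rfl⟩ := Submodule.Quotient.mk_surjective _ u
  rw [show (Submodule.Quotient.mk u : R ⧸ I ^ n) = u • Submodule.Quotient.mk 1 by
    rw [← Submodule.Quotient.mk_smul, smul_eq_mul, mul_one], map_smul, map_smul, h]

lemma extVanish_zero_iff (M : Type) [AddCommGroup M] [Module R M] :
    ExtVanish (Ideal.span (Set.range x)) 0 (ModuleCat.of R M) ↔ torsionPart x M = ⊥ := by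
  set I := Ideal.span (Set.range x) with hI
  constructor
  · intro h
    rw [eq_bot_iff]
    intro m hm
    obtain ⟨n, hn⟩ := exists_pow_le_torsionOf x hm
    obtain ⟨k, hk, hk'⟩ := h n (Ext.mk₀ (powQuotDesc m hn))
    rw [Ext.mk₀_comp_mk₀, Ext.mk₀_eq_zero_iff] at hk'
    have := congr_arg (fun f => f.hom (Submodule.Quotient.mk 1)) hk'
    change (1 : R) • m = 0 at this
    simpa using this
  · intro h n α
    refine ⟨n, le_rfl, ?_⟩
    obtain ⟨f, rfl⟩ := Ext.mk₀_bijective _ _ |>.2 α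
    have hf : f = 0 := by
      apply powQuot_hom_ext
      change f.hom (Submodule.Quotient.mk 1) = 0
      have : f.hom (Submodule.Quotient.mk 1) ∈ torsionPart x M := by
        refine mem_torsionPart_of_pow_le x (n := n) fun a ha => ?_
        rw [Ideal.mem_torsionOf_iff, ← map_smul, ← Submodule.Quotient.mk_smul,
          show (Submodule.Quotient.mk (a • (1 : R)) : R ⧸ I ^ n) = 0 from
            (Submodule.Quotient.mk_eq_zero _).2 (Ideal.mul_mem_right _ _ ha), map_zero]
      simpa [h] using this
    rw [hf, Ext.mk₀_zero, Ext.comp_zero]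

lemma torsionPart_quotient_eq_top {M : Type} [AddCommGroup M] [Module R M]
    (h : torsionPart x M = ⊤) (T : Submodule R M) : torsionPart x (M ⧸ T) = ⊤ := by
  rw [eq_top_iff]
  rintro u -
  obtain ⟨u, rfl⟩ := T.mkQ_surjective u
  exact map_mem_torsionPart x T.mkQ (h ▸ Submodule.mem_top)

lemma torsionPart_submodule_eq_top {M : Type} [AddCommGroup M] [Module R M]
    {T : Submodule R M} (h : T ≤ torsionPart x M) : torsionPart x T = ⊤ := by
  rw [eq_top_iff]
  rintro ⟨u, hu⟩ -
  rw [mem_torsionPart]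
  intro j
  obtain ⟨n, hn⟩ := (mem_torsionPart x).1 (h hu) j
  exact ⟨n, Subtype.ext hn⟩

/-- Torsion modules embed into torsion injective modules. -/
lemma exists_injective_torsion (T : Type) [AddCommGroup T] [Module R T]
    (hT : torsionPart x T = ⊤) : ∃ (E : Type) (_ : AddCommGroup E) (_ : Module R E)
      (f : T →ₗ[R] E), Module.Injective R E ∧ torsionPart x E = ⊤ ∧ Function.Injective f := by
  let E := Injective.under (ModuleCat.of R T)
  have : Injective (ModuleCat.of R E) := inferInstanceAs (Injective (Injective.under _))
  have : Module.Injective R E := Module.injective_module_of_injective_object R E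
  have hf : Function.Injective (Injective.ι (ModuleCat.of R T)) :=
    (ModuleCat.mono_iff_injective _).1 inferInstance
  refine ⟨torsionPart x E, inferInstance, inferInstance,
    (Injective.ι (ModuleCat.of R T)).hom.codRestrict _ fun t =>
      map_mem_torsionPart x _ (hT ▸ Submodule.mem_top), injective_torsionPart x E,
    torsionPart_submodule_eq_top x le_rfl, fun u v huv => hf (congr_arg Subtype.val huv)⟩

lemma extVanish_succ_of_torsion (i : ℕ) : ∀ (T : Type) [AddCommGroup T] [Module R T],
    torsionPart x T = ⊤ →
    ExtVanish (Ideal.span (Set.range x)) (i + 1) (ModuleCat.of R T) := by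
  induction i with
  | zero =>
    intro T _ _ hT n α
    obtain ⟨E, _, _, f, _, hE, hf⟩ := exists_injective_torsion x T hT
    have : Injective (ModuleCat.of R E) := Module.injective_object_of_injective_module R E
    have hexact := LinearMap.exact_map_mkQ_range f
    have hS := shortCpx_shortExact hf hexact (Submodule.mkQ_surjective _)
    obtain ⟨β, rfl⟩ := Ext.covariant_sequence_exact₁ _ hS α
      (Ext.eq_zero_of_injective _) (zero_add 1)
    obtain ⟨b, rfl⟩ := Ext.mk₀_bijective _ _ |>.2 β
    obtain ⟨e, he⟩ := Submodule.mkQ_surjective _ (b.hom (Submodule.Quotient.mk 1))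
    obtain ⟨m, hm⟩ := exists_pow_le_torsionOf x (m := e) (hE ▸ Submodule.mem_top)
    have hm' : Ideal.span (Set.range x) ^ (n + m) ≤ Ideal.torsionOf R E e :=
      (Ideal.pow_le_pow_right (Nat.le_add_left m n)).trans hm
    refine ⟨n + m, Nat.le_add_right n m, ?_⟩
    have hc : powQuotMap (Ideal.span (Set.range x)) (Nat.le_add_right n m) ≫ b =
        powQuotDesc e hm' ≫ (shortCpx f _ hexact).g := by
      apply powQuot_hom_ext
      refine Eq.trans ?_ (Eq.trans he.symm (congr_arg _ (one_smul R e).symm))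
      rfl
    rw [Ext.mk₀_comp_mk₀_assoc, hc, ← Ext.mk₀_comp_mk₀_assoc, hS.comp_extClass, Ext.comp_zero]
  | succ i ih =>
    intro T _ _ hT
    obtain ⟨E, _, _, f, _, hE, hf⟩ := exists_injective_torsion x T hT
    have : Injective (ModuleCat.of R E) := Module.injective_object_of_injective_module R E
    exact ExtVanish.left
      (shortCpx_shortExact hf (LinearMap.exact_map_mkQ_range f) (Submodule.mkQ_surjective _))
      (ih _ (torsionPart_quotient_eq_top x hE _)) (extVanish_of_injective _ _ _)

/-- Vanishing of `Coh x M i` in terms of the `Ext`-modules of the quotients by powers. -/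
theorem extVanish_iff [Finite ι] (i : ℕ) : ∀ (M : Type) [AddCommGroup M] [Module R M],
    ExtVanish (Ideal.span (Set.range x)) i (ModuleCat.of R M) ↔ Subsingleton (Coh x M i) := by
  induction i with
  | zero =>
    intro M _ _
    rw [extVanish_zero_iff]
    exact Submodule.subsingleton_iff_eq_bot.symm
  | succ i ih =>
    intro M _ _
    rw [show Subsingleton (Coh x M (i + 1)) ↔ Subsingleton (Coh x (LocQuot x M) i) from Iff.rfl,
      ← ih]
    have hx : ∀ j, x j ∈ Ideal.span (Set.range x) := fun j =>
      Ideal.subset_span (Set.mem_range_self j)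
    have h1 := shortCpx_shortExact (torsionPart x M).subtype_injective
      (LinearMap.exact_subtype_mkQ (torsionPart x M)) (Submodule.mkQ_surjective _)
    have hT := torsionPart_submodule_eq_top x (le_refl (torsionPart x M))
    let g : (M ⧸ torsionPart x M) →ₗ[R] Loc x M := (torsionPart x M).liftQ (toLoc x M) le_rfl
    have hg : Function.Injective g := by
      rw [← LinearMap.ker_eq_bot]
      exact Submodule.ker_liftQ_eq_bot _ _ _ le_rfl
    have hgq : Function.Exact g (LinearMap.range (toLoc x M)).mkQ := by
      rw [LinearMap.exact_iff, Submodule.ker_mkQ]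
      exact (Submodule.range_liftQ _ _ _).symm
    have h2 := shortCpx_shortExact hg hgq (Submodule.mkQ_surjective _)
    constructor
    · intro h
      exact ExtVanish.right h2 (extVanish_loc x hx i M)
        (ExtVanish.right h1 h (extVanish_succ_of_torsion x (i + 1) _ hT))
    · intro h
      exact ExtVanish.mid h1 (extVanish_succ_of_torsion x i _ hT)
        (ExtVanish.left h2 h (extVanish_loc x hx (i + 1) M))

end ExtVanishIff

end

section

open CategoryTheory Abelian Limits Opposite

section OpModuleComplex

variable {R : Type} [CommRing R] (C : ChainComplex (ModuleCat.{0} R)ᵒᵖ ℕ) (n : ℕ)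

lemma homologyι_unop_surjective : Function.Surjective (C.homologyι n).unop.hom := by
  rw [← ModuleCat.epi_iff_surjective]
  infer_instance

lemma pOpcycles_unop_injective : Function.Injective (C.pOpcycles n).unop.hom := by
  rw [← ModuleCat.mono_iff_injective]
  infer_instance

lemma homologyι_unop_eq_zero_iff (z : (C.opcycles n).unop) :
    (C.homologyι n).unop.hom z = 0 ↔
      ∃ w : (C.X ((ComplexShape.down ℕ).next n)).unop,
        (C.d n ((ComplexShape.down ℕ).next n)).unop.hom w = (C.pOpcycles n).unop.hom z := by
  set m := (ComplexShape.down ℕ).next n with hm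
  have hex : (ShortComplex.mk _ _ (C.homologyι_comp_fromOpcycles n m)).Exact :=
    ShortComplex.exact_of_f_is_kernel _ (C.homologyIsKernel n m hm.symm)
  have hu := hex.unop
  rw [ShortComplex.moduleCat_exact_iff] at hu
  have hd : (C.d n m).unop = (C.fromOpcycles n m).unop ≫ (C.pOpcycles n).unop := by
    rw [← unop_comp, C.p_fromOpcycles]
  constructor
  · intro h
    obtain ⟨w, hw⟩ := hu z h
    refine ⟨w, ?_⟩
    rw [hd, ← hw]
    rfl
  · rintro ⟨w, hw⟩
    have : z = (C.fromOpcycles n m).unop.hom w := by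
      apply pOpcycles_unop_injective C n
      rw [← hw, hd]
      rfl
    rw [this]
    have h0 := congr_arg (fun f => f.unop.hom w) (C.homologyι_comp_fromOpcycles n m)
    exact h0

lemma exists_pOpcycles_unop_eq (w : (C.X n).unop) (hw : (C.d (n + 1) n).unop.hom w = 0) :
    ∃ z, (C.pOpcycles n).unop.hom z = w := by
  have hex : (ShortComplex.mk _ _ (C.d_pOpcycles (n + 1) n)).Exact :=
    ShortComplex.exact_of_g_is_cokernel _ (C.opcyclesIsCokernel (n + 1) n (by simp))
  have hu := hex.unop
  rw [ShortComplex.moduleCat_exact_iff] at hu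
  exact hu w hw

lemma d_pOpcycles_unop (z : (C.opcycles n).unop) :
    (C.d (n + 1) n).unop.hom ((C.pOpcycles n).unop.hom z) = 0 :=
  congr_arg (fun f => f.unop.hom z) (C.d_pOpcycles (n + 1) n)

end OpModuleComplex

section OldExt

variable {R : Type} [CommRing R]

/-- A cochain on a projective resolution is a coboundary. -/
def IsCob {X Y : ModuleCat.{0} R} (P : ProjectiveResolution X) (n : ℕ)
    (f : P.complex.X n ⟶ Y) : Prop :=
  ∃ g : P.complex.X ((ComplexShape.down ℕ).next n) ⟶ Y,
    P.complex.d n ((ComplexShape.down ℕ).next n) ≫ g = f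

/-- The cocycle `f` represents the class `a`, tested after all restrictions. -/
def Represents {X Y : ModuleCat.{0} R} (P : ProjectiveResolution X) (n : ℕ)
    (a : ((_root_.Ext R (ModuleCat.{0} R) n).obj (op X)).obj Y) (f : P.complex.X n ⟶ Y) : Prop :=
  ∀ (X' : ModuleCat.{0} R) (g : X' ⟶ X) (P' : ProjectiveResolution X')
    (φ : ProjectiveResolution.Hom P' P g),
    (((_root_.Ext R (ModuleCat.{0} R) n).map g.op).app Y).hom a = 0 ↔ IsCob P' n (φ.hom.f n ≫ f)

/-- The complex in the opposite category computing `Ext`. -/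
noncomputable abbrev opCpx {X : ModuleCat.{0} R} (P : ProjectiveResolution X)
    (Y : ModuleCat.{0} R) :
    ChainComplex (ModuleCat.{0} R)ᵒᵖ ℕ :=
  (((linearYoneda R (ModuleCat.{0} R)).obj Y).rightOp.mapHomologicalComplex _).obj P.complex

lemma represents_of {X Y : ModuleCat.{0} R} (P : ProjectiveResolution X) (n : ℕ)
    (z : ((opCpx P Y).opcycles n).unop) :
    Represents P n
      ((P.isoLeftDerivedObj ((linearYoneda R (ModuleCat.{0} R)).obj Y).rightOp n).hom.unop.hom
        (((opCpx P Y).homologyι n).unop.hom z))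
      (((opCpx P Y).pOpcycles n).unop.hom z) := by
  intro X' g P' φ
  set F := ((linearYoneda R (ModuleCat.{0} R)).obj Y).rightOp with hF
  have comm : φ.hom.f 0 ≫ P.π.f 0 = P'.π.f 0 ≫ g := by
    simpa using φ.hom_f_zero_comp_π_f_zero
  have nat := P'.isoLeftDerivedObj_hom_naturality g P φ.hom comm F n
  set ψ : opCpx P' Y ⟶ opCpx P Y := (F.mapHomologicalComplex _).map φ.hom with hψ
  have nat2 := HomologicalComplex.homologyι_naturality ψ n
  have nat3 := HomologicalComplex.p_opcyclesMap ψ n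
  have e1 : (((_root_.Ext R (ModuleCat.{0} R) n).map g.op).app Y).hom
      ((P.isoLeftDerivedObj F n).hom.unop.hom (((opCpx P Y).homologyι n).unop.hom z)) =
      (P'.isoLeftDerivedObj F n).hom.unop.hom (((opCpx P' Y).homologyι n).unop.hom
        ((HomologicalComplex.opcyclesMap ψ n).unop.hom z)) := by
    have a1 := congr_arg (fun f => f.unop.hom (((opCpx P Y).homologyι n).unop.hom z)) nat
    have a2 := congr_arg (fun f => f.unop.hom z) nat2
    refine Eq.trans a1 ?_
    exact congr_arg (P'.isoLeftDerivedObj F n).hom.unop.hom a2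
  have e2 : ((opCpx P' Y).pOpcycles n).unop.hom
      ((HomologicalComplex.opcyclesMap ψ n).unop.hom z) =
      φ.hom.f n ≫ ((opCpx P Y).pOpcycles n).unop.hom z :=
    congr_arg (fun f => f.unop.hom z) nat3
  have hinj : Function.Injective (P'.isoLeftDerivedObj F n).hom.unop.hom := by
    rw [← ModuleCat.mono_iff_injective]
    infer_instance
  refine ((Eq.congr_left e1).trans (map_eq_zero_iff _ hinj)).trans ?_
  refine (homologyι_unop_eq_zero_iff _ _ _).trans ?_
  rw [e2]
  rfl

lemma exists_represents_cocycle {X Y : ModuleCat.{0} R} (P : ProjectiveResolution X) (n : ℕ)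
    (a : ((_root_.Ext R (ModuleCat.{0} R) n).obj (op X)).obj Y) :
    ∃ f : P.complex.X n ⟶ Y, P.complex.d (n + 1) n ≫ f = 0 ∧ Represents P n a f := by
  have hs : Function.Surjective (P.isoLeftDerivedObj
      ((linearYoneda R (ModuleCat.{0} R)).obj Y).rightOp n).hom.unop.hom := by
    rw [← ModuleCat.epi_iff_surjective]
    infer_instance
  obtain ⟨b, rfl⟩ := hs a
  obtain ⟨z, rfl⟩ := homologyι_unop_surjective (opCpx P Y) n b
  exact ⟨_, d_pOpcycles_unop (opCpx P Y) n z, represents_of P n z⟩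

lemma exists_represents_class {X Y : ModuleCat.{0} R} (P : ProjectiveResolution X) (n : ℕ)
    (f : P.complex.X n ⟶ Y) (hf : P.complex.d (n + 1) n ≫ f = 0) :
    ∃ a, Represents P n a f := by
  obtain ⟨z, rfl⟩ := exists_pOpcycles_unop_eq (opCpx P Y) n f hf
  exact ⟨_, represents_of P n z⟩

end OldExt

section NewExt

variable {R : Type} [CommRing R]

lemma extMk_eq_zero_iff_isCob {X Y : ModuleCat.{0} R} (P : ProjectiveResolution X) (n : ℕ)
    (f : P.complex.X n ⟶ Y) (hf : P.complex.d (n + 1) n ≫ f = 0) :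
    P.extMk f (n + 1) rfl hf = 0 ↔ IsCob P n f := by
  cases n with
  | succ n =>
    rw [P.extMk_eq_zero_iff f _ rfl hf n rfl]
    unfold IsCob
    rw [show (ComplexShape.down ℕ).next (n + 1) = n by simp]
  | zero =>
    have h1 : IsCob P 0 f ↔ f = 0 := by
      unfold IsCob
      rw [P.complex.shape 0 _ (by simp)]
      simp [eq_comm]
    rw [h1]
    constructor
    · intro h
      rw [← P.extEquivCohomologyClass.apply_eq_iff_eq,
        ProjectiveResolution.extEquivCohomologyClass_extMk,
        ProjectiveResolution.extEquivCohomologyClass_zero,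
        CochainComplex.HomComplex.CohomologyClass.mk_eq_zero_iff,
        CochainComplex.HomComplex.Cocycle.toSingleMk_mem_coboundaries_iff _ _ _ _ _ 1 (by simp)]
        at h
      obtain ⟨g, hg⟩ := h
      have hz : IsZero (P.cochainComplex.X 1) :=
        P.complex.isZero_extend_X _ _ fun i h => by
          rw [ComplexShape.embeddingDownNat_f] at h
          lia
      rw [hz.eq_of_src g 0, comp_zero] at hg
      rw [← cancel_epi (P.cochainComplexXIso (-((0 : ℕ) : ℤ)) 0 rfl).hom, comp_zero]
      exact hg.symm
    · rintro rfl
      simp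

end NewExt

section Link

variable {R : Type} [CommRing R]

/-- `ExtVanish` via cocycles. -/
lemma extVanish_iff_cocycle (I : Ideal R) (d : ℕ) (N : ModuleCat.{0} R)
    (P : ∀ n, ProjectiveResolution (powQuot I n))
    (φ : ∀ n m (h : n ≤ m), ProjectiveResolution.Hom (P m) (P n) (powQuotMap I h)) :
    ExtVanish I d N ↔ ∀ n (f : (P n).complex.X d ⟶ N), (P n).complex.d (d + 1) d ≫ f = 0 →
      ∃ m, ∃ h : n ≤ m, IsCob (P m) d ((φ n m h).hom.f d ≫ f) := by
  constructor
  · intro H n f hf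
    obtain ⟨m, h, hm⟩ := H n ((P n).extMk f (d + 1) rfl hf)
    refine ⟨m, h, ?_⟩
    rw [ProjectiveResolution.mk₀_comp_extMk _ _ _ _ (φ n m h)] at hm
    exact (extMk_eq_zero_iff_isCob _ _ _ _).1 hm
  · intro H n α
    obtain ⟨f, hf, rfl⟩ := (P n).extMk_surjective α (d + 1) rfl
    obtain ⟨m, h, hm⟩ := H n f hf
    refine ⟨m, h, ?_⟩
    rw [ProjectiveResolution.mk₀_comp_extMk _ _ _ _ (φ n m h)]
    exact (extMk_eq_zero_iff_isCob _ _ _ _).2 hm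

lemma subsingleton_colimit_iff {F : ℕᵒᵖᵒᵖ ⥤ ModuleCat.{0} R} {c : Cocone F} (hc : IsColimit c) :
    Subsingleton c.pt ↔ ∀ n (a : F.obj (op (op n))), ∃ m, ∃ h : n ≤ m,
      (F.map (homOfLE h).op.op).hom a = 0 := by
  constructor
  · intro hs n a
    have h0 : (c.ι.app (op (op n))).hom a = (c.ι.app (op (op n))).hom 0 :=
      @Subsingleton.elim c.pt hs _ _
    obtain ⟨m, f, g, hfg⟩ := Concrete.isColimit_exists_of_rep_eq _ hc a 0 h0
    refine ⟨m.unop.unop, f.unop.unop.down.down, ?_⟩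
    exact hfg.trans (map_zero _)
  · intro H
    refine subsingleton_of_forall_eq 0 fun u => ?_
    obtain ⟨n, a, rfl⟩ := Concrete.isColimit_exists_rep _ hc u
    obtain ⟨m, h, hm⟩ := H n.unop.unop a
    have hw := congr_arg (fun f => f.hom a) (c.w (show n ⟶ op (op m) from (homOfLE h).op.op))
    refine hw.symm.trans ?_
    exact (congr_arg (c.ι.app (op (op m))).hom hm).trans (map_zero _)

lemma subsingleton_localCohomology_iff (I : Ideal R) (d : ℕ) (N : ModuleCat.{0} R) :
    Subsingleton ((localCohomology I d).obj N) ↔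
      ∀ n (a : ((_root_.Ext R (ModuleCat.{0} R) d).obj (op (powQuot I n))).obj N),
      ∃ m, ∃ h : n ≤ m, (((_root_.Ext R (ModuleCat.{0} R) d).map (powQuotMap I h).op).app N).hom a
        = 0 :=
  subsingleton_colimit_iff (isColimitOfPreserves ((evaluation _ _).obj N)
    (colimit.isColimit (localCohomology.diagram (localCohomology.idealPowersDiagram I) d)))

theorem subsingleton_localCohomology_iff_extVanish (I : Ideal R) (d : ℕ) (N : ModuleCat.{0} R) :
    Subsingleton ((localCohomology I d).obj N) ↔ ExtVanish I d N := by
  let P : ∀ n, ProjectiveResolution (powQuot I n) := fun n => projectiveResolution _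
  let φ : ∀ n m (h : n ≤ m), ProjectiveResolution.Hom (P m) (P n) (powQuotMap I h) :=
    fun n m h => ⟨ProjectiveResolution.lift (powQuotMap I h) (P m) (P n),
      ProjectiveResolution.lift_commutes_zero _ _ _⟩
  rw [extVanish_iff_cocycle I d N P φ, subsingleton_localCohomology_iff]
  constructor
  · intro H n f hf
    obtain ⟨a, ha⟩ := exists_represents_class (P n) d f hf
    obtain ⟨m, h, hm⟩ := H n a
    exact ⟨m, h, (ha _ _ _ (φ n m h)).1 hm⟩
  · intro H n a
    obtain ⟨f, hf, ha⟩ := exists_represents_cocycle (P n) d a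
    obtain ⟨m, h, hm⟩ := H n f hf
    exact ⟨m, h, (ha _ _ _ (φ n m h)).2 hm⟩

theorem subsingleton_localCohomology_iff_coh [IsNoetherianRing R] {ι : Type} [Finite ι] (x : ι → R)
    (d : ℕ) (N : Type) [AddCommGroup N] [Module R N] :
    Subsingleton ((localCohomology (Ideal.span (Set.range x)) d).obj (ModuleCat.of R N)) ↔
      Subsingleton (Coh x N d) := by
  rw [subsingleton_localCohomology_iff_extVanish, extVanish_iff]

end Link

end

section

open TensorProduct

section BaseChange

variable {R : Type} [CommRing R] (B : Type) [CommRing B] [Algebra R B]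
variable {M M' : Type} [AddCommGroup M] [Module R M] [AddCommGroup M'] [Module R M']

lemma isLocalizedModule_lTensor [Module.Flat R B] (S : Submonoid R) (f : M →ₗ[R] M')
    [IsLocalizedModule S f] : IsLocalizedModule S (f.lTensor B) where
  map_units s := by
    have := (IsLocalizedModule.map_units f s).map (Module.End.lTensorAlgHom R M' B)
    rwa [AlgHom.commutes] at this
  surj y := by
    induction y with
    | zero => exact ⟨(0, 1), by simp⟩
    | tmul b u =>
      obtain ⟨⟨m, s⟩, hs⟩ := IsLocalizedModule.surj S f u
      refine ⟨(b ⊗ₜ m, s), ?_⟩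
      simp only [LinearMap.lTensor_tmul]
      rw [← hs, TensorProduct.tmul_smul]
      rfl
    | add y z hy hz =>
      obtain ⟨⟨m, s⟩, hs⟩ := hy
      obtain ⟨⟨n, t⟩, ht⟩ := hz
      refine ⟨(t • m + s • n, s * t), ?_⟩
      dsimp only at hs ht ⊢
      rw [map_add, LinearMap.map_smul_of_tower, LinearMap.map_smul_of_tower, ← hs, ← ht, smul_add,
        mul_smul, mul_smul, smul_comm s t y]
  exists_of_eq {u v} h := by
    have hex : Function.Exact ((LinearMap.ker f).subtype.lTensor B) (f.lTensor B) :=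
      Module.Flat.lTensor_exact B (LinearMap.exact_subtype_ker_map f)
    obtain ⟨w, hw⟩ := (hex (u - v)).1 (by rw [map_sub, h, sub_self])
    suffices ∃ s : S, s • ((LinearMap.ker f).subtype.lTensor B) w = 0 by
      obtain ⟨s, hs⟩ := this
      refine ⟨s, ?_⟩
      rw [hw, smul_sub, sub_eq_zero] at hs
      exact hs
    clear hw h u v
    induction w with
    | zero => exact ⟨1, by simp⟩
    | tmul b k =>
      obtain ⟨s, hs⟩ := (IsLocalizedModule.eq_zero_iff S f).1 (LinearMap.mem_ker.1 k.2)
      refine ⟨s, ?_⟩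
      rw [LinearMap.lTensor_tmul]
      refine (TensorProduct.tmul_smul (s : R) b _).symm.trans ?_
      rw [Submodule.subtype_apply, show (s : R) • (k : M) = 0 from hs, TensorProduct.tmul_zero]
    | add y z hy hz =>
      obtain ⟨s, hs⟩ := hy
      obtain ⟨t, ht⟩ := hz
      refine ⟨s * t, ?_⟩
      rw [map_add, smul_add, mul_smul, mul_smul, ht, smul_zero, smul_comm s t, hs, smul_zero,
        add_zero]

variable {ι : Type} [Finite ι] (x : ι → R)

lemma isLocalizedModule_powers_baseChange [Module.Flat R B] (r : R) (f : M →ₗ[R] M')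
    [IsLocalizedModule (.powers r) f] :
    IsLocalizedModule (.powers (algebraMap R B r)) (f.baseChange B) := by
  have h1 := isLocalizedModule_lTensor B (.powers r) f
  have h2 : IsLocalizedModule (.powers r) ((f.baseChange B).restrictScalars R) := h1
  have h3 := IsLocalizedModule.of_restrictScalars (.powers r) (f.baseChange B)
  rwa [Algebra.algebraMapSubmonoid_powers] at h3

variable (M) in
/-- Base change of the product of localizations along a flat algebra. -/
lemma exists_locBaseChange [Module.Flat R B] :
    ∃ e : (B ⊗[R] Loc x M) ≃ₗ[B] Loc (fun j => algebraMap R B (x j)) (B ⊗[R] M),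
      e.toLinearMap.comp ((toLoc x M).baseChange B) = toLoc _ (B ⊗[R] M) := by
  classical
  have := Fintype.ofFinite ι
  have h := fun j => isLocalizedModule_powers_baseChange B (x j)
    (LocalizedModule.mkLinearMap (Submonoid.powers (x j)) M)
  let e1 : (B ⊗[R] Loc x M) ≃ₗ[B] ∀ j, B ⊗[R] LocalizedModule (.powers (x j)) M :=
    TensorProduct.piRight R B B _
  let e2 : (∀ j, B ⊗[R] LocalizedModule (.powers (x j)) M) ≃ₗ[B]
      Loc (fun j => algebraMap R B (x j)) (B ⊗[R] M) :=
    LinearEquiv.piCongrRight fun j => IsLocalizedModule.linearEquiv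
      (.powers (algebraMap R B (x j)))
      ((LocalizedModule.mkLinearMap (Submonoid.powers (x j)) M).baseChange B)
      (LocalizedModule.mkLinearMap _ _)
  refine ⟨e1.trans e2, ?_⟩
  apply TensorProduct.AlgebraTensorModule.ext
  intro b m
  funext j
  change (IsLocalizedModule.linearEquiv (.powers (algebraMap R B (x j)))
      ((LocalizedModule.mkLinearMap (Submonoid.powers (x j)) M).baseChange B)
      (LocalizedModule.mkLinearMap _ _))
        (((LocalizedModule.mkLinearMap (Submonoid.powers (x j)) M).baseChange B) (b ⊗ₜ m)) =
      LocalizedModule.mkLinearMap _ _ (b ⊗ₜ m)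
  rw [IsLocalizedModule.linearEquiv_apply]

variable (M) in
lemma exists_locQuotBaseChange [Module.Flat R B] :
    Nonempty ((B ⊗[R] LocQuot x M) ≃ₗ[B]
      LocQuot (fun j => algebraMap R B (x j)) (B ⊗[R] M)) := by
  obtain ⟨e, he⟩ := exists_locBaseChange B M x
  let q := (LinearMap.range (toLoc x M)).mkQ.baseChange B
  have hq : Function.Surjective q := by
    have := LinearMap.lTensor_surjective B (Submodule.mkQ_surjective (LinearMap.range (toLoc x M)))
    exact this
  have hker : LinearMap.ker q = LinearMap.range ((toLoc x M).baseChange B) := by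
    have h1 := lTensor_exact B (LinearMap.exact_map_mkQ_range (toLoc x M))
      (Submodule.mkQ_surjective _)
    ext u
    exact h1 u
  refine ⟨((LinearMap.quotKerEquivOfSurjective q hq).symm.trans
    (Submodule.Quotient.equiv _ _ e ?_))⟩
  rw [hker, ← he, LinearMap.range_comp]

theorem subsingleton_coh_baseChange_iff [Module.FaithfullyFlat R B] (i : ℕ) :
    ∀ (M : Type) [AddCommGroup M] [Module R M],
    Subsingleton (Coh x M i) ↔
      Subsingleton (Coh (fun j => algebraMap R B (x j)) (B ⊗[R] M) i) := by
  induction i with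
  | zero =>
    intro M _ _
    obtain ⟨e, he⟩ := exists_locBaseChange B M x
    have h1 : Subsingleton (Coh x M 0) ↔ Function.Injective (toLoc x M) :=
      Submodule.subsingleton_iff_eq_bot.trans LinearMap.ker_eq_bot
    have h2 : Subsingleton (Coh (fun j => algebraMap R B (x j)) (B ⊗[R] M) 0) ↔
        Function.Injective (toLoc (fun j => algebraMap R B (x j)) (B ⊗[R] M)) :=
      Submodule.subsingleton_iff_eq_bot.trans LinearMap.ker_eq_bot
    rw [h1, h2, ← he, ← Module.FaithfullyFlat.lTensor_injective_iff_injective R B]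
    exact (e.injective.of_comp_iff _).symm
  | succ i ih =>
    intro M _ _
    obtain ⟨e⟩ := exists_locQuotBaseChange B M x
    exact (ih (LocQuot x M)).trans (cohCongr _ i e).toEquiv.subsingleton_congr

end BaseChange

end

section CompletionNoetherian

variable {R : Type} [CommRing R]

lemma factorPow_comp_quotientMap {P : Type} [CommRing P] (J : Ideal P) (I : Ideal R) (f : P →+* R)
    (h : J ≤ I.comap f) {m n : ℕ} (hle : m ≤ n) :
    (Ideal.Quotient.factorPow I hle).comp ((Ideal.quotientMap (I ^ n) f
      ((Ideal.pow_right_mono h n).trans (Ideal.le_comap_pow f n))).comp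
        (AdicCompletion.evalₐ J n : AdicCompletion J P →+* P ⧸ J ^ n)) =
    (Ideal.quotientMap (I ^ m) f
      ((Ideal.pow_right_mono h m).trans (Ideal.le_comap_pow f m))).comp
        (AdicCompletion.evalₐ J m : AdicCompletion J P →+* P ⧸ J ^ m) := by
  ext x
  obtain ⟨x, rfl⟩ := AdicCompletion.mk_surjective J P x
  simp only [RingHom.comp_apply, RingHom.coe_coe, AdicCompletion.evalₐ_mk, Ideal.quotientMap_mk]
  have h1 : x m - x n ∈ J ^ m :=
    Ideal.Quotient.eq.1 (AdicCompletion.Ideal.mk_eq_mk J hle x).symm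
  refine Ideal.Quotient.eq.2 ?_
  rw [← neg_mem_iff, neg_sub, ← map_sub]
  exact (Ideal.pow_right_mono h m).trans (Ideal.le_comap_pow f m) h1

/-- The ring map on completions induced by a ring map carrying `J` into `I`. -/
noncomputable def completionMap {P : Type} [CommRing P] (J : Ideal P) (I : Ideal R) (f : P →+* R)
    (h : J ≤ I.comap f) : AdicCompletion J P →+* AdicCompletion I R :=
  AdicCompletion.liftRingHom I
    (fun n => (Ideal.quotientMap (I ^ n) f
      ((Ideal.pow_right_mono h n).trans (Ideal.le_comap_pow f n))).comp
        (AdicCompletion.evalₐ J n : AdicCompletion J P →+* P ⧸ J ^ n))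
    (factorPow_comp_quotientMap J I f h)

theorem completionMap_algebraMap {P : Type} [CommRing P] (J : Ideal P) (I : Ideal R) (f : P →+* R)
    (h : J ≤ I.comap f) (p : P) :
    completionMap J I f h (algebraMap P _ p) = algebraMap R _ (f p) := by
  refine AdicCompletion.ext_evalₐ fun n => ?_
  exact AdicCompletion.evalₐ_liftRingHom I _ (factorPow_comp_quotientMap J I f h) n _

theorem isNoetherianRing_completion [IsNoetherianRing R] (I : Ideal R) :
    IsNoetherianRing (AdicCompletion I R) := by
  obtain ⟨n, a, ha⟩ := Submodule.fg_iff_exists_fin_generating_family.1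
    (IsNoetherian.noetherian I)
  let f : MvPolynomial (Fin n) R →+* R := (MvPolynomial.aeval a).toRingHom
  have hf : (MvPolynomial.idealOfVars (Fin n) R).map f = I := by
    rw [MvPolynomial.idealOfVars, Ideal.map_span, ← Set.range_comp, ← ha]
    congr 2
    ext i
    simp [f]
  let J := MvPolynomial.idealOfVars (Fin n) R
  let φ := completionMap J I f (Ideal.map_le_iff_le_comap.1 hf.le)
  have : IsNoetherianRing (AdicCompletion J (MvPolynomial (Fin n) R)) :=
    isNoetherianRing_of_ringEquiv _ (MvPowerSeries.toAdicCompletionAlgEquiv (Fin n) R).toRingEquiv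
  have : IsAdicComplete J (AdicCompletion J (MvPolynomial (Fin n) R)) :=
    AdicCompletion.isAdicComplete (MvPolynomial.idealOfVars_fg _ R)
  have h1 : IsAdicComplete (J.map (algebraMap _ (AdicCompletion J (MvPolynomial (Fin n) R))))
      (AdicCompletion J (MvPolynomial (Fin n) R)) := (IsAdicComplete.map_algebraMap_iff _ _).2 this
  have h2 : (J.map (algebraMap _ (AdicCompletion J (MvPolynomial (Fin n) R)))).map φ =
      I.map (algebraMap R (AdicCompletion I R)) := by
    rw [Ideal.map_map]
    refine Eq.trans ?_ (congrArg (Ideal.map (algebraMap R (AdicCompletion I R))) hf)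
    rw [Ideal.map_map]
    refine congrArg (fun g => Ideal.map g J) ?_
    exact RingHom.ext fun p => completionMap_algebraMap J I f (Ideal.map_le_iff_le_comap.1 hf.le) p
  have h3 : IsAdicComplete (I.map (algebraMap R (AdicCompletion I R))) (AdicCompletion I R) :=
    AdicCompletion.isAdicComplete_self I (IsNoetherian.noetherian I)
  have hs : Function.Surjective φ := by
    have := h3.toIsHausdorff
    rw [← h2] at this
    refine surjective_of_mk_map_comp_surjective (I := J.map (algebraMap _ _)) φ ?_
    rw [h2]
    intro y
    obtain ⟨y, rfl⟩ := Ideal.Quotient.mk_surjective y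
    obtain ⟨r, hr⟩ := Ideal.Quotient.mk_surjective (AdicCompletion.evalOneₐ I y)
    refine ⟨algebraMap (MvPolynomial (Fin n) R) _ (MvPolynomial.C r), ?_⟩
    rw [RingHom.comp_apply]
    refine Ideal.Quotient.eq.2 ?_
    rw [completionMap_algebraMap, ← AdicCompletion.ker_evalOneₐ_eq_map I
      (IsNoetherian.noetherian I), RingHom.mem_ker, map_sub]
    have : f (MvPolynomial.C r) = r := by simp [f]
    rw [this]
    exact sub_eq_zero.2 hr
  exact isNoetherianRing_of_surjective _ _ φ hs

end CompletionNoetherian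

section IntegralClosure

variable {R : Type} [CommRing R] {N : Type} [AddCommGroup N] [Module R N]

lemma smul_mem_ideal_smul_pointwise {J : Ideal R} {P : Submodule R N} (a : R) {t : N} (ht : t ∈ J • P) :
    a • t ∈ J • (a • P) := by
  have : a • t ∈ (J • P).map (LinearMap.lsmul R N a) := ⟨t, ht, rfl⟩
  rw [Submodule.map_smul''] at this
  exact this

lemma mem_smul_of_le {J : Ideal R} {P Q : Submodule R N} (h : P ≤ Q) {t : N} (ht : t ∈ J • P) :
    t ∈ J • Q :=
  (smul_mono_right J h : J • P ≤ J • Q) ht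

lemma pow_smul_mem_pow_smul {J : Ideal R} {F : Submodule R N} {w : R}
    (h : ∀ t ∈ F, w • t ∈ J • F) (j : ℕ) : ∀ t ∈ F, w ^ j • t ∈ J ^ j • F := by
  induction j with
  | zero => intro t ht; simpa using ht
  | succ j ih =>
    intro t ht
    have h1 : w ^ j • F ≤ J ^ j • F := by
      rintro _ ⟨u, hu, rfl⟩
      exact ih u hu
    rw [pow_succ w, mul_smul, pow_succ' J, mul_smul J]
    exact mem_smul_of_le h1 (smul_mem_ideal_smul_pointwise (w ^ j) (h t ht))

lemma exists_pow_add_smul_mem_of_relIntDep {J : Ideal R} {x : R} (h : J.RelIntDep N x) :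
    ∃ e, ∀ j (m : N), x ^ (j + e) • m ∈ J ^ j • (⊤ : Submodule R N) := by
  obtain ⟨n, hn, h⟩ := h
  set T : Submodule R N := ⨆ i ∈ Finset.range n, x ^ (n - 1 - i) • (J ^ i • (⊤ : Submodule R N))
    with hT
  have hle : ∀ i < n, x ^ (n - 1 - i) • (J ^ i • (⊤ : Submodule R N)) ≤ T := fun i hi =>
    le_iSup₂_of_le i (Finset.mem_range.2 hi) le_rfl
  have key : ∀ i, 1 ≤ i → i ≤ n → x ^ (n - i) • (J ^ i • (⊤ : Submodule R N)) ≤ J • T := by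
    intro i h1 h2
    obtain ⟨i, rfl⟩ := Nat.exists_eq_add_of_le' h1
    rintro _ ⟨u, hu, rfl⟩
    have hu : u ∈ J ^ (i + 1) • (⊤ : Submodule R N) := hu
    rw [pow_succ', mul_smul] at hu
    refine mem_smul_of_le (hle i h2) ?_
    rw [show n - 1 - i = n - (i + 1) by omega]
    exact smul_mem_ideal_smul_pointwise _ hu
  have hxT : ∀ t ∈ T, x • t ∈ J • T := by
    suffices T ≤ (J • T).comap (LinearMap.lsmul R N x) from fun t ht => this ht
    refine iSup₂_le fun i hi => ?_
    have hi := Finset.mem_range.1 hi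
    rintro _ ⟨u, hu, rfl⟩
    have hu : u ∈ J ^ i • (⊤ : Submodule R N) := hu
    change x • x ^ (n - 1 - i) • u ∈ J • T
    rw [← mul_smul, ← pow_succ']
    rcases Nat.eq_zero_or_pos i with rfl | hi0
    · rw [show n - 1 - 0 + 1 = n by omega]
      exact (iSup₂_le fun i hi => key i (Finset.mem_Icc.1 hi).1 (Finset.mem_Icc.1 hi).2 :
        (⨆ i ∈ Finset.Icc 1 n, x ^ (n - i) • (J ^ i • (⊤ : Submodule R N))) ≤ J • T) (h u)
    · rw [show n - 1 - i + 1 = n - i by omega]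
      exact key i hi0 hi.le ⟨u, hu, rfl⟩
  refine ⟨n - 1, fun j m => ?_⟩
  rw [pow_add, mul_smul]
  refine mem_smul_of_le le_top (pow_smul_mem_pow_smul hxT j _ ?_)
  refine hle 0 hn ⟨m, by simp, ?_⟩
  simp

lemma relIntDep_of_stable {J : Ideal R} {w : R} {F : Submodule R N} (hF : F.FG)
    (h : ∀ t ∈ F, w • t ∈ J • F) {c : ℕ} (hc : ∀ m : N, w ^ c • m ∈ F) : J.RelIntDep N w := by
  have : Module.Finite R F := Module.Finite.of_fg hF
  have hr : LinearMap.range (LinearMap.lsmul R F w) ≤ J • ⊤ := by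
    rintro _ ⟨t, rfl⟩
    have h1 := h t t.2
    have h2 : F.subtype (w • t) ∈ (J • (⊤ : Submodule R F)).map F.subtype := by
      rw [Submodule.map_smul'', Submodule.map_top, Submodule.range_subtype]
      exact h1
    obtain ⟨u, hu, hu'⟩ := h2
    rwa [F.injective_subtype hu'] at hu
  obtain ⟨p, hp, -, hpc, hp0⟩ :=
    LinearMap.exists_monic_and_natDegree_eq_and_coeff_mem_pow_and_aeval_eq_zero R
      (LinearMap.lsmul R F w) J hr
  have hev : ∀ t : F, p.eval w • t = 0 := by
    intro t
    have h1 : Polynomial.aeval (LinearMap.lsmul R F w) p = LinearMap.lsmul R F (p.eval w) := by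
      have := Polynomial.aeval_algHom_apply (Algebra.lsmul R R F) w p
      rw [Polynomial.coe_aeval_eq_eval] at this
      exact this
    rw [h1] at hp0
    exact LinearMap.congr_fun hp0 t
  set k := p.natDegree
  refine ⟨k + c + 1, by omega, fun m => ?_⟩
  have hs := hev ⟨w ^ c • (w • m), by rw [smul_comm]; exact F.smul_mem _ (hc m)⟩
  rw [Polynomial.eval_eq_sum_range, Finset.sum_range_succ] at hs
  have hs := congrArg F.subtype hs
  simp only [map_smul, map_zero] at hs
  change (_ + _) • (w ^ c • w • m) = 0 at hs
  rw [add_smul, hp.coeff_natDegree, one_mul,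
    show w ^ c • w • m = w ^ (c + 1) • m by rw [pow_succ, mul_smul], ← mul_smul, ← mul_smul,
    ← pow_add] at hs
  rw [add_assoc, (eq_neg_of_add_eq_zero_right hs), neg_mem_iff, Finset.sum_mul,
    Finset.sum_smul]
  refine Submodule.sum_mem _ fun i hi => ?_
  have hi := Finset.mem_range.1 hi
  refine Submodule.mem_iSup_of_mem (k - i) (Submodule.mem_iSup_of_mem
    (Finset.mem_Icc.2 ⟨by omega, by omega⟩) ?_)
  refine ⟨p.coeff i • m, Submodule.smul_mem_smul (hpc i) trivial, ?_⟩
  change w ^ (k + (c + 1) - (k - i)) • p.coeff i • m = _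
  rw [show k + (c + 1) - (k - i) = i + (c + 1) by omega, smul_smul, pow_add w i]
  congr 1
  ring

lemma exists_stable_of_pow_smul_mem [IsNoetherianRing R] [Module.Finite R N] {J : Ideal R}
    {v x : R} {e : ℕ}
    (h : ∀ j, ∃ M, ∀ m : N, (v ^ M * x ^ (j + e)) • m ∈ J ^ j • (⊤ : Submodule R N)) :
    ∃ M c, ∃ F : Submodule R N, (∀ t ∈ F, (v ^ M * x) • t ∈ J • F) ∧
      ∀ m : N, (v ^ M * x) ^ c • m ∈ F := by
  choose M0 hM0 using h
  let M : ℕ → ℕ := fun n => ∑ i ∈ Finset.range (n + 1), M0 i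
  have hMs : ∀ n, M n ≤ M (n + 1) := fun n => by
    simp only [M]; rw [Finset.sum_range_succ _ (n + 1)]; omega
  have hM0M : ∀ n, M0 n ≤ M n := fun n => by
    simp only [M]; rw [Finset.sum_range_succ _ n]; omega
  let c : ℕ → R := fun i => v ^ M i * x ^ (i + e)
  have hc : ∀ i (m : N), c i • m ∈ J ^ i • (⊤ : Submodule R N) := fun i m => by
    have : c i = v ^ (M i - M0 i) * (v ^ M0 i * x ^ (i + e)) := by
      rw [← mul_assoc, ← pow_add, Nat.sub_add_cancel (hM0M i)]
    rw [this, mul_smul]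
    exact Submodule.smul_mem _ _ (hM0 i m)
  have hcs : ∀ i (P : Submodule R N), c (i + 1) • P ≤ (x * v ^ (M (i + 1) - M i)) • (c i • P) := by
    rintro i P _ ⟨u, hu, rfl⟩
    refine ⟨c i • u, ⟨u, hu, rfl⟩, ?_⟩
    change (x * v ^ (M (i + 1) - M i)) • c i • u = c (i + 1) • u
    rw [← mul_smul]
    congr 1
    simp only [c]
    rw [show M (i + 1) = (M (i + 1) - M i) + M i by have := hMs i; omega]
    rw [Nat.add_sub_cancel]
    ring
  let F : ℕ → Submodule R N := fun n =>
    ⨆ i ∈ Finset.range (n + 1), J ^ (n - i) • (c i • (⊤ : Submodule R N))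
  have hFle : ∀ n i, i ≤ n → J ^ (n - i) • (c i • (⊤ : Submodule R N)) ≤ F n := fun n i hi =>
    le_iSup₂_of_le i (Finset.mem_range.2 (by omega)) le_rfl
  have hcF : ∀ n, c n • (⊤ : Submodule R N) ≤ F n := fun n => by
    simpa using hFle n n le_rfl
  have hmono : ∀ n, F (n + 1) ≤ F n := fun n => iSup₂_le fun i hi => by
    have hi := Finset.mem_range.1 hi
    rcases Nat.lt_succ_iff_lt_or_eq.1 hi with hi | rfl
    · refine le_trans ?_ (hFle n i (by omega))
      exact Submodule.smul_mono_left (Ideal.pow_le_pow_right (by omega))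
    · rw [Nat.sub_self, pow_zero, Ideal.one_eq_top, Submodule.top_smul]
      refine (hcs n ⊤).trans (le_trans ?_ (hcF n))
      rintro _ ⟨u, hu, rfl⟩
      exact Submodule.smul_mem _ _ hu
  have hsmul : ∀ n, J • F n ≤ F (n + 1) := fun n => by
    rw [Submodule.smul_iSup]
    refine iSup_le fun i => ?_
    rw [Submodule.smul_iSup]
    refine iSup_le fun hi => ?_
    have hi := Finset.mem_range.1 hi
    rw [← mul_smul, ← pow_succ', show n - i + 1 = n + 1 - i by omega]
    exact hFle _ _ (by omega)
  let 𝓕 : J.Filtration N := ⟨F, hmono, hsmul⟩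
  have h𝓕 : 𝓕 ≤ J.stableFiltration ⊤ := fun n => iSup₂_le fun i hi => by
    have hi := Finset.mem_range.1 hi
    have : c i • (⊤ : Submodule R N) ≤ J ^ i • ⊤ := by
      rintro _ ⟨u, hu, rfl⟩
      exact hc i u
    refine (smul_mono_right _ this).trans ?_
    rw [← mul_smul, ← pow_add, Nat.sub_add_cancel (by omega)]
    exact le_rfl
  obtain ⟨n, hn⟩ := (J.stableFiltration_stable (⊤ : Submodule R N)).of_le h𝓕
  have hn : J • F n = F (n + 1) := hn n le_rfl
  refine ⟨M (n + 1), n + e + 1, F n, ?_, fun m => ?_⟩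
  · suffices F n ≤ (J • F n).comap (LinearMap.lsmul R N (v ^ M (n + 1) * x)) from
      fun t ht => this ht
    have hMi : ∀ i ≤ n, M (i + 1) ≤ M (n + 1) := fun i hi =>
      (monotone_nat_of_le_succ hMs) (by omega)
    have hi1 : ∀ i ≤ n, (v ^ M (n + 1) * x) • (c i • (⊤ : Submodule R N)) ≤ c (i + 1) • ⊤ := by
      rintro i hi _ ⟨_, ⟨u, -, rfl⟩, rfl⟩
      refine ⟨(v ^ (M (n + 1) - M (i + 1)) * v ^ M i) • u, trivial, ?_⟩
      change c (i + 1) • (v ^ (M (n + 1) - M (i + 1)) * v ^ M i) • u =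
        (v ^ M (n + 1) * x) • c i • u
      rw [← mul_smul, ← mul_smul]
      congr 1
      simp only [c]
      rw [show M (n + 1) = (M (n + 1) - M (i + 1)) + M (i + 1) by have := hMi i hi; omega]
      rw [Nat.add_sub_cancel]
      ring
    refine iSup₂_le fun i hi => ?_
    have hi := Finset.mem_range.1 hi
    intro t ht
    have h1 : (v ^ M (n + 1) * x) • t ∈ J ^ (n - i) • (c (i + 1) • (⊤ : Submodule R N)) :=
      mem_smul_of_le (hi1 i (by omega)) (smul_mem_ideal_smul_pointwise _ ht)
    change (v ^ M (n + 1) * x) • t ∈ J • F n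
    rw [hn]
    rw [show n - i = n + 1 - (i + 1) by omega] at h1
    exact hFle _ _ (by omega) h1
  · have : (v ^ M (n + 1) * x) ^ (n + e + 1) =
        (v ^ (M (n + 1) * (n + e) + (M (n + 1) - M n)) * x) * c n := by
      simp only [c]
      rw [mul_pow, ← pow_mul, show M (n + 1) * (n + e + 1) =
        M (n + 1) * (n + e) + (M (n + 1) - M n) + M n by have := hMs n; rw [mul_add]; omega]
      ring
    rw [this, mul_smul]
    exact Submodule.smul_mem _ _ (hcF n ⟨m, trivial, rfl⟩)

theorem relIntDep_iff [IsNoetherianRing R] [Module.Finite R N] {J : Ideal R} {x : R} :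
    J.RelIntDep N x ↔ ∃ e, ∀ j (m : N), x ^ (j + e) • m ∈ J ^ j • (⊤ : Submodule R N) := by
  refine ⟨exists_pow_add_smul_mem_of_relIntDep, fun ⟨e, he⟩ => ?_⟩
  obtain ⟨M, c, F, hF, hc⟩ := exists_stable_of_pow_smul_mem (v := 1) (x := x) (J := J) (N := N)
    fun j => ⟨0, fun m => by simpa using he j m⟩
  simp only [one_pow, one_mul] at hF hc
  exact relIntDep_of_stable (IsNoetherian.noetherian F) hF hc

theorem exists_pow_mul_relIntDep [IsNoetherianRing R] [Module.Finite R N] {J : Ideal R}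
    {v x : R} {e : ℕ}
    (h : ∀ j, ∃ M, ∀ m : N, (v ^ M * x ^ (j + e)) • m ∈ J ^ j • (⊤ : Submodule R N)) :
    ∃ M, J.RelIntDep N (v ^ M * x) := by
  obtain ⟨M, c, F, hF, hc⟩ := exists_stable_of_pow_smul_mem h
  exact ⟨M, relIntDep_of_stable (IsNoetherian.noetherian F) hF hc⟩

theorem relIntDep_of_smul_mem [Module.Finite R N] {J : Ideal R} {z : R}
    (h : ∀ m : N, z • m ∈ J • (⊤ : Submodule R N)) : J.RelIntDep N z :=
  relIntDep_of_stable Module.Finite.fg_top (fun t _ => h t) (c := 0) fun _ => trivial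

theorem relIntDep_mono [IsNoetherianRing R] [Module.Finite R N] {J J' : Ideal R} (hJ : J ≤ J')
    {x : R} (h : J.RelIntDep N x) : J'.RelIntDep N x := by
  obtain ⟨e, he⟩ := relIntDep_iff.1 h
  exact relIntDep_iff.2 ⟨e, fun j m =>
    Submodule.smul_mono_left (Ideal.pow_right_mono hJ j) (he j m)⟩

/-- The relative integral closure, as an ideal. -/
def relIntClosureIdeal [IsNoetherianRing R] (J : Ideal R) (N : Type) [AddCommGroup N] [Module R N]
    [Module.Finite R N] : Ideal R where
  carrier := J.relIntClosure N
  zero_mem' := relIntDep_iff.2 ⟨1, fun j m => by simp⟩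
  add_mem' := by
    intro x y hx hy
    obtain ⟨e, he⟩ := relIntDep_iff.1 hx
    obtain ⟨e', he'⟩ := relIntDep_iff.1 hy
    have key : ∀ {z : R} {e : ℕ}, (∀ j (m : N), z ^ (j + e) • m ∈ J ^ j • (⊤ : Submodule R N)) →
        ∀ a (m : N), z ^ a • m ∈ J ^ (a - e) • (⊤ : Submodule R N) := by
      intro z e h a m
      rcases le_total e a with ha | ha
      · simpa [Nat.sub_add_cancel ha] using h (a - e) m
      · simp [Nat.sub_eq_zero_of_le ha]
    refine relIntDep_iff.2 ⟨e + e', fun j m => ?_⟩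
    rw [add_pow, Finset.sum_smul]
    refine Submodule.sum_mem _ fun a ha => ?_
    have ha := Finset.mem_range.1 ha
    rw [mul_comm, mul_smul, mul_smul]
    refine Submodule.smul_mem _ _ ?_
    have h1 : x ^ a • y ^ (j + (e + e') - a) • m ∈
        J ^ (j + (e + e') - a - e') • J ^ (a - e) • (⊤ : Submodule R N) := by
      refine mem_smul_of_le ?_ (smul_mem_ideal_smul_pointwise (x ^ a) (key he' _ m))
      rintro _ ⟨u, -, rfl⟩
      exact key he a u
    rw [← mul_smul, ← pow_add] at h1
    exact Submodule.smul_mono_left (Ideal.pow_le_pow_right (by omega)) h1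
  smul_mem' := by
    intro r x hx
    obtain ⟨e, he⟩ := relIntDep_iff.1 hx
    refine relIntDep_iff.2 ⟨e, fun j m => ?_⟩
    rw [smul_eq_mul, mul_pow, mul_smul]
    exact Submodule.smul_mem _ _ (he j m)

theorem mem_relIntClosureIdeal [IsNoetherianRing R] [Module.Finite R N] {J : Ideal R} {x : R} :
    x ∈ relIntClosureIdeal J N ↔ J.RelIntDep N x := Iff.rfl

end IntegralClosure

section SeparationOfIntegralClosures

variable {A : Type} [CommRing A] {M : Type} [AddCommGroup M] [Module A M]

lemma mem_radical_of_smul_mem [Module.Finite A M] {J : Ideal A} {w : A}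
    (h : ∀ m : M, w • m ∈ J • (⊤ : Submodule A M)) :
    w ∈ (J ⊔ Module.annihilator A M).radical := by
  obtain ⟨p, hp, -, hpc, hp0⟩ :=
    LinearMap.exists_monic_and_natDegree_eq_and_coeff_mem_pow_and_aeval_eq_zero A
      (LinearMap.lsmul A M w) J (by rintro _ ⟨m, rfl⟩; exact h m)
  have hev : p.eval w ∈ Module.annihilator A M := by
    rw [Module.mem_annihilator]
    intro t
    have h1 : Polynomial.aeval (LinearMap.lsmul A M w) p = LinearMap.lsmul A M (p.eval w) := by
      have := Polynomial.aeval_algHom_apply (Algebra.lsmul A A M) w p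
      rw [Polynomial.coe_aeval_eq_eval] at this
      exact this
    rw [h1] at hp0
    exact LinearMap.congr_fun hp0 t
  refine ⟨p.natDegree, ?_⟩
  rw [Polynomial.eval_eq_sum_range, Finset.sum_range_succ, hp.coeff_natDegree, one_mul] at hev
  have h2 : ∑ x ∈ Finset.range p.natDegree, p.coeff x * w ^ x ∈ J := by
    refine J.sum_mem fun i hi => J.mul_mem_right _ ?_
    exact Ideal.pow_le_self (by have := Finset.mem_range.1 hi; omega) (hpc i)
  have := sub_mem (Ideal.mem_sup_right hev : _ ∈ J ⊔ Module.annihilator A M)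
    (Ideal.mem_sup_left h2)
  rwa [add_sub_cancel_left] at this

lemma mem_of_smul_mem_prime [Module.Finite A M] {p : Ideal A} [hp : p.IsPrime]
    (hM : Module.annihilator A M ≤ p) {w : A}
    (h : ∀ m : M, w • m ∈ p • (⊤ : Submodule A M)) : w ∈ p := by
  have := mem_radical_of_smul_mem h
  rwa [sup_eq_left.2 hM, hp.radical] at this

lemma eq_of_mem_minimalPrimes_sup_span [IsNoetherianRing A] {Q P P' : Ideal A} [Q.IsPrime]
    [P'.IsPrime] {z : A} (hP : P ∈ (Q ⊔ Ideal.span {z}).minimalPrimes) (h1 : Q < P')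
    (h2 : P' ≤ P) : P' = P := by
  by_contra hne
  have hlt := lt_of_le_of_ne h2 hne
  have hPp := hP.1.1
  have hh := Ideal.map_height_le_one_of_mem_minimalPrimes hP
  have hc : ∀ K : Ideal A, Q ≤ K → (K.map (Ideal.Quotient.mk Q)).comap (Ideal.Quotient.mk Q) = K :=
    fun K hK => by
      rw [Ideal.comap_map_of_surjective _ Ideal.Quotient.mk_surjective, ← RingHom.ker_eq_comap_bot,
        Ideal.mk_ker, sup_eq_left.2 hK]
  have hm : ∀ K K' : Ideal A, Q ≤ K → Q ≤ K' → K < K' →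
      K.map (Ideal.Quotient.mk Q) < K'.map (Ideal.Quotient.mk Q) := by
    intro K K' hK hK' h
    refine lt_of_le_of_ne (Ideal.map_mono h.le) fun he => h.ne ?_
    rw [← hc K hK, ← hc K' hK', he]
  have hprime : ∀ K : Ideal A, Q ≤ K → K.IsPrime → (K.map (Ideal.Quotient.mk Q)).IsPrime :=
    fun K hK _ => Ideal.map_isPrime_of_surjective Ideal.Quotient.mk_surjective (by rwa [Ideal.mk_ker])
  have hQP : Q ≤ P := h1.le.trans h2
  have hPq := hprime P hQP hPp
  have hP'q := hprime P' h1.le ‹_›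
  have hQq := hprime Q le_rfl ‹_›
  have h3 : (P'.map (Ideal.Quotient.mk Q)).height < 1 :=
    Ideal.height_le_iff.1 hh _ hP'q (hm _ _ h1.le hQP hlt)
  have h4 : (P'.map (Ideal.Quotient.mk Q)).height ≤ 0 := (Order.lt_one_iff.1 h3).le
  have h5 := Ideal.height_le_iff.1 h4 _ hQq (hm _ _ le_rfl h1.le h1)
  exact absurd h5 not_lt_zero

/-- A prime containing `q`, contained in `p`, avoiding `y ∈ p` and such that `p` is minimal over
its sum with `y`. -/
lemma exists_prime_mem_minimalPrimes_sup_span [IsNoetherianRing A] {q p : Ideal A} [hq : q.IsPrime]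
    [hp : p.IsPrime] (hqp : q ≤ p) {y : A} (hyq : y ∉ q) (hyp : y ∈ p) :
    ∃ Q : Ideal A, Q.IsPrime ∧ q ≤ Q ∧ y ∉ Q ∧ p ∈ (Q ⊔ Ideal.span {y}).minimalPrimes := by
  obtain ⟨(Q : Ideal A), ⟨hQ, hqQ, hQp, hyQ⟩, hmax⟩ := set_has_maximal_iff_noetherian.2
    (inferInstance : IsNoetherian A A) {Q : Ideal A | Q.IsPrime ∧ q ≤ Q ∧ Q ≤ p ∧ y ∉ Q}
    ⟨q, hq, le_rfl, hqp, hyq⟩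
  refine ⟨Q, hQ, hqQ, hyQ, ?_⟩
  set J : Ideal A := Q ⊔ Ideal.span {y} with hJ
  have hJp : J ≤ p := sup_le hQp ((Ideal.span_singleton_le_iff_mem _).2 hyp)
  by_contra hnm
  have hz : ∃ z ∈ p, ∀ P ∈ J.minimalPrimes, z ∉ P := by
    by_contra! hcon
    obtain ⟨P, hP, hpP⟩ := (Ideal.subset_union_prime_finite
      J.finite_minimalPrimes_of_isNoetherianRing (f := id) 0 0
        fun _ h _ _ => h.1.1).1 (show (p : Set A) ⊆ _ from fun z hz => by
          obtain ⟨P, hP, hzP⟩ := hcon z hz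
          exact Set.mem_biUnion hP hzP)
    have : p = P := le_antisymm hpP (hP.2 ⟨hp, hJp⟩ hpP)
    exact hnm (this ▸ hP)
  obtain ⟨z, hzp, hz⟩ := hz
  obtain ⟨Q', hQ', hQ'p⟩ := Ideal.exists_minimalPrimes_le
    (sup_le hQp ((Ideal.span_singleton_le_iff_mem p).2 hzp) : Q ⊔ Ideal.span {z} ≤ p)
  have hQQ' : Q ≤ Q' := le_sup_left.trans hQ'.1.2
  have hzQ' : z ∈ Q' := hQ'.1.2 (Ideal.mem_sup_right (Ideal.mem_span_singleton_self z))
  have hQ'pr := hQ'.1.1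
  by_cases hyQ' : y ∈ Q'
  · obtain ⟨P, hP, hPQ'⟩ := Ideal.exists_minimalPrimes_le
      (sup_le hQQ' ((Ideal.span_singleton_le_iff_mem Q').2 hyQ') : J ≤ Q')
    have hyP : y ∈ P := hP.1.2 (Ideal.mem_sup_right (Ideal.mem_span_singleton_self y))
    have := hP.1.1
    have hQP : Q < P := lt_of_le_of_ne (le_sup_left.trans hP.1.2) fun h => hyQ (h ▸ hyP)
    have := eq_of_mem_minimalPrimes_sup_span hQ' hQP hPQ'
    exact hz P hP (this ▸ hzQ')
  · obtain ⟨P, hP⟩ := Ideal.exists_minimalPrimes_le hJp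
    refine hmax Q' ⟨hQ'pr, hqQ.trans hQQ', hQ'p, hyQ'⟩ (lt_of_le_of_ne hQQ' fun h => ?_)
    exact hz P hP.1 ((le_sup_left.trans hP.1.1.2 : Q ≤ P) (h ▸ hzQ'))

lemma exists_smul_pow_le_of_mem_minimalPrimes [IsNoetherianRing A] {J p : Ideal A}
    (hp : p ∈ J.minimalPrimes) : ∃ g ∉ p, ∃ n, ∀ a ∈ p ^ n, g * a ∈ J := by
  have hpp := hp.1.1
  have hfin := J.finite_minimalPrimes_of_isNoetherianRing
  have hg : ∃ g ∉ p, ∀ P ∈ J.minimalPrimes, P ≠ p → g ∈ P := by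
    have h1 : ¬ (hfin.toFinset.erase p).inf id ≤ p := by
      rw [hpp.inf_le']
      rintro ⟨P, hP, hPp⟩
      obtain ⟨hne, hP⟩ := Finset.mem_erase.1 hP
      have hP := hfin.mem_toFinset.1 hP
      exact hne (le_antisymm hPp (hp.2 hP.1 hPp))
    obtain ⟨g, hg, hgp⟩ := Set.not_subset.1 h1
    refine ⟨g, hgp, fun P hP hne => ?_⟩
    exact (Finset.inf_le (Finset.mem_erase.2 ⟨hne, hfin.mem_toFinset.2 hP⟩) :
      (hfin.toFinset.erase p).inf id ≤ id P) hg
  obtain ⟨g, hgp, hg⟩ := hg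
  have h2 : Ideal.span {g} * p ≤ J.radical := by
    rw [← Ideal.sInf_minimalPrimes]
    refine le_sInf fun P hP => ?_
    by_cases h : P = p
    · exact h ▸ Ideal.mul_le_right
    · exact Ideal.mul_le_left.trans ((Ideal.span_singleton_le_iff_mem P).2 (hg P hP h))
  obtain ⟨n, hn⟩ := Ideal.exists_pow_le_of_le_radical_of_fg h2 (IsNoetherian.noetherian _)
  refine ⟨g ^ n, fun h => hgp (hpp.mem_of_pow_mem n h), n, fun a ha => hn ?_⟩
  rw [mul_pow]
  exact Ideal.mul_mem_mul (Ideal.pow_mem_pow (Ideal.mem_span_singleton_self g) n) ha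

/-- An element outside a prime `q` of the support cannot lie, locally at a prime `p ⊇ I + q`, in
the integral closures of all the powers of `I`. -/
theorem mem_of_forall_exists_relIntDep [IsNoetherianRing A] [Module.Finite A M]
    {I p q : Ideal A} [hp : p.IsPrime] [hq : q.IsPrime] (hM : Module.annihilator A M ≤ q)
    (hIp : I ≤ p) (hqp : q ≤ p) {y : A}
    (h : ∀ k, ∃ g ∉ p, (I ^ k).RelIntDep M (g * y)) : y ∈ q := by
  by_contra hyq
  have hyp : y ∈ p := by
    obtain ⟨g, hg, hgy⟩ := h 1
    obtain ⟨e, he⟩ := relIntDep_iff.1 hgy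
    have h1 : (g * y) ^ (1 + e) ∈ p := mem_of_smul_mem_prime (hM.trans hqp) fun m =>
      Submodule.smul_mono_left (by rwa [pow_one, pow_one]) (he 1 m)
    exact (hp.mem_or_mem (hp.mem_of_pow_mem _ h1)).resolve_left hg
  obtain ⟨Q, hQ, hqQ, hyQ, hpm⟩ := exists_prime_mem_minimalPrimes_sup_span hqp hyq hyp
  have hQp : Q ≤ p := le_sup_left.trans hpm.1.2
  obtain ⟨G, hGp, n, hG⟩ := exists_smul_pow_le_of_mem_minimalPrimes hpm
  obtain ⟨g, hgp, hg⟩ := h (2 * n)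
  obtain ⟨e, he⟩ := relIntDep_iff.1 hg
  set c : A := G ^ (2 * (e + 1)) * g ^ (e + 1 + e) with hc
  have hcp : c ∉ p := fun h => (hp.mem_or_mem h).elim (fun h => hGp (hp.mem_of_pow_mem _ h))
    fun h => hgp (hp.mem_of_pow_mem _ h)
  have hideal : Ideal.span {G ^ (2 * (e + 1))} * ((I ^ (2 * n)) ^ (e + 1)) ≤
      Ideal.span {y ^ (2 * (e + 1))} ⊔ Q := by
    have h1 : Ideal.span {G} * I ^ n ≤ Q ⊔ Ideal.span {y} := Ideal.mul_le.2 fun a ha b hb => by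
      obtain ⟨a, rfl⟩ := Ideal.mem_span_singleton'.1 ha
      rw [mul_assoc]
      exact Ideal.mul_mem_left _ _ (hG b (Ideal.pow_right_mono hIp n hb))
    have h2 : Ideal.span {G ^ (2 * (e + 1))} * ((I ^ (2 * n)) ^ (e + 1)) =
        (Ideal.span {G} * I ^ n) ^ (2 * (e + 1)) := by
      rw [mul_pow, Ideal.span_singleton_pow, ← pow_mul, ← pow_mul]
      congr 2
      ring
    rw [h2]
    refine (Ideal.pow_right_mono h1 _).trans ?_
    have hpow : ∀ k, (Q ⊔ Ideal.span {y}) ^ k ≤ Ideal.span {y ^ k} ⊔ Q := by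
      intro k
      induction k with
      | zero => simp
      | succ k ih =>
        rw [pow_succ]
        refine (Ideal.mul_mono_left ih).trans ?_
        rw [Ideal.mul_sup, Ideal.sup_mul _ _ (Ideal.span {y}),
          Ideal.span_singleton_mul_span_singleton, ← pow_succ]
        exact sup_le (Ideal.mul_le_right.trans le_sup_right)
          (sup_le le_sup_left (Ideal.mul_le_left.trans le_sup_right))
    exact hpow _
  let M' := M ⧸ (Q • (⊤ : Submodule A M))
  let L : Submodule A M' := LinearMap.range (LinearMap.lsmul A M' (y ^ (2 * e + 1)))
  have hL : ∀ t : L, c • t ∈ Ideal.span {y} • (⊤ : Submodule A L) := by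
    rintro ⟨_, u, rfl⟩
    obtain ⟨m, rfl⟩ := Submodule.Quotient.mk_surjective _ u
    have h1 : c • y ^ (2 * e + 1) • m ∈
        (Ideal.span {y ^ (2 * (e + 1))} ⊔ Q) • (⊤ : Submodule A M) := by
      refine Submodule.smul_mono_left hideal ?_
      rw [mul_smul]
      have : c • y ^ (2 * e + 1) • m = G ^ (2 * (e + 1)) • (g * y) ^ (e + 1 + e) • m := by
        rw [hc, smul_smul, smul_smul]
        congr 1
        rw [show 2 * e + 1 = e + 1 + e by ring]
        ring
      rw [this]
      exact Submodule.smul_mem_smul (Ideal.mem_span_singleton_self _) (he (e + 1) m)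
    rw [Submodule.sup_smul] at h1
    obtain ⟨a, ha, b, hb, hab⟩ := Submodule.mem_sup.1 h1
    rw [Submodule.ideal_span_singleton_smul] at ha
    obtain ⟨a, -, rfl⟩ := ha
    have h2 : (⟨LinearMap.lsmul A M' (y ^ (2 * e + 1)) (Submodule.Quotient.mk m), _, rfl⟩ : L) ∈
      (⊤ : Submodule A L) := trivial
    have h3 : c • (⟨LinearMap.lsmul A M' (y ^ (2 * e + 1)) (Submodule.Quotient.mk m), _, rfl⟩ : L)
        = y • (⟨LinearMap.lsmul A M' (y ^ (2 * e + 1)) (Submodule.Quotient.mk a), _, rfl⟩ : L) := by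
      refine Subtype.ext ?_
      change c • y ^ (2 * e + 1) • (Submodule.Quotient.mk m : M') =
        y • y ^ (2 * e + 1) • (Submodule.Quotient.mk a : M')
      rw [← Submodule.Quotient.mk_smul, ← Submodule.Quotient.mk_smul, ← Submodule.Quotient.mk_smul,
        ← Submodule.Quotient.mk_smul, Submodule.Quotient.eq, ← hab]
      have : y • y ^ (2 * e + 1) • a = y ^ (2 * (e + 1)) • a := by
        rw [← mul_smul, ← pow_succ']; congr 1
      rw [this]
      change y ^ (2 * (e + 1)) • a + b - y ^ (2 * (e + 1)) • a ∈ _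
      rwa [add_sub_cancel_left]
    rw [h3]
    exact Submodule.smul_mem_smul (Ideal.mem_span_singleton_self _) trivial
  have hfin : Module.Finite A L := Module.Finite.of_fg (IsNoetherian.noetherian _)
  obtain ⟨k, hk⟩ := mem_radical_of_smul_mem hL
  have hann : Module.annihilator A L ≤ Q := by
    intro b hb
    rw [Module.mem_annihilator] at hb
    have h1 : b * y ^ (2 * e + 1) ∈ Q := mem_of_smul_mem_prime (hM.trans hqQ) fun m => by
      have := congrArg Subtype.val (hb ⟨_, (Submodule.Quotient.mk m : M'), rfl⟩)
      rw [mul_smul]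
      exact (Submodule.Quotient.mk_eq_zero _).1 this
    exact (hQ.mem_or_mem h1).resolve_right fun h => hyQ (hQ.mem_of_pow_mem _ h)
  exact hcp (hp.mem_of_pow_mem k (sup_le ((Ideal.span_singleton_le_iff_mem _).2 hyp)
    (hann.trans hQp) hk))

end SeparationOfIntegralClosures

section ResidueHull
open CategoryTheory IsLocalRing

variable (A : Type) [CommRing A] [IsLocalRing A]

/-- An injective module whose socle is one-dimensional over the residue field. -/
structure IsResidueHull (E : Type) [AddCommGroup E] [Module A E] : Prop where
  injective : Module.Injective A E
  exists_socle : ∃ e : E, e ≠ 0 ∧ (∀ a ∈ maximalIdeal A, a • e = 0) ∧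
    ∀ w : E, (∀ a ∈ maximalIdeal A, a • w = 0) → w ∈ Submodule.span A {e}

lemma exists_injective_with_socle_element : ∃ (Q : Type) (_ : AddCommGroup Q) (_ : Module A Q),
    Module.Injective A Q ∧ ∃ e : Q, e ≠ 0 ∧ ∀ a ∈ maximalIdeal A, a • e = 0 := by
  let k : ModuleCat.{0} A := ModuleCat.of A (A ⧸ maximalIdeal A)
  let Q : ModuleCat.{0} A := Injective.under k
  have hinj : Injective (ModuleCat.of A Q) := inferInstanceAs (Injective (Injective.under k))
  refine ⟨Q, inferInstance, inferInstance, Module.injective_module_of_injective_object A Q,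
    (Injective.ι k).hom (1 : A ⧸ maximalIdeal A),
    ?_, fun a ha => ?_⟩
  · intro h
    have h1 : Function.Injective (Injective.ι k).hom := (ModuleCat.mono_iff_injective _).1 inferInstance
    have h2 : (1 : A ⧸ maximalIdeal A) = 0 := h1 (h.trans (map_zero _).symm)
    exact one_ne_zero h2
  · rw [← map_smul]
    refine Eq.trans (congrArg _ ?_) (map_zero _)
    change a • (Ideal.Quotient.mk (maximalIdeal A) 1) = 0
    rw [← Ideal.Quotient.mk_eq_mk, ← Submodule.Quotient.mk_smul, Submodule.Quotient.mk_eq_zero]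
    simpa using ha

theorem exists_isResidueHull : ∃ (E : Type) (_ : AddCommGroup E) (_ : Module A E),
    IsResidueHull A E := by
  obtain ⟨Q, _, _, hQ, e, he, hme⟩ := exists_injective_with_socle_element A
  have hunit : ∀ {w w' : Q} {a : A}, (∀ b ∈ maximalIdeal A, b • w = 0) → a • w = w' → w' ≠ 0 →
      ∃ b : A, b • w' = w := by
    intro w w' a hw h h'
    have ha : IsUnit a := by
      by_contra ha
      exact h' (h ▸ hw a ((mem_maximalIdeal a).2 ha))
    obtain ⟨b, hb⟩ := ha.exists_left_inv
    exact ⟨b, by rw [← h, smul_smul, hb, one_smul]⟩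
  obtain ⟨E, heE, hE⟩ := zorn_le_nonempty₀
    {W : Submodule A Q | ∀ w ∈ W, w ≠ 0 → ∃ a : A, a • w = e}
    (fun c hc hchain W hW => ⟨sSup c, fun w hw hw0 => by
      obtain ⟨V, hV, hwV⟩ := (Submodule.mem_sSup_of_directed ⟨W, hW⟩ hchain.directedOn).1 hw
      exact hc hV w hwV hw0, fun _ => le_sSup⟩)
    (Submodule.span A {e}) (fun w hw hw0 => by
      obtain ⟨a, h⟩ := Submodule.mem_span_singleton.1 hw
      exact hunit hme h hw0)
  have heE : e ∈ E := heE (Submodule.mem_span_singleton_self e)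
  obtain ⟨C, -, hC⟩ := zorn_le_nonempty₀ {W : Submodule A Q | e ∉ W}
    (fun c hc hchain W hW => ⟨sSup c, fun h => by
      obtain ⟨V, hV, h'⟩ := (Submodule.mem_sSup_of_directed ⟨W, hW⟩ hchain.directedOn).1 h
      exact hc hV h', fun _ => le_sSup⟩) ⊥ (fun h => he ((Submodule.mem_bot A).1 h))
  obtain ⟨g, hg⟩ := hQ.out (C.mkQ ∘ₗ E.subtype) (by
    rw [← LinearMap.ker_eq_bot, LinearMap.ker_eq_bot']
    intro w hw
    by_contra h0
    obtain ⟨a, ha⟩ := hE.1 w w.2 fun h => h0 (Subtype.ext h)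
    exact hC.1 (ha ▸ C.smul_mem a ((Submodule.Quotient.mk_eq_zero C).1 hw))) E.subtype
  have hge : g (C.mkQ e) = e := hg ⟨e, heE⟩
  have hrange : LinearMap.range g ≤ E := by
    refine hE.2 ?_ fun w hw => ⟨C.mkQ w, hg ⟨w, hw⟩⟩
    rintro _ ⟨u, rfl⟩ hu
    obtain ⟨u, rfl⟩ := C.mkQ_surjective u
    have huC : u ∉ C := fun h => hu (by
      rw [show C.mkQ u = 0 from (Submodule.Quotient.mk_eq_zero C).2 h, map_zero])
    have h1 : e ∈ C ⊔ Submodule.span A {u} := by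
      by_contra h
      exact huC (hC.2 h le_sup_left
        (Submodule.mem_sup_right (Submodule.mem_span_singleton_self u)))
    obtain ⟨c, hc, v, hv, hcv⟩ := Submodule.mem_sup.1 h1
    obtain ⟨a, rfl⟩ := Submodule.mem_span_singleton.1 hv
    refine ⟨a, ?_⟩
    rw [← map_smul, ← map_smul, ← hge, ← hcv, map_add,
      show C.mkQ c = 0 from (Submodule.Quotient.mk_eq_zero C).2 hc, zero_add]
  let r : Q →ₗ[A] E := (g ∘ₗ C.mkQ).codRestrict E fun u => hrange ⟨_, rfl⟩
  have hr : ∀ w : E, r w = w := fun w => Subtype.ext (hg w)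
  refine ⟨E, inferInstance, inferInstance, ⟨⟨?_⟩, ⟨e, heE⟩, fun h => he (congrArg Subtype.val h),
    fun a ha => Subtype.ext (hme a ha), fun w hw => ?_⟩⟩
  · intro X Y _ _ _ _ f hf h
    obtain ⟨h', hh'⟩ := hQ.out f hf (E.subtype ∘ₗ h)
    exact ⟨r ∘ₗ h', fun u => by rw [LinearMap.comp_apply, hh']; exact hr _⟩
  · by_cases hw0 : w = 0
    · exact hw0 ▸ zero_mem _
    obtain ⟨a, ha⟩ := hE.1 w w.2 fun h => hw0 (Subtype.ext h)
    obtain ⟨b, hb⟩ := hunit (fun b hb => congrArg Subtype.val (hw b hb)) ha he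
    exact Submodule.mem_span_singleton.2 ⟨b, Subtype.ext hb⟩

end ResidueHull

section Cofinite
open IsLocalRing

variable {A : Type} [CommRing A] [IsLocalRing A] {E : Type} [AddCommGroup E] [Module A E]
variable {H H' H'' : Type} [AddCommGroup H] [Module A H] [AddCommGroup H'] [Module A H']
  [AddCommGroup H''] [Module A H'']

lemma lcomp_surjective (hE : IsResidueHull A E) {f : H →ₗ[A] H'} (hf : Function.Injective f) :
    Function.Surjective (f.lcomp A E) := fun φ => by
  obtain ⟨h, hh⟩ := hE.injective.out f hf φ
  exact ⟨h, LinearMap.ext hh⟩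

lemma lcomp_exact (hE : IsResidueHull A E) {f : H →ₗ[A] H'} {g : H' →ₗ[A] H''}
    (hfg : Function.Exact f g) : Function.Exact (g.lcomp A E) (f.lcomp A E) := by
  intro φ
  constructor
  · intro h
    have hker : LinearMap.ker g ≤ LinearMap.ker φ := by
      intro w hw
      obtain ⟨u, rfl⟩ := (hfg w).1 hw
      exact LinearMap.congr_fun h u
    obtain ⟨ψ, hψ⟩ := hE.injective.out ((LinearMap.ker g).liftQ g le_rfl)
      (LinearMap.ker_eq_bot.1 (Submodule.ker_liftQ_eq_bot _ _ _ le_rfl))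
      ((LinearMap.ker g).liftQ φ hker)
    exact ⟨ψ, LinearMap.ext fun w => hψ (Submodule.Quotient.mk w)⟩
  · rintro ⟨ψ, rfl⟩
    exact LinearMap.ext fun u => by
      change ψ (g (f u)) = 0
      rw [(hfg _).2 ⟨u, rfl⟩, map_zero]

lemma eq_zero_of_forall_hom (hE : IsResidueHull A E) {h : H} (hh : ∀ φ : H →ₗ[A] E, φ h = 0) :
    h = 0 := by
  by_contra h0
  obtain ⟨e, he, hme, -⟩ := hE.exists_socle
  let f : (A ⧸ LinearMap.ker (LinearMap.toSpanSingleton A H h)) →ₗ[A] H :=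
    (LinearMap.ker (LinearMap.toSpanSingleton A H h)).liftQ _ le_rfl
  have hle : LinearMap.ker (LinearMap.toSpanSingleton A H h) ≤
      LinearMap.ker (LinearMap.toSpanSingleton A E e) := by
    intro a ha
    refine hme a ((mem_maximalIdeal a).2 fun hu => h0 ?_)
    obtain ⟨b, hb⟩ := hu.exists_left_inv
    have ha : a • h = 0 := ha
    rw [← one_smul A h, ← hb, mul_smul, ha, smul_zero]
  obtain ⟨φ, hφ⟩ := hE.injective.out f
    (LinearMap.ker_eq_bot.1 (Submodule.ker_liftQ_eq_bot _ _ _ le_rfl))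
    ((LinearMap.ker (LinearMap.toSpanSingleton A H h)).liftQ _ hle)
  have h1 := hφ (Submodule.Quotient.mk 1)
  have h2 : φ ((1 : A) • h) = (1 : A) • e := h1
  rw [one_smul, one_smul, hh φ] at h2
  exact he h2.symm

lemma smul_eq_zero_of_forall_hom (hE : IsResidueHull A E) {c : A}
    (hc : ∀ φ : H →ₗ[A] E, c • φ = 0) (h : H) : c • h = 0 :=
  eq_zero_of_forall_hom hE fun φ => by
    rw [map_smul]
    exact LinearMap.congr_fun (hc φ) h

variable (E H) in
/-- A module whose elements are killed by powers of the maximal ideal and whose dual is finitely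
generated. -/
structure Cofinite : Prop where
  torsion : ∀ h : H, ∃ n, ∀ a ∈ maximalIdeal A ^ n, a • h = 0
  finite : Module.Finite A (H →ₗ[A] E)

variable [IsNoetherianRing A]

lemma exists_pow_smul_eq_zero_of_forall_mem_pow {w : H} {n : ℕ}
    (hw : ∀ b ∈ maximalIdeal A ^ n, ∃ k, ∀ a ∈ maximalIdeal A ^ k, a • b • w = 0) :
    ∃ k, ∀ a ∈ maximalIdeal A ^ k, a • w = 0 := by
  classical
  obtain ⟨s, hs⟩ := IsNoetherian.noetherian (maximalIdeal A ^ n)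
  have key : ∀ t : Finset A, (t : Set A) ⊆ (maximalIdeal A ^ n : Ideal A) →
      ∃ k, ∀ a ∈ maximalIdeal A ^ k, ∀ b ∈ t, a • b • w = 0 := by
    intro t
    induction t using Finset.induction_on with
    | empty => exact fun _ => ⟨0, by simp⟩
    | insert b t _ ih =>
      intro ht
      rw [Finset.coe_insert, Set.insert_subset_iff] at ht
      obtain ⟨k, hk⟩ := ih ht.2
      obtain ⟨l, hl⟩ := hw b ht.1
      refine ⟨k + l, fun a ha c hc => ?_⟩
      rcases Finset.mem_insert.1 hc with rfl | hc
      · exact hl a (Ideal.pow_le_pow_right (by omega) ha)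
      · exact hk a (Ideal.pow_le_pow_right (by omega) ha) c hc
  obtain ⟨k, hk⟩ := key s (hs ▸ Submodule.subset_span)
  refine ⟨k + n, fun c hc => ?_⟩
  rw [pow_add] at hc
  refine Submodule.mul_induction_on hc (fun a ha b hb => ?_) fun a b ha hb => by
    rw [add_smul, ha, hb, add_zero]
  have hle : Submodule.span A (s : Set A) ≤
      LinearMap.ker (LinearMap.toSpanSingleton A H (a • w)) := by
    rw [Submodule.span_le]
    intro b hb
    change b • a • w = 0
    rw [smul_comm]
    exact hk a ha b hb
  have := hle (hs ▸ hb)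
  rw [mul_comm, mul_smul]
  exact this

lemma Cofinite.of_exact (hE : IsResidueHull A E) {f : H →ₗ[A] H'} {g : H' →ₗ[A] H''}
    (hfg : Function.Exact f g) (h : Cofinite (A := A) E H) (h'' : Cofinite (A := A) E H'') :
    Cofinite (A := A) E H' := by
  refine ⟨fun w => ?_, ?_⟩
  · obtain ⟨n, hn⟩ := h''.torsion (g w)
    refine exists_pow_smul_eq_zero_of_forall_mem_pow (n := n) fun b hb => ?_
    obtain ⟨u, hu⟩ := (hfg (b • w)).1 (by rw [map_smul, hn b hb])
    obtain ⟨k, hk⟩ := h.torsion u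
    exact ⟨k, fun a ha => by rw [← hu, ← map_smul, hk a ha, map_zero]⟩
  · have := h.finite
    have := h''.finite
    exact ⟨Submodule.fg_of_fg_map_of_fg_inf_ker (f.lcomp A E)
      (IsNoetherian.noetherian _) (by
        rw [top_inf_eq, (LinearMap.exact_iff.1 (lcomp_exact hE hfg))]
        exact Submodule.FG.of_finite)⟩

lemma Cofinite.of_subsingleton [Subsingleton H] : Cofinite (A := A) E H :=
  ⟨fun _ => ⟨0, fun _ _ => Subsingleton.elim _ _⟩, inferInstance⟩

lemma Cofinite.of_injective (hE : IsResidueHull A E) {f : H →ₗ[A] H'} (hf : Function.Injective f)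
    (h : Cofinite (A := A) E H') : Cofinite (A := A) E H := by
  refine of_exact hE (H := PUnit) (f := 0) (g := f) ?_ .of_subsingleton h
  exact (LinearMap.exact_zero_iff_injective _ _).2 hf

lemma Cofinite.of_surjective (hE : IsResidueHull A E) {f : H →ₗ[A] H'}
    (hf : Function.Surjective f) (h : Cofinite (A := A) E H) : Cofinite (A := A) E H' := by
  refine of_exact hE (H'' := PUnit) (f := f) (g := 0) ?_ h .of_subsingleton
  exact (LinearMap.exact_zero_iff_surjective _ _).2 hf

lemma Cofinite.quotient_maximalIdeal (hE : IsResidueHull A E) :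
    Cofinite (A := A) E (A ⧸ maximalIdeal A) := by
  refine ⟨fun h => ⟨1, fun a ha => ?_⟩, ?_⟩
  · obtain ⟨b, rfl⟩ := Ideal.Quotient.mk_surjective h
    rw [← Ideal.Quotient.mk_eq_mk, ← Submodule.Quotient.mk_smul, Submodule.Quotient.mk_eq_zero]
    exact Ideal.mul_mem_right _ _ (by simpa using ha)
  · obtain ⟨e, -, -, he⟩ := hE.exists_socle
    let T : ((A ⧸ maximalIdeal A) →ₗ[A] E) →ₗ[A] Submodule.span A {e} :=
      (LinearMap.applyₗ (1 : A ⧸ maximalIdeal A)).codRestrict _ fun φ => he _ fun a ha => by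
        change a • φ 1 = 0
        rw [← map_smul]
        refine Eq.trans (congrArg φ ?_) (map_zero φ)
        change a • (Ideal.Quotient.mk (maximalIdeal A) 1) = 0
        rw [← Ideal.Quotient.mk_eq_mk, ← Submodule.Quotient.mk_smul, Submodule.Quotient.mk_eq_zero]
        simpa using ha
    refine Module.Finite.of_injective T fun φ ψ h => LinearMap.ext fun u => ?_
    obtain ⟨b, rfl⟩ := Ideal.Quotient.mk_surjective u
    have h1 : φ 1 = ψ 1 := congrArg Subtype.val h
    have h2 : Ideal.Quotient.mk (maximalIdeal A) b = b • 1 := by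
      rw [Algebra.smul_def, mul_one]; rfl
    rw [h2, map_smul, map_smul, h1]

lemma isPrecomplete_pi {ι : Type} [Fintype ι] (J : Ideal A) [IsPrecomplete J A] :
    IsPrecomplete J (ι → A) := by
  classical
  have hco : ∀ n (u v : ι → A), u ≡ v [SMOD (J ^ n • ⊤ : Submodule A (ι → A))] ↔
      ∀ i, u i ≡ v i [SMOD (J ^ n • ⊤ : Submodule A A)] := by
    intro n u v
    simp only [SModEq.sub_mem]
    constructor
    · intro h i
      have := Submodule.mem_map_of_mem (f := LinearMap.proj (R := A) (φ := fun _ : ι => A) i) h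
      rw [Submodule.map_smul''] at this
      exact mem_smul_of_le le_top this
    · intro h
      rw [pi_eq_sum_univ (u - v)]
      refine Submodule.sum_mem _ fun i _ => Submodule.smul_mem_smul ?_ trivial
      simpa using h i
  refine ⟨fun f hf => ?_⟩
  have h1 : ∀ i, ∃ L : A, ∀ n, f n i ≡ L [SMOD (J ^ n • ⊤ : Submodule A A)] := fun i =>
    IsPrecomplete.prec' (fun n => f n i) fun {m n} h => (hco m _ _).1 (hf h) i
  choose L hL using h1
  exact ⟨L, fun n => (hco n _ _).2 fun i => hL i n⟩

/-- An `y`-power torsion module is cofinite as soon as the kernel of `y` is. -/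
theorem Cofinite.of_ker_smul [IsPrecomplete (maximalIdeal A) A] (hE : IsResidueHull A E) {y : A}
    (hy : y ∈ maximalIdeal A) (htor : ∀ h : H, ∃ n, y ^ n • h = 0)
    (hker : Cofinite (A := A) E (LinearMap.ker (LinearMap.lsmul A H y))) :
    Cofinite (A := A) E H := by
  have htorsion : ∀ n (h : H), y ^ n • h = 0 → ∃ k, ∀ a ∈ maximalIdeal A ^ k, a • h = 0 := by
    intro n
    induction n with
    | zero => exact fun h hh => ⟨0, fun a _ => by rw [← one_smul A h, ← pow_zero y, hh, smul_zero]⟩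
    | succ n ih =>
      intro h hh
      obtain ⟨k, hk⟩ := ih (y • h) (by rw [smul_smul, ← pow_succ, hh])
      refine exists_pow_smul_eq_zero_of_forall_mem_pow (n := k) fun b hb => ?_
      obtain ⟨l, hl⟩ := hker.torsion ⟨b • h, by
        change y • b • h = 0
        rw [smul_comm, hk b hb]⟩
      exact ⟨l, fun a ha => congrArg Subtype.val (hl a ha)⟩
  have htors : ∀ h : H, ∃ k, ∀ a ∈ maximalIdeal A ^ k, a • h = 0 := fun h =>
    (htor h).elim fun n hn => htorsion n h hn
  refine ⟨htors, ?_⟩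
  have hfin := hker.finite
  obtain ⟨n, π, hπ⟩ := Module.Finite.exists_fin' A
    (LinearMap.ker (LinearMap.lsmul A H y) →ₗ[A] E)
  have hres := lcomp_surjective hE
    (Submodule.injective_subtype (LinearMap.ker (LinearMap.lsmul A H y)))
  obtain ⟨f, hf⟩ := Module.projective_lifting_property _ π hres
  have hexact := lcomp_exact hE (LinearMap.exact_subtype_ker_map (LinearMap.lsmul A H y))
  have hpre : IsPrecomplete (maximalIdeal A) (Fin n → A) := isPrecomplete_pi _
  have hhaus : IsHausdorff (maximalIdeal A) (H →ₗ[A] E) := by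
    refine ⟨fun φ hφ => LinearMap.ext fun h => ?_⟩
    obtain ⟨k, hk⟩ := htors h
    have h1 := hφ k
    rw [SModEq.zero] at h1
    refine Submodule.smul_induction_on (p := fun φ => φ h = 0) h1 (fun a ha ψ _ => ?_)
      fun ψ χ h1 h2 => by rw [LinearMap.add_apply, h1, h2, add_zero]
    rw [LinearMap.smul_apply, ← map_smul, hk a ha, map_zero]
  have hsurj : Function.Surjective f := by
    refine surjective_of_mkQ_comp_surjective (I := maximalIdeal A) fun u => ?_
    obtain ⟨φ, rfl⟩ := Submodule.mkQ_surjective _ u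
    obtain ⟨v, hv⟩ := hπ (LinearMap.lcomp A E (Submodule.subtype _) φ)
    refine ⟨v, ?_⟩
    rw [← hf] at hv
    obtain ⟨ψ, hψ⟩ := (hexact (f v - φ)).1 (by rw [map_sub, sub_eq_zero]; exact hv)
    refine (Submodule.Quotient.eq _).2 ?_
    rw [← hψ]
    have : LinearMap.lcomp A E (LinearMap.lsmul A H y) ψ = y • ψ := LinearMap.ext fun h => by
      change ψ (y • h) = y • ψ h
      exact map_smul _ _ _
    rw [this]
    exact Submodule.smul_mem_smul hy trivial
  exact Module.Finite.of_surjective f hsurj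

end Cofinite

section Devissage

variable {A : Type} [CommRing A] {ι : Type} (x : ι → A)

lemma mem_support_quotient {J : Ideal A} {q : PrimeSpectrum A} :
    q ∈ Module.support A (A ⧸ J) ↔ J ≤ q.asIdeal := by
  rw [Module.support_eq_zeroLocus, Ideal.annihilator_quotient]
  rfl

theorem devissage [IsNoetherianRing A] (T : PrimeSpectrum A → Prop)
    (P : (M : Type) → [AddCommGroup M] → [Module A M] → Prop)
    (hzero : ∀ (M : Type) [AddCommGroup M] [Module A M], Subsingleton M → P M)
    (hmid : ∀ {M M' M'' : Type} [AddCommGroup M] [Module A M] [AddCommGroup M'] [Module A M']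
      [AddCommGroup M''] [Module A M''] {f : M →ₗ[A] M'} {g : M' →ₗ[A] M''},
      Function.Injective f → Function.Exact f g → Function.Surjective g → P M → P M'' → P M')
    (hprime : ∀ q, T q → P (A ⧸ q.asIdeal)) (M : Type) [AddCommGroup M] [Module A M]
    (hM : Module.Finite A M) : (∀ q ∈ Module.support A M, T q) → P M := by
  refine IsNoetherianRing.induction_on_isQuotientEquivQuotientPrime A hM
    (motive := fun N _ _ _ => (∀ q ∈ Module.support A N, T q) → P N) ?_ ?_ ?_
  · exact fun N _ _ _ hN _ => hzero N hN
  · intro N _ _ _ q e hT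
    refine hmid (M'' := PUnit) (f := e.symm.toLinearMap) (g := 0) e.symm.injective
      ((LinearMap.exact_zero_iff_surjective _ _).2 e.symm.surjective)
      (Function.surjective_to_subsingleton _) (hprime q (hT q ?_)) (hzero _ inferInstance)
    rw [e.support_eq]
    exact mem_support_quotient.2 le_rfl
  · intro N₁ _ _ _ N₂ _ _ _ N₃ _ _ _ f g hf hg hfg h1 h3 hT
    exact hmid hf hfg hg (h1 fun q hq => hT q (Module.support_subset_of_injective f hf hq))
      (h3 fun q hq => hT q (Module.support_subset_of_surjective g hg hq))

/-- The segment of the long exact sequence of `0 → A ⧸ q → A ⧸ q → A ⧸ (q + (y)) → 0`. -/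
lemma exists_exact_lsmul (q : PrimeSpectrum A) {y : A} (hy : y ∉ q.asIdeal) (i : ℕ) :
    ∃ (π : Coh x (A ⧸ q.asIdeal) i →ₗ[A] Coh x (A ⧸ (q.asIdeal ⊔ Ideal.span {y})) i)
      (δ : Coh x (A ⧸ (q.asIdeal ⊔ Ideal.span {y})) i →ₗ[A] Coh x (A ⧸ q.asIdeal) (i + 1)),
      Function.Exact (LinearMap.lsmul A (Coh x (A ⧸ q.asIdeal) i) y) π ∧ Function.Exact π δ ∧
      Function.Exact δ (LinearMap.lsmul A (Coh x (A ⧸ q.asIdeal) (i + 1)) y) := by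
  let f : (A ⧸ q.asIdeal) →ₗ[A] (A ⧸ q.asIdeal) := y • LinearMap.id
  let g : (A ⧸ q.asIdeal) →ₗ[A] (A ⧸ (q.asIdeal ⊔ Ideal.span {y})) := Submodule.factor le_sup_left
  have hf : Function.Injective f := by
    rw [← LinearMap.ker_eq_bot, LinearMap.ker_eq_bot']
    intro u hu
    obtain ⟨b, rfl⟩ := Submodule.Quotient.mk_surjective _ u
    have h1 : (Submodule.Quotient.mk (y • b) : A ⧸ q.asIdeal) = 0 := hu
    rw [Submodule.Quotient.mk_eq_zero] at h1 ⊢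
    exact (q.2.mem_or_mem h1).resolve_left hy
  have hfg : Function.Exact f g := by
    intro u
    obtain ⟨b, rfl⟩ := Submodule.Quotient.mk_surjective _ u
    change (Submodule.Quotient.mk b : A ⧸ (q.asIdeal ⊔ Ideal.span {y})) = 0 ↔ _
    rw [Submodule.Quotient.mk_eq_zero]
    constructor
    · intro hb
      obtain ⟨c, hc, d, hd, rfl⟩ := Submodule.mem_sup.1 hb
      obtain ⟨a, rfl⟩ := Ideal.mem_span_singleton'.1 hd
      refine ⟨Submodule.Quotient.mk a, ?_⟩
      change (Submodule.Quotient.mk (y * a) : A ⧸ q.asIdeal) = _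
      rw [eq_comm, Submodule.Quotient.eq]
      rwa [mul_comm y a, add_sub_cancel_right]
    · rintro ⟨u, hu⟩
      obtain ⟨a, rfl⟩ := Submodule.Quotient.mk_surjective _ u
      have h1 : (Submodule.Quotient.mk (y * a) : A ⧸ q.asIdeal) = Submodule.Quotient.mk b := hu
      rw [eq_comm, Submodule.Quotient.eq] at h1
      rw [← sub_add_cancel b (y * a)]
      exact add_mem (Ideal.mem_sup_left h1)
        (Ideal.mem_sup_right (Ideal.mul_mem_right _ _ (Ideal.mem_span_singleton_self y)))
  obtain ⟨h1, δ, h2, h3⟩ := segmentExact x i hf hfg (Submodule.factor_surjective _)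
  rw [cohMap_lsmul] at h1 h3
  exact ⟨_, δ, h1, h2, h3⟩

lemma torsionPart_quotient_eq_top_of_mem (q : PrimeSpectrum A) (h : ∀ j, x j ∈ q.asIdeal) :
    torsionPart x (A ⧸ q.asIdeal) = ⊤ := by
  refine eq_top_iff.2 fun u _ => (mem_torsionPart x).2 fun j => ⟨1, ?_⟩
  obtain ⟨b, rfl⟩ := Submodule.Quotient.mk_surjective _ u
  rw [← Submodule.Quotient.mk_smul, Submodule.Quotient.mk_eq_zero, pow_one]
  exact q.asIdeal.mul_mem_right _ (h j)

lemma subsingleton_coh_zero_quotient (q : PrimeSpectrum A) {j : ι} (h : x j ∉ q.asIdeal) :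
    Subsingleton (Coh x (A ⧸ q.asIdeal) 0) := by
  refine subsingleton_of_forall_eq 0 fun u => Subtype.ext ?_
  obtain ⟨n, hn⟩ := (mem_torsionPart x).1 u.2 j
  obtain ⟨b, hb⟩ := Submodule.Quotient.mk_surjective q.asIdeal u.1
  refine hb.symm.trans ?_
  rw [← hb, ← Submodule.Quotient.mk_smul, Submodule.Quotient.mk_eq_zero] at hn
  exact (Submodule.Quotient.mk_eq_zero _).2
    ((q.2.mem_or_mem hn).resolve_left fun h' => h (q.2.mem_of_pow_mem n h'))

lemma subsingleton_of_exact {H H' H'' : Type} [AddCommGroup H] [Module A H] [AddCommGroup H']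
    [Module A H'] [AddCommGroup H''] [Module A H''] {f : H →ₗ[A] H'} {g : H' →ₗ[A] H''}
    (h : Function.Exact f g) [Subsingleton H] [Subsingleton H''] : Subsingleton H' :=
  subsingleton_of_forall_eq 0 fun w => by
    obtain ⟨u, rfl⟩ := (h w).1 (Subsingleton.elim _ _)
    rw [Subsingleton.elim u 0, map_zero]

lemma subsingleton_coh_of_exact {M M' M'' : Type} [AddCommGroup M] [Module A M] [AddCommGroup M']
    [Module A M'] [AddCommGroup M''] [Module A M''] {f : M →ₗ[A] M'} {g : M' →ₗ[A] M''} (i : ℕ)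
    (hf : Function.Injective f) (hfg : Function.Exact f g) (hg : Function.Surjective g)
    (h : Subsingleton (Coh x M i)) (h'' : Subsingleton (Coh x M'' i)) :
    Subsingleton (Coh x M' i) :=
  subsingleton_of_exact (segmentExact x i hf hfg hg).exact_mid

lemma subsingleton_of_injective_lsmul {H : Type} [AddCommGroup H] [Module A H] {y : A}
    (hy : Function.Injective (LinearMap.lsmul A H y)) (h : ∀ u : H, ∃ n, y ^ n • u = 0) :
    Subsingleton H := by
  refine subsingleton_of_forall_eq 0 fun u => ?_
  obtain ⟨n, hn⟩ := h u
  induction n with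
  | zero => rwa [pow_zero, one_smul] at hn
  | succ n ih =>
    refine ih (hy ?_)
    rw [map_zero]
    change y • y ^ n • u = 0
    rwa [smul_smul, ← pow_succ']

lemma lt_of_mem_support_quotient_sup {q q' : PrimeSpectrum A} {y : A} (hy : y ∉ q.asIdeal)
    (h : q' ∈ Module.support A (A ⧸ (q.asIdeal ⊔ Ideal.span {y}))) : q < q' := by
  have h := mem_support_quotient.1 h
  refine lt_of_le_of_ne (le_sup_left.trans h) fun h' => hy ?_
  rw [h']
  exact h (Ideal.mem_sup_right (Ideal.mem_span_singleton_self y))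

/-- Grothendieck vanishing. -/
theorem subsingleton_coh_of_coheight_lt [IsNoetherianRing A] (i : ℕ) : ∀ (M : Type)
    [AddCommGroup M] [Module A M] [Module.Finite A M],
    (∀ q ∈ Module.support A M, Order.coheight q < i) → Subsingleton (Coh x M i) := by
  induction i with
  | zero =>
    intro M _ _ _ h
    have : Subsingleton M := by
      rw [← Module.support_eq_empty_iff (R := A)]
      exact Set.eq_empty_of_forall_notMem fun q hq => by simpa using h q hq
    exact subsingleton_coh x 0
  | succ i ih =>
    intro M _ _ _
    refine devissage (fun q => Order.coheight q < ((i + 1 : ℕ) : ℕ∞))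
      (fun M _ _ => Subsingleton (Coh x M (i + 1))) (fun M _ _ _ => subsingleton_coh x _)
      (subsingleton_coh_of_exact x _) (fun q hq => ?_) M inferInstance
    by_cases hx : ∀ j, x j ∈ q.asIdeal
    · exact subsingleton_coh_succ x i (torsionPart_quotient_eq_top_of_mem x q hx)
    push Not at hx
    obtain ⟨j, hj⟩ := hx
    have h0 : Subsingleton (Coh x (A ⧸ (q.asIdeal ⊔ Ideal.span {x j})) i) := ih _ fun q' hq' => by
      have h1 := Order.coheight_add_one_le (lt_of_mem_support_quotient_sup hj hq')
      exact (ENat.add_one_le_iff (ne_top_of_lt (h1.trans_lt hq) |> fun h => by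
        rintro h'; simp [h'] at h)).1 (h1.trans (Order.le_of_lt_add_one (by simpa using hq)))
    obtain ⟨π, δ, -, -, h3⟩ := exists_exact_lsmul x q hj i
    refine subsingleton_of_injective_lsmul (y := x j) ?_ fun u =>
      exists_pow_smul_eq_zero x _ u (Ideal.subset_span ⟨j, rfl⟩)
    rw [← LinearMap.ker_eq_bot, LinearMap.exact_iff.1 h3, LinearMap.range_eq_bot]
    exact LinearMap.ext fun u => by rw [Subsingleton.elim u 0, map_zero, map_zero]

end Devissage

section TopVanishing
open IsLocalRing

variable {A : Type} [CommRing A] [IsLocalRing A] [IsNoetherianRing A]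
  [IsPrecomplete (maximalIdeal A) A] {E : Type} [AddCommGroup E] [Module A E]
  {ι : Type} (x : ι → A)

lemma smul_quotient_eq_zero (J : Ideal A) {a : A} (ha : a ∈ J) (u : A ⧸ J) : a • u = 0 := by
  obtain ⟨b, rfl⟩ := Submodule.Quotient.mk_surjective _ u
  rw [← Submodule.Quotient.mk_smul, Submodule.Quotient.mk_eq_zero]
  exact J.mul_mem_right _ ha

lemma cofinite_ker_lsmul (hE : IsResidueHull A E) {H H' : Type} [AddCommGroup H] [Module A H]
    [AddCommGroup H'] [Module A H'] {δ : H →ₗ[A] H'} {y : A}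
    (h : Function.Exact δ (LinearMap.lsmul A H' y)) (hH : Cofinite (A := A) E H) :
    Cofinite (A := A) E (LinearMap.ker (LinearMap.lsmul A H' y)) := by
  rw [LinearMap.exact_iff.1 h]
  exact hH.of_surjective hE (LinearMap.surjective_rangeRestrict δ)

/-- A criterion for local cohomology modules to be Artinian, phrased through duals. -/
theorem cofinite_coh (hE : IsResidueHull A E) (hx : ∀ j, x j ∈ maximalIdeal A)
    (C : ℕ → PrimeSpectrum A → Prop)
    (hzero : ∀ q, C 0 q → (∀ j, x j ∈ q.asIdeal) → q.asIdeal = maximalIdeal A)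
    (hsucc : ∀ i q q', C (i + 1) q → q < q' → C i q') (i : ℕ) :
    ∀ (M : Type) [AddCommGroup M] [Module A M] [Module.Finite A M],
      (∀ q ∈ Module.support A M, C i q) → Cofinite (A := A) E (Coh x M i) := by
  induction i with
  | zero =>
    intro M _ _ _
    refine devissage (C 0) (fun M _ _ => Cofinite (A := A) E (Coh x M 0))
      (fun M _ _ _ => have := subsingleton_coh x 0 (M := M); .of_subsingleton)
      (fun hf hfg hg h h'' => h.of_exact hE (segmentExact x 0 hf hfg hg).exact_mid h'')
      (fun q hq => ?_) M inferInstance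
    by_cases hxq : ∀ j, x j ∈ q.asIdeal
    · rw [hzero q hq hxq]
      exact (Cofinite.quotient_maximalIdeal hE).of_injective hE
        (Submodule.injective_subtype (torsionPart x (A ⧸ maximalIdeal A)))
    · push Not at hxq
      obtain ⟨j, hj⟩ := hxq
      have := subsingleton_coh_zero_quotient x q hj
      exact .of_subsingleton
  | succ i ih =>
    intro M _ _ _
    refine devissage (C (i + 1)) (fun M _ _ => Cofinite (A := A) E (Coh x M (i + 1)))
      (fun M _ _ _ => have := subsingleton_coh x (i + 1) (M := M); .of_subsingleton)
      (fun hf hfg hg h h'' => h.of_exact hE (segmentExact x (i + 1) hf hfg hg).exact_mid h'')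
      (fun q hq => ?_) M inferInstance
    by_cases hxq : ∀ j, x j ∈ q.asIdeal
    · have := subsingleton_coh_succ x i (torsionPart_quotient_eq_top_of_mem x q hxq)
      exact .of_subsingleton
    push Not at hxq
    obtain ⟨j, hj⟩ := hxq
    obtain ⟨π, δ, -, -, h3⟩ := exists_exact_lsmul x q hj i
    refine Cofinite.of_ker_smul hE (hx j)
      (fun u => exists_pow_smul_eq_zero x _ u (Ideal.subset_span ⟨j, rfl⟩)) ?_
    exact cofinite_ker_lsmul hE h3 (ih _ fun q' hq' =>
      hsucc i q q' hq (lt_of_mem_support_quotient_sup hj hq'))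

lemma asIdeal_eq_maximalIdeal_of_isMax {q : PrimeSpectrum A} (h : IsMax q) :
    q.asIdeal = maximalIdeal A :=
  eq_maximalIdeal (PrimeSpectrum.isMax_iff.1 h)

lemma coheight_le_of_lt {q q' : PrimeSpectrum A} {i : ℕ}
    (hq : Order.coheight q ≤ ((i + 1 : ℕ) : ℕ∞)) (h : q < q') : Order.coheight q' ≤ i := by
  have h1 := (Order.coheight_add_one_le h).trans hq
  push_cast at h1
  exact (ENat.add_le_add_iff_right (by simp)).1 h1

lemma cofinite_coh_of_coheight_le (hE : IsResidueHull A E) (hx : ∀ j, x j ∈ maximalIdeal A)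
    (i : ℕ) (M : Type) [AddCommGroup M] [Module A M] [Module.Finite A M]
    (hM : ∀ q ∈ Module.support A M, Order.coheight q ≤ i) :
    Cofinite (A := A) E (Coh x M i) := by
  refine cofinite_coh x hE hx (fun i q => Order.coheight q ≤ (i : ℕ∞)) (fun q hq _ => ?_)
    (fun i q q' hq h => coheight_le_of_lt hq h) i M hM
  exact asIdeal_eq_maximalIdeal_of_isMax (Order.coheight_eq_zero.1 (by simpa using hq))

/-- Away from the closed point the top local cohomology is annihilated by some element. -/
theorem exists_notMem_smul_coh_eq_zero (hx : ∀ j, x j ∈ maximalIdeal A) {p : Ideal A}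
    [hp : p.IsPrime] (hxp : ∀ j, x j ∈ p) (hpm : p ≠ maximalIdeal A) (d : ℕ) :
    ∀ (M : Type) [AddCommGroup M] [Module A M] [Module.Finite A M],
      (∀ q ∈ Module.support A M, Order.coheight q ≤ d) →
        ∃ c ∉ p, ∀ u : Coh x M d, c • u = 0 := by
  obtain ⟨E, _, _, hE⟩ := exists_isResidueHull A
  have hmid : ∀ (i : ℕ) {M M' M'' : Type} [AddCommGroup M] [Module A M] [AddCommGroup M']
      [Module A M'] [AddCommGroup M''] [Module A M''] {f : M →ₗ[A] M'} {g : M' →ₗ[A] M''},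
      Function.Injective f → Function.Exact f g → Function.Surjective g →
      (∃ c ∉ p, ∀ u : Coh x M i, c • u = 0) → (∃ c ∉ p, ∀ u : Coh x M'' i, c • u = 0) →
      ∃ c ∉ p, ∀ u : Coh x M' i, c • u = 0 := by
    intro i M M' M'' _ _ _ _ _ _ f g hf hfg hg ⟨c, hc, h⟩ ⟨c', hc', h'⟩
    refine ⟨c * c', fun h => (hp.mem_or_mem h).elim hc hc', fun u => ?_⟩
    obtain ⟨w, hw⟩ := ((segmentExact x i hf hfg hg).exact_mid (c' • u)).1 (by rw [map_smul, h'])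
    rw [mul_smul, ← hw, ← map_smul, h, map_zero]
  have hone : (1 : A) ∉ p := fun h => hp.ne_top ((Ideal.eq_top_iff_one _).2 h)
  have hsub : ∀ (i : ℕ) (M : Type) [AddCommGroup M] [Module A M], Subsingleton (Coh x M i) →
      ∃ c ∉ p, ∀ u : Coh x M i, c • u = 0 := fun i M _ _ _ => ⟨1, hone, fun u => Subsingleton.elim _ _⟩
  induction d with
  | zero =>
    intro M _ _ _
    refine devissage (fun q => Order.coheight q ≤ ((0 : ℕ) : ℕ∞))
      (fun M _ _ => ∃ c ∉ p, ∀ u : Coh x M 0, c • u = 0)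
      (fun M _ _ _ => hsub 0 M (subsingleton_coh x 0)) (hmid 0) (fun q hq => ?_) M inferInstance
    have hqm := asIdeal_eq_maximalIdeal_of_isMax (q := q)
      (Order.coheight_eq_zero.1 (nonpos_iff_eq_zero.1 (by exact_mod_cast hq)))
    obtain ⟨c, hcm, hcp⟩ := Set.not_subset.1
      fun h : maximalIdeal A ≤ p => hpm (le_antisymm (le_maximalIdeal hp.ne_top) h)
    exact ⟨c, hcp, smul_coh_eq_zero x 0 (smul_quotient_eq_zero _ (hqm ▸ hcm))⟩
  | succ d ih =>
    intro M _ _ _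
    refine devissage (fun q => Order.coheight q ≤ ((d + 1 : ℕ) : ℕ∞))
      (fun M _ _ => ∃ c ∉ p, ∀ u : Coh x M (d + 1), c • u = 0)
      (fun M _ _ _ => hsub _ M (subsingleton_coh x _)) (hmid _) (fun q hq => ?_) M inferInstance
    by_cases hxq : ∀ j, x j ∈ q.asIdeal
    · exact hsub _ _ (subsingleton_coh_succ x d (torsionPart_quotient_eq_top_of_mem x q hxq))
    push Not at hxq
    obtain ⟨j, hj⟩ := hxq
    have hcof : Cofinite (A := A) E (Coh x (A ⧸ q.asIdeal) (d + 1)) :=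
      cofinite_coh_of_coheight_le x hE hx _ _ fun q' hq' =>
        (Order.coheight_anti (show q ≤ q' from mem_support_quotient.1 hq')).trans hq
    have hfin := hcof.finite
    obtain ⟨c, hcp, hc⟩ := ih (A ⧸ (q.asIdeal ⊔ Ideal.span {x j})) fun q' hq' =>
      coheight_le_of_lt hq (lt_of_mem_support_quotient_sup hj hq')
    obtain ⟨π, δ, -, -, h3⟩ := exists_exact_lsmul x q hj d
    have hexact := lcomp_exact hE
      (LinearMap.exact_subtype_ker_map (LinearMap.lsmul A (Coh x (A ⧸ q.asIdeal) (d + 1)) (x j)))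
    have hcK : ∀ φ : Coh x (A ⧸ q.asIdeal) (d + 1) →ₗ[A] E,
        c • φ ∈ Ideal.span {x j} • (⊤ : Submodule A (Coh x (A ⧸ q.asIdeal) (d + 1) →ₗ[A] E)) := by
      intro φ
      obtain ⟨ψ, hψ⟩ := (hexact (c • φ)).1 (LinearMap.ext fun u => by
        obtain ⟨w, hw⟩ := (h3 u.1).1 u.2
        change c • φ u.1 = 0
        rw [← hw, ← map_smul, ← map_smul, hc, map_zero, map_zero])
      rw [← hψ]
      have : LinearMap.lcomp A E (LinearMap.lsmul A (Coh x (A ⧸ q.asIdeal) (d + 1)) (x j)) ψ =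
          x j • ψ := LinearMap.ext fun u => map_smul ψ (x j) u
      rw [this]
      exact Submodule.smul_mem_smul (Ideal.mem_span_singleton_self _) trivial
    obtain ⟨k, hk⟩ := mem_radical_of_smul_mem hcK
    obtain ⟨a, ha, b, hb, hab⟩ := Submodule.mem_sup.1 hk
    refine ⟨b, fun hbp => hcp (hp.mem_of_pow_mem k ?_), smul_eq_zero_of_forall_hom hE
      (Module.mem_annihilator.1 hb)⟩
    rw [← hab]
    exact add_mem ((Ideal.span_singleton_le_iff_mem p).2 (hxp j) ha) hbp

/-- If the dimension is at most `d`, then `H^d` only depends on the torsion-free directions: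
an element outside `q` acts surjectively on `H^d(A ⧸ q)`. -/
lemma lsmul_coh_surjective {q : PrimeSpectrum A} {d : ℕ} (hq : Order.coheight q ≤ d) {c : A}
    (hc : c ∉ q.asIdeal) : Function.Surjective (LinearMap.lsmul A (Coh x (A ⧸ q.asIdeal) d) c) := by
  obtain ⟨π, -, h1, -, -⟩ := exists_exact_lsmul x q hc d
  have : Subsingleton (Coh x (A ⧸ (q.asIdeal ⊔ Ideal.span {c})) d) :=
    subsingleton_coh_of_coheight_lt x d _ fun q' hq' => by
      have hlt := Order.coheight_add_one_le (lt_of_mem_support_quotient_sup hc hq')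
      refine (ENat.add_one_le_iff ?_).1 (hlt.trans hq)
      rintro h
      rw [h] at hlt
      have := hlt.trans hq
      simp at this
  intro u
  exact (h1 u).1 (Subsingleton.elim _ _)

/-- The Hartshorne–Lichtenbaum vanishing theorem over a complete local ring. -/
theorem subsingleton_coh_of_forall_exists_prime (hx : ∀ j, x j ∈ maximalIdeal A) (d : ℕ)
    (M : Type) [AddCommGroup M] [Module A M] [Module.Finite A M]
    (hM : ∀ q ∈ Module.support A M, Order.coheight q ≤ d ∧ (Order.coheight q = d →
      ∃ p : Ideal A, p.IsPrime ∧ p ≠ maximalIdeal A ∧ q.asIdeal ≤ p ∧ ∀ j, x j ∈ p)) :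
    Subsingleton (Coh x M d) := by
  refine devissage (fun q => Order.coheight q ≤ d ∧ (Order.coheight q = d →
      ∃ p : Ideal A, p.IsPrime ∧ p ≠ maximalIdeal A ∧ q.asIdeal ≤ p ∧ ∀ j, x j ∈ p))
    (fun M _ _ => Subsingleton (Coh x M d)) (fun M _ _ _ => subsingleton_coh x _)
    (subsingleton_coh_of_exact x _) (fun q ⟨hq, h⟩ => ?_) M inferInstance hM
  have hsupp : ∀ q' ∈ Module.support A (A ⧸ q.asIdeal), Order.coheight q' ≤ Order.coheight q :=
    fun q' hq' => Order.coheight_anti (show q ≤ q' from mem_support_quotient.1 hq')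
  rcases hq.lt_or_eq with hlt | heq
  · exact subsingleton_coh_of_coheight_lt x d _ fun q' hq' => (hsupp q' hq').trans_lt hlt
  obtain ⟨p, hp, hpm, hqp, hxp⟩ := h heq
  obtain ⟨c, hcp, hc⟩ := exists_notMem_smul_coh_eq_zero x hx hxp hpm d (A ⧸ q.asIdeal)
    fun q' hq' => (hsupp q' hq').trans hq
  refine subsingleton_of_forall_eq 0 fun u => ?_
  obtain ⟨w, rfl⟩ := lsmul_coh_surjective x hq (fun h => hcp (hqp h)) u
  exact hc w

end TopVanishing

section TopNonvanishing
open IsLocalRing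

variable {A : Type} [CommRing A] [IsNoetherianRing A] {ι : Type} (x : ι → A)

lemma cohMap_surjective {M M'' : Type} [AddCommGroup M] [Module A M] [Module.Finite A M]
    [AddCommGroup M''] [Module A M''] {d : ℕ} (hM : ∀ q ∈ Module.support A M, Order.coheight q ≤ d)
    {g : M →ₗ[A] M''} (hg : Function.Surjective g) : Function.Surjective (cohMap x d g) := by
  have hinj := Submodule.injective_subtype (LinearMap.ker g)
  obtain ⟨δ, h1, -⟩ :=
    (segmentExact x d hinj (LinearMap.exact_subtype_ker_map g) hg).exists_connecting
  have : Subsingleton (Coh x (LinearMap.ker g) (d + 1)) :=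
    subsingleton_coh_of_coheight_lt x (d + 1) _ fun q hq =>
      (hM q (Module.support_subset_of_injective _ hinj hq)).trans_lt
        (by exact_mod_cast Nat.lt_succ_self d)
  exact fun u => (h1 u).1 (Subsingleton.elim _ _)

lemma exists_notMem_annihilator {M : Type} [AddCommGroup M] [Module A M] [Module.Finite A M]
    {q : PrimeSpectrum A} (h : q ∉ Module.support A M) :
    ∃ c ∉ q.asIdeal, ∀ m : M, c • m = 0 := by
  rw [Module.support_eq_zeroLocus] at h
  obtain ⟨c, hc, hcq⟩ := Set.not_subset.1 h
  exact ⟨c, hcq, Module.mem_annihilator.1 hc⟩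

lemma exists_hom_ne_zero {d : ℕ} {p : PrimeSpectrum A} (hp : Order.coheight p = d) (M : Type)
    [AddCommGroup M] [Module A M] [hfin : Module.Finite A M]
    (hM : ∀ q ∈ Module.support A M, Order.coheight q ≤ d) (hpM : p ∈ Module.support A M) :
    ∃ f : M →ₗ[A] (A ⧸ p.asIdeal), f ≠ 0 := by
  refine devissage (fun q => Order.coheight q ≤ d)
    (fun M _ _ => Module.Finite A M → p ∈ Module.support A M →
      ∃ f : M →ₗ[A] (A ⧸ p.asIdeal), f ≠ 0) (fun M _ _ _ _ h => ?_) ?_ (fun q hq _ h => ?_) M hfin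
      hM hfin hpM
  · rw [Module.support_eq_empty] at h
    exact h.elim
  · intro M M' M'' _ _ _ _ _ _ f g hf hfg hg h h'' _ hpM'
    have h1 : Module.Finite A M := Module.Finite.of_injective f hf
    have h2 : Module.Finite A M'' := Module.Finite.of_surjective g hg
    by_cases hp'' : p ∈ Module.support A M''
    · obtain ⟨φ, hφ⟩ := h'' h2 hp''
      refine ⟨φ ∘ₗ g, fun h0 => hφ (LinearMap.ext fun u => ?_)⟩
      obtain ⟨w, rfl⟩ := hg u
      exact LinearMap.congr_fun h0 w
    · have hpM : p ∈ Module.support A M := by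
        rw [Module.support_of_exact hfg hf hg] at hpM'
        exact hpM'.resolve_right hp''
      obtain ⟨φ, hφ⟩ := h h1 hpM
      obtain ⟨c, hcp, hc⟩ := exists_notMem_annihilator hp''
      have hex : ∀ m, ∃ u, f u = c • m := fun m => (hfg (c • m)).1 (by rw [map_smul, hc])
      choose s hs using hex
      let ψ : M' →ₗ[A] M :=
        { toFun := s
          map_add' := fun a b => hf (by rw [map_add, hs, hs, hs, smul_add])
          map_smul' := fun r a => hf (by simp [hs, smul_comm c r]) }
      refine ⟨φ ∘ₗ ψ, fun h0 => hφ (LinearMap.ext fun u => ?_)⟩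
      have h3 : ψ (f u) = c • u := hf (by rw [map_smul]; exact hs (f u))
      have h4 : c • φ u = 0 := by
        rw [← map_smul, ← h3]
        exact LinearMap.congr_fun h0 (f u)
      obtain ⟨b, hb⟩ := Submodule.Quotient.mk_surjective _ (φ u)
      rw [← hb, ← Submodule.Quotient.mk_smul, Submodule.Quotient.mk_eq_zero] at h4
      rw [← hb, LinearMap.zero_apply, Submodule.Quotient.mk_eq_zero]
      exact (p.isPrime.mem_or_mem h4).resolve_left hcp
  · have hqp : q ≤ p := mem_support_quotient.1 h
    have : q = p := by
      by_contra hne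
      have h1 := (Order.coheight_add_one_le (lt_of_le_of_ne hqp hne)).trans hq
      rw [hp] at h1
      exact absurd h1 (by exact_mod_cast Nat.not_succ_le_self d)
    subst this
    refine ⟨LinearMap.id, fun h0 => ?_⟩
    have : Nontrivial (A ⧸ q.asIdeal) := Ideal.Quotient.nontrivial_iff.2 q.isPrime.ne_top
    obtain ⟨u, hu⟩ := exists_ne (0 : A ⧸ q.asIdeal)
    exact hu (LinearMap.congr_fun h0 u)

variable [IsLocalRing A]

lemma exists_coheight_eq_of_mem_maximalIdeal {q : PrimeSpectrum A} {d : ℕ}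
    (hq : Order.coheight q = (d + 1 : ℕ)) {y : A} (hy : y ∈ maximalIdeal A) :
    ∃ q' : PrimeSpectrum A, q < q' ∧ y ∈ q'.asIdeal ∧
      Order.coheight q' = d := by
  obtain ⟨s, hs, hl⟩ := Order.exists_series_of_coheight_eq_coe q hq
  have hlast : s.last.asIdeal = maximalIdeal A := by
    refine eq_maximalIdeal (PrimeSpectrum.isMax_iff.1 fun r hr => ?_)
    by_contra hlt
    have h1 : (((s.snoc r (lt_of_le_not_ge hr hlt)).length : ℕ) : ℕ∞) ≤ Order.coheight q :=
      Order.length_le_coheight (by simp [hs])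
    rw [hq, RelSeries.snoc_length, hl] at h1
    exact absurd h1 (by exact_mod_cast Nat.not_succ_le_self (d + 1))
  obtain ⟨t, ht, htl, hth, -⟩ :=
    PrimeSpectrum.exist_ltSeries_mem_one_of_mem_last s (x := y) (hlast ▸ hy)
  have hlen : t.length = d + 1 := htl ▸ hl
  have hthq : t.head = q := hth ▸ hs
  have hidx := Order.coheight_eq_index_of_length_eq_head_coheight (p := t)
    (by rw [hthq, hq, hlen]) 1
  have hlt : q < t 1 := by
    rw [← hthq]
    refine t.strictMono (show (0 : Fin (t.length + 1)) < 1 from ?_)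
    rw [Fin.lt_def]
    simp [hlen]
  refine ⟨t 1, hlt, ht, hidx.trans ?_⟩
  simp [Fin.val_rev, hlen]

variable [IsPrecomplete (maximalIdeal A) A]

lemma not_subsingleton_coh_quotient (hx : ∀ j, x j ∈ maximalIdeal A) (d : ℕ) :
    ∀ q : PrimeSpectrum A, Order.coheight q = d →
      (∀ p : Ideal A, p.IsPrime → q.asIdeal ≤ p → (∀ j, x j ∈ p) → p = maximalIdeal A) →
        ¬ Subsingleton (Coh x (A ⧸ q.asIdeal) d) := by
  obtain ⟨E, _, _, hE⟩ := exists_isResidueHull A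
  induction d with
  | zero =>
    intro q hq hp hsub
    have hqm := eq_maximalIdeal (PrimeSpectrum.isMax_iff.1 (Order.coheight_eq_zero.1
      (by exact_mod_cast hq : Order.coheight q = 0)))
    have : Nontrivial (A ⧸ q.asIdeal) := Ideal.Quotient.nontrivial_iff.2 q.isPrime.ne_top
    have := nontrivial_coh_zero x
      (torsionPart_quotient_eq_top_of_mem x q fun j => by rw [hqm]; exact hx j)
    exact not_subsingleton _ hsub
  | succ d ih =>
    intro q hq hp hsub
    have hqm : q.asIdeal ≠ maximalIdeal A := fun h => by
      have : IsMax q := PrimeSpectrum.isMax_iff.2 (h ▸ maximalIdeal.isMaximal A)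
      rw [Order.coheight_eq_zero.2 this] at hq
      exact absurd hq (by exact_mod_cast (Nat.succ_ne_zero d).symm)
    have hcof : Cofinite (A := A) E (Coh x (A ⧸ q.asIdeal) d) := by
      refine cofinite_coh x hE hx (fun _ q' => q ≤ q') (fun q' h1 h2 => hp _ q'.isPrime h1 h2)
        (fun i q' q'' h1 h2 => h1.trans h2.le) d _ fun q' hq' => mem_support_quotient.1 hq'
    have hfin := hcof.finite
    have hfinite : ({q.asIdeal} ∪ {P ∈ associatedPrimes A (Coh x (A ⧸ q.asIdeal) d →ₗ[A] E) |
        P ≠ maximalIdeal A} : Set (Ideal A)).Finite :=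
      (Set.finite_singleton _).union ((associatedPrimes.finite _ _).subset (Set.sep_subset _ _))
    obtain ⟨y, hyI, hy⟩ : ∃ y ∈ Ideal.span (Set.range x), y ∉ ⋃ P ∈ ({q.asIdeal} ∪
        {P ∈ associatedPrimes A (Coh x (A ⧸ q.asIdeal) d →ₗ[A] E) |
          P ≠ maximalIdeal A} : Set (Ideal A)), (id P : Set A) := by
      refine Set.not_subset.1 fun h => ?_
      obtain ⟨P, hP, hIP⟩ := (Ideal.subset_union_prime_finite hfinite (f := id) ⊥ ⊥
        (fun P hP _ _ => by
          rcases hP with rfl | hP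
          · exact q.isPrime
          · exact hP.1.isPrime)).1 h
      have hxP : ∀ j, x j ∈ P := fun j => hIP (Ideal.subset_span ⟨j, rfl⟩)
      rcases hP with rfl | hP
      · exact hqm (hp _ q.isPrime le_rfl hxP)
      · refine hP.2 (hp _ hP.1.isPrime (fun a ha => hP.1.annihilator_le ?_) hxP)
        rw [Submodule.mem_annihilator]
        refine fun φ _ => LinearMap.ext fun u => ?_
        rw [LinearMap.smul_apply, ← map_smul,
          smul_coh_eq_zero x d (smul_quotient_eq_zero _ ha), map_zero, LinearMap.zero_apply]
    simp only [Set.mem_iUnion, not_exists] at hy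
    have hyq : y ∉ q.asIdeal := fun h => hy _ (Or.inl rfl) h
    have hym : y ∈ maximalIdeal A :=
      Ideal.span_le.2 (Set.range_subset_iff.2 hx) hyI
    obtain ⟨q', hqq', hyq', hq'⟩ := exists_coheight_eq_of_mem_maximalIdeal hq hym
    obtain ⟨π, δ, -, h2, -⟩ := exists_exact_lsmul x q hyq d
    have hle : q.asIdeal ⊔ Ideal.span {y} ≤ q'.asIdeal :=
      sup_le hqq'.le ((Ideal.span_singleton_le_iff_mem _).2 hyq')
    let g : (A ⧸ (q.asIdeal ⊔ Ideal.span {y})) →ₗ[A] (A ⧸ q'.asIdeal) := Submodule.factor hle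
    have hg : Function.Surjective (cohMap x d g) :=
      cohMap_surjective x (fun r hr => coheight_le_of_lt hq.le
        (lt_of_mem_support_quotient_sup hyq hr)) (Submodule.factor_surjective hle)
    let σ : Coh x (A ⧸ q.asIdeal) d →ₗ[A] Coh x (A ⧸ q'.asIdeal) d := cohMap x d g ∘ₗ π
    have hσ : Function.Surjective σ :=
      hg.comp fun u => (h2 u).1 (Subsingleton.elim _ _)
    have hp' : ∀ p : Ideal A, p.IsPrime → q'.asIdeal ≤ p → (∀ j, x j ∈ p) → p = maximalIdeal A :=
      fun p h1 h2 => hp p h1 (le_trans (show q.asIdeal ≤ q'.asIdeal from hqq'.le) h2)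
    refine ih q' hq' hp' ?_
    have hfin' : Module.Finite A (Coh x (A ⧸ q'.asIdeal) d →ₗ[A] E) := (hcof.of_surjective hE hσ).finite
    have hσ' : Function.Injective (σ.lcomp A E) := fun φ ψ h => LinearMap.ext fun u => by
      obtain ⟨w, rfl⟩ := hσ u
      exact LinearMap.congr_fun h w
    have hrad : maximalIdeal A ≤
        (Module.annihilator A (Coh x (A ⧸ q'.asIdeal) d →ₗ[A] E)).radical := by
      rw [← Ideal.sInf_minimalPrimes]
      refine le_sInf fun P hP => ?_
      have hP' := Module.associatedPrimes.minimalPrimes_annihilator_subset_associatedPrimes A _ hP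
      by_contra hPm
      refine hy P (Or.inr ⟨associatedPrimes.subset_of_injective hσ' hP', ?_⟩) ?_
      · rintro rfl
        exact hPm le_rfl
      · refine hP.1.2 (Module.mem_annihilator.2 fun φ => LinearMap.ext fun u => ?_)
        rw [LinearMap.smul_apply, ← map_smul,
          smul_coh_eq_zero x d (smul_quotient_eq_zero _ hyq'), map_zero, LinearMap.zero_apply]
    by_cases hqm' : q'.asIdeal = maximalIdeal A
    · have hd : d = 0 := by
        have : IsMax q' := PrimeSpectrum.isMax_iff.2 (hqm' ▸ maximalIdeal.isMaximal A)
        rw [Order.coheight_eq_zero.2 this] at hq'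
        exact_mod_cast hq'.symm
      subst hd
      obtain ⟨j, hj⟩ : ∃ j, x j ∉ q.asIdeal := by
        by_contra! h
        exact hqm (hp _ q.isPrime le_rfl h)
      have := subsingleton_coh_zero_quotient x q hj
      exact hσ.subsingleton
    · obtain ⟨z, hzm, hzq⟩ := Set.not_subset.1
        fun h : maximalIdeal A ≤ q'.asIdeal => hqm' (le_antisymm (le_maximalIdeal q'.isPrime.ne_top) h)
      obtain ⟨k, hk⟩ := hrad hzm
      refine subsingleton_of_forall_eq 0 fun u => ?_
      obtain ⟨w, rfl⟩ := lsmul_coh_surjective x hq'.le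
        (fun h => hzq (q'.isPrime.mem_of_pow_mem k h)) u
      exact smul_eq_zero_of_forall_hom hE (Module.mem_annihilator.1 hk) w

/-- A partial converse of the Hartshorne–Lichtenbaum vanishing theorem. -/
theorem exists_prime_of_subsingleton_coh (hx : ∀ j, x j ∈ maximalIdeal A) {d : ℕ} (M : Type)
    [AddCommGroup M] [Module A M] [Module.Finite A M]
    (hM : ∀ q ∈ Module.support A M, Order.coheight q ≤ d) (hsub : Subsingleton (Coh x M d))
    {q : PrimeSpectrum A} (hqM : q ∈ Module.support A M) (hq : Order.coheight q = d) :
    ∃ p : Ideal A, p.IsPrime ∧ p ≠ maximalIdeal A ∧ q.asIdeal ≤ p ∧ ∀ j, x j ∈ p := by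
  by_contra! h
  refine not_subsingleton_coh_quotient x hx d q hq (fun p h1 h2 h3 => ?_) ?_
  · by_contra hpm
    obtain ⟨j, hj⟩ := h p h1 hpm h2
    exact hj (h3 j)
  obtain ⟨f, hf⟩ := exists_hom_ne_zero hq M hM hqM
  have h1 : Subsingleton (Coh x (LinearMap.range f) d) :=
    (cohMap_surjective x hM (LinearMap.surjective_rangeRestrict f)).subsingleton
  refine subsingleton_coh_of_exact x d (Submodule.injective_subtype (LinearMap.range f))
    (LinearMap.exact_subtype_mkQ _) (Submodule.mkQ_surjective _) h1
    (subsingleton_coh_of_coheight_lt x d _ fun q' hq' => ?_)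
  have hqq' : q ≤ q' := mem_support_quotient.1
    (Module.support_subset_of_surjective _ (Submodule.mkQ_surjective (LinearMap.range f)) hq')
  have hne : q ≠ q' := by
    rintro rfl
    obtain ⟨m, hm⟩ : ∃ m, f m ≠ 0 := by
      by_contra! h0
      exact hf (LinearMap.ext h0)
    obtain ⟨b, hb⟩ := Submodule.Quotient.mk_surjective _ (f m)
    have hbq : b ∉ q.asIdeal := fun h0 => hm (by rw [← hb, Submodule.Quotient.mk_eq_zero]; exact h0)
    rw [Module.support_eq_zeroLocus] at hq'
    refine hbq (hq' (Module.mem_annihilator.2 fun u => ?_))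
    obtain ⟨v, rfl⟩ := Submodule.mkQ_surjective _ u
    obtain ⟨c, rfl⟩ := Submodule.Quotient.mk_surjective _ v
    rw [← map_smul, ← LinearMap.mem_ker, Submodule.ker_mkQ]
    refine ⟨c • m, ?_⟩
    rw [map_smul, ← hb, ← Submodule.Quotient.mk_smul, ← Submodule.Quotient.mk_smul, smul_eq_mul,
      smul_eq_mul, mul_comm]
  have h2 := Order.coheight_add_one_le (lt_of_le_of_ne hqq' hne)
  rw [hq] at h2
  refine (ENat.add_one_le_iff ?_).1 h2
  rintro h3
  rw [h3] at h2
  simp at h2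

end TopNonvanishing

section BaseChange
open IsLocalRing TensorProduct

variable {R B : Type} [CommRing R] [CommRing B] [Algebra R B]
  {N : Type} [AddCommGroup N] [Module R N]

lemma one_tmul_mem_map_smul_top {J : Ideal R} {m : N} (hm : m ∈ J • (⊤ : Submodule R N)) (b : B) :
    b ⊗ₜ[R] m ∈ J.map (algebraMap R B) • (⊤ : Submodule B (B ⊗[R] N)) := by
  induction hm using Submodule.smul_induction_on' with
  | smul r hr n _ =>
    rw [tmul_smul, ← algebraMap_smul B r]
    exact Submodule.smul_mem_smul (Ideal.mem_map_of_mem _ hr) trivial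
  | add u _ v _ hu hv =>
    rw [tmul_add]
    exact add_mem hu hv

lemma lTensor_mkQ_eq_zero {J : Ideal R} {u : B ⊗[R] N}
    (hu : u ∈ J.map (algebraMap R B) • (⊤ : Submodule B (B ⊗[R] N))) :
    (J • (⊤ : Submodule R N)).mkQ.lTensor B u = 0 := by
  have key : ∀ a ∈ J.map (algebraMap R B), ∀ w : B ⊗[R] (N ⧸ J • (⊤ : Submodule R N)),
      a • w = 0 := by
    intro a ha w
    refine Submodule.span_induction (p := fun a _ => a • w = 0) ?_ (zero_smul _ _)
      (fun a b _ _ h h' => by rw [add_smul, h, h', add_zero])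
      (fun c a _ h => by rw [smul_eq_mul, mul_smul, h, smul_zero]) ha
    rintro _ ⟨r, hr, rfl⟩
    rw [algebraMap_smul]
    induction w with
    | zero => rw [smul_zero]
    | add u v hu hv => rw [smul_add, hu, hv, add_zero]
    | tmul b n =>
      obtain ⟨n, rfl⟩ := Submodule.mkQ_surjective _ n
      rw [← tmul_smul, ← map_smul, Submodule.mkQ_apply, (Submodule.Quotient.mk_eq_zero _).2
        (Submodule.smul_mem_smul hr Submodule.mem_top), tmul_zero]
  have hlin : ∀ (b : B) (w : B ⊗[R] N), (J • (⊤ : Submodule R N)).mkQ.lTensor B (b • w) =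
      b • (J • (⊤ : Submodule R N)).mkQ.lTensor B w := fun b w =>
    map_smul ((J • (⊤ : Submodule R N)).mkQ.baseChange B) b w
  induction hu using Submodule.smul_induction_on' with
  | smul a ha n _ => rw [hlin, key a ha]
  | add u _ v _ hu hv => rw [map_add, hu, hv, add_zero]

lemma mem_smul_top_of_one_tmul_mem [Module.FaithfullyFlat R B] {J : Ideal R} {m : N}
    (hm : (1 : B) ⊗ₜ[R] m ∈ J.map (algebraMap R B) • (⊤ : Submodule B (B ⊗[R] N))) :
    m ∈ J • (⊤ : Submodule R N) := by
  have h := lTensor_mkQ_eq_zero hm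
  rw [LinearMap.lTensor_tmul] at h
  have := Module.FaithfullyFlat.tensorProduct_mk_injective (A := R) (B := B)
    (N ⧸ J • (⊤ : Submodule R N)) (h.trans (tmul_zero _ _).symm)
  rwa [Submodule.mkQ_apply, Submodule.Quotient.mk_eq_zero] at this

/-- Relative integral closures contract from a faithfully flat extension. -/
theorem relIntDep_baseChange_iff [IsNoetherianRing R] [IsNoetherianRing B]
    [Module.FaithfullyFlat R B] [Module.Finite R N] {J : Ideal R} {x : R} :
    (J.map (algebraMap R B)).RelIntDep (B ⊗[R] N) (algebraMap R B x) ↔ J.RelIntDep N x := by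
  rw [relIntDep_iff, relIntDep_iff]
  refine exists_congr fun e => forall_congr' fun j => ⟨fun h m => ?_, fun h u => ?_⟩
  · refine mem_smul_top_of_one_tmul_mem (B := B) ?_
    have h1 := h (1 ⊗ₜ m)
    rwa [← map_pow, algebraMap_smul, ← tmul_smul, ← Ideal.map_pow] at h1
  · induction u with
    | zero => rw [smul_zero]; exact zero_mem _
    | add u v hu hv => rw [smul_add]; exact add_mem hu hv
    | tmul b m =>
      rw [← map_pow, algebraMap_smul, ← tmul_smul, ← Ideal.map_pow]
      exact one_tmul_mem_map_smul_top (h m) b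

/-- Transporters into a submodule commute with flat base change. -/
theorem mem_map_of_forall_smul_mem [Module.Flat R B] [Module.Finite R N] {J 𝔞 : Ideal R} {s : R}
    (h𝔞 : ∀ r, (∀ m : N, (r * s) • m ∈ J • (⊤ : Submodule R N)) → r ∈ 𝔞) {y : B}
    (hy : ∀ u : B ⊗[R] N, (y * algebraMap R B s) • u ∈
      J.map (algebraMap R B) • (⊤ : Submodule B (B ⊗[R] N))) : y ∈ 𝔞.map (algebraMap R B) := by
  obtain ⟨n, g, hg⟩ := Module.Finite.exists_fin (R := R) (M := N)
  let φ : R →ₗ[R] (Fin n → N ⧸ J • (⊤ : Submodule R N)) :=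
    LinearMap.toSpanSingleton R _ fun i => Submodule.Quotient.mk (s • g i)
  have hker : LinearMap.ker φ ≤ 𝔞 := by
    intro r hr
    refine h𝔞 r fun m => ?_
    have hm : m ∈ Submodule.span R (Set.range g) := hg ▸ trivial
    induction hm using Submodule.span_induction with
    | mem m hm =>
      obtain ⟨i, rfl⟩ := hm
      have := congr_fun (LinearMap.mem_ker.1 hr) i
      rw [mul_smul]
      exact (Submodule.Quotient.mk_eq_zero _).1 this
    | zero => rw [smul_zero]; exact zero_mem _
    | add u v _ _ hu hv => rw [smul_add]; exact add_mem hu hv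
    | smul c u _ hu => rw [smul_comm]; exact Submodule.smul_mem _ c hu
  have hex := Module.Flat.lTensor_exact B (LinearMap.exact_subtype_ker_map φ)
  obtain ⟨w, hw⟩ := (hex (y ⊗ₜ 1)).1 (by
    rw [LinearMap.lTensor_tmul]
    refine (TensorProduct.piRight R R B fun _ : Fin n => N ⧸ J • (⊤ : Submodule R N)).injective ?_
    rw [map_zero]
    ext i
    rw [TensorProduct.piRight_apply, TensorProduct.piRightHom_tmul]
    have h1 := lTensor_mkQ_eq_zero (hy (1 ⊗ₜ g i))
    rw [mul_smul, algebraMap_smul, ← tmul_smul, smul_tmul', smul_eq_mul, mul_one,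
      LinearMap.lTensor_tmul] at h1
    simpa [φ] using h1)
  have hy' : y = TensorProduct.rid R B (y ⊗ₜ 1) := by simp
  rw [hy', ← hw]
  clear hw hy'
  induction w with
  | zero => simp
  | add u v hu hv => rw [map_add, map_add]; exact add_mem hu hv
  | tmul b a =>
    rw [LinearMap.lTensor_tmul, TensorProduct.rid_tmul, Algebra.smul_def]
    exact Ideal.mul_mem_right _ _ (Ideal.mem_map_of_mem _ (hker a.2))

end BaseChange

section Dimension
open IsLocalRing TensorProduct

lemma ringKrullDim_quotient_eq_coheight {A : Type} [CommRing A] (q : PrimeSpectrum A) :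
    ringKrullDim (A ⧸ q.asIdeal) = (Order.coheight q : WithBot ℕ∞) := by
  rw [ringKrullDim_quotient, Order.coheight_eq_krullDim_Ici]
  rfl

/-- Finitely generated modules over Noetherian local rings have systems of parameters. -/
lemma exists_parameters {R : Type} [CommRing R] [IsLocalRing R] [IsNoetherianRing R] {N : Type}
    [AddCommGroup N] [Module R N] [Module.Finite R N] {d : ℕ}
    (hd : Order.krullDim (Module.support R N) = (d : WithBot (WithTop ℕ))) :
    ∃ T : Finset R, T.card ≤ d ∧ (∀ P : Ideal R, P.IsPrime → Module.annihilator R N ≤ P →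
      (T : Set R) ⊆ P → P = maximalIdeal R) ∧ (T : Set R) ⊆ maximalIdeal R := by
  classical
  set 𝔞 := Module.annihilator R N
  have hdim : ringKrullDim (R ⧸ 𝔞) = (d : WithBot (WithTop ℕ)) := by
    rw [← Module.supportDim_eq_ringKrullDim_quotient_annihilator]
    exact hd
  have hnt : Nontrivial (R ⧸ 𝔞) := by
    by_contra h
    rw [not_nontrivial_iff_subsingleton] at h
    rw [ringKrullDim_eq_bot_of_subsingleton] at hdim
    exact absurd hdim.symm (WithBot.coe_ne_bot)
  have hloc : IsLocalRing (R ⧸ 𝔞) :=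
    IsLocalRing.of_surjective' (Ideal.Quotient.mk 𝔞) Ideal.Quotient.mk_surjective
  have hlochom : IsLocalHom (Ideal.Quotient.mk 𝔞) :=
    .of_surjective _ Ideal.Quotient.mk_surjective
  obtain ⟨s, hs, hcard⟩ :=
    (maximalIdeal (R ⧸ 𝔞)).exists_finset_card_eq_height_of_isNoetherianRing
  have hsd : s.card = d := by
    rw [← maximalIdeal_height_eq_ringKrullDim, ← hcard] at hdim
    exact Nat.cast_injective (R := ℕ∞) (WithBot.coe_injective hdim)
  let σ := Function.surjInv (Ideal.Quotient.mk_surjective (I := 𝔞))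
  have hσ : ∀ a, Ideal.Quotient.mk 𝔞 (σ a) = a :=
    Function.surjInv_eq (Ideal.Quotient.mk_surjective (I := 𝔞))
  refine ⟨s.image σ, Finset.card_image_le.trans hsd.le, fun P hP h𝔞 hTP => ?_, ?_⟩
  · have hcomap : (P.map (Ideal.Quotient.mk 𝔞)).comap (Ideal.Quotient.mk 𝔞) = P := by
      rw [Ideal.comap_map_of_surjective _ Ideal.Quotient.mk_surjective, ← RingHom.ker_eq_comap_bot,
        Ideal.mk_ker, sup_eq_left.2 h𝔞]
    have hprime : (P.map (Ideal.Quotient.mk 𝔞)).IsPrime :=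
      Ideal.map_isPrime_of_surjective Ideal.Quotient.mk_surjective (by rwa [Ideal.mk_ker])
    have hle : Ideal.span (s : Set (R ⧸ 𝔞)) ≤ P.map (Ideal.Quotient.mk 𝔞) := by
      refine Ideal.span_le.2 fun a ha => ?_
      rw [← hσ a]
      exact Ideal.mem_map_of_mem _ (hTP (Finset.mem_coe.2 (Finset.mem_image_of_mem σ ha)))
    have h1 := hs.2 ⟨hprime, hle⟩ (le_maximalIdeal hprime.ne_top)
    refine le_antisymm (le_maximalIdeal hP.ne_top) fun r hr => ?_
    rw [← hcomap]
    exact h1 (map_nonunit _ _ hr)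
  · intro t ht
    obtain ⟨a, ha, rfl⟩ := Finset.mem_image.1 ht
    have h1 : a ∈ maximalIdeal (R ⧸ 𝔞) := hs.1.2 (Ideal.subset_span ha)
    rw [← hσ a] at h1
    exact ((local_hom_TFAE (Ideal.Quotient.mk 𝔞)).out 0 4).1 hlochom ▸ h1

variable {R B : Type} [CommRing R] [IsLocalRing R] [IsNoetherianRing R] [CommRing B]
  [IsLocalRing B] [IsNoetherianRing B] [Algebra R B] {N : Type} [AddCommGroup N] [Module R N]

lemma map_annihilator_le : (Module.annihilator R N).map (algebraMap R B) ≤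
    Module.annihilator B (B ⊗[R] N) := by
  refine Ideal.map_le_iff_le_comap.2 fun r hr => Module.mem_annihilator.2 fun u => ?_
  rw [algebraMap_smul]
  induction u with
  | zero => rw [smul_zero]
  | add u v hu hv => rw [smul_add, hu, hv, add_zero]
  | tmul b m => rw [← tmul_smul, Module.mem_annihilator.1 hr, tmul_zero]

/-- Extending the maximal ideal to the maximal ideal does not raise the dimension. -/
theorem coheight_le_of_mem_support_baseChange [Module.Finite R N] {d : ℕ}
    (hd : Order.krullDim (Module.support R N) = (d : WithBot (WithTop ℕ)))
    (hB : (maximalIdeal R).map (algebraMap R B) = maximalIdeal B) {q : PrimeSpectrum B}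
    (hq : q ∈ Module.support B (B ⊗[R] N)) : Order.coheight q ≤ d := by
  classical
  obtain ⟨T, hTd, hT, hTm⟩ := exists_parameters hd
  rw [Module.support_eq_zeroLocus] at hq
  have hann : (Module.annihilator R N).map (algebraMap R B) ≤ q.asIdeal := map_annihilator_le.trans hq
  have hnt : Nontrivial (B ⧸ q.asIdeal) := Ideal.Quotient.nontrivial_iff.2 q.isPrime.ne_top
  have hloc : IsLocalRing (B ⧸ q.asIdeal) :=
    IsLocalRing.of_surjective' (Ideal.Quotient.mk q.asIdeal) Ideal.Quotient.mk_surjective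
  have hlochom : IsLocalHom (Ideal.Quotient.mk q.asIdeal) :=
    .of_surjective _ Ideal.Quotient.mk_surjective
  let φ : R →+* B ⧸ q.asIdeal := (Ideal.Quotient.mk q.asIdeal).comp (algebraMap R B)
  have hmap : (maximalIdeal R).map φ = maximalIdeal (B ⧸ q.asIdeal) := by
    rw [← Ideal.map_map, hB]
    exact IsLocalRing.map_maximalIdeal_of_surjective _ Ideal.Quotient.mk_surjective
  have hmin : maximalIdeal (B ⧸ q.asIdeal) ∈
      (Ideal.span ((T.image φ : Finset _) : Set (B ⧸ q.asIdeal))).minimalPrimes := by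
    refine ⟨⟨inferInstance, Ideal.span_le.2 fun a ha => ?_⟩, fun P hP hPm => ?_⟩
    · obtain ⟨t, ht, rfl⟩ := Finset.mem_image.1 (Finset.mem_coe.1 ha)
      rw [← hmap]
      exact Ideal.mem_map_of_mem _ (hTm ht)
    · have hPp := hP.1
      rw [← hmap, Ideal.map_le_iff_le_comap, hT (P.comap φ) inferInstance (fun r hr => ?_) fun t ht => ?_]
      · have : φ r = 0 := Ideal.Quotient.eq_zero_iff_mem.2 (hann (Ideal.mem_map_of_mem _ hr))
        rw [Ideal.mem_comap, this]
        exact P.zero_mem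
      · exact hP.2 (Ideal.subset_span (Finset.mem_coe.2 (Finset.mem_image_of_mem φ ht)))
  have h1 := Ideal.height_le_card_of_mem_minimalPrimes_span_finset hmin
  have h2 := ringKrullDim_quotient_eq_coheight q
  rw [← maximalIdeal_height_eq_ringKrullDim] at h2
  rw [← WithBot.coe_le_coe, ← h2]
  exact_mod_cast h1.trans (by exact_mod_cast Finset.card_image_le.trans hTd)

end Dimension

section Forward
open IsLocalRing TensorProduct

variable {R B : Type} [CommRing R] [IsLocalRing R] [IsNoetherianRing R] [CommRing B]
  [IsLocalRing B] [IsNoetherianRing B] [Algebra R B] {N : Type} [AddCommGroup N] [Module R N]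
  [Module.Finite R N]

lemma relIntDep_of_mem {J : Ideal R} {z : R} (h : z ∈ J) : J.RelIntDep N z :=
  relIntDep_of_smul_mem fun m => Submodule.smul_mem_smul h (Submodule.mem_top : m ∈ ⊤)

lemma exists_mem_add_mem_pow_maximalIdeal
    (hdense : ∀ (n : ℕ) (b : B), ∃ r, b - algebraMap R B r ∈ maximalIdeal B ^ n) {𝔞 : Ideal R}
    {y : B} (hy : y ∈ 𝔞.map (algebraMap R B)) (n : ℕ) :
    ∃ r ∈ 𝔞, y - algebraMap R B r ∈ maximalIdeal B ^ n := by
  refine Submodule.span_induction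
    (p := fun y _ => ∃ r ∈ 𝔞, y - algebraMap R B r ∈ maximalIdeal B ^ n) ?_ ?_ ?_ ?_ hy
  · rintro _ ⟨r, hr, rfl⟩
    exact ⟨r, hr, by simp⟩
  · exact ⟨0, zero_mem _, by simp⟩
  · rintro y z - - ⟨r, hr, hr'⟩ ⟨t, ht, ht'⟩
    refine ⟨r + t, add_mem hr ht, ?_⟩
    have := add_mem hr' ht'
    rwa [map_add, add_sub_add_comm]
  · rintro b y - ⟨r, hr, hr'⟩
    obtain ⟨c, hc⟩ := hdense n b
    refine ⟨c * r, 𝔞.mul_mem_left c hr, ?_⟩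
    have h1 := add_mem (Ideal.mul_mem_left _ b hr') (Ideal.mul_mem_right (algebraMap R B r) _ hc)
    rw [smul_eq_mul, map_mul]
    convert h1 using 1
    ring

/-- If saturating the integral closures does not change their topology, no minimal prime of the
extended module becomes primary to the maximal ideal after adding `I`. -/
theorem exists_prime_of_sat_subset [Module.FaithfullyFlat R B]
    (hB : (maximalIdeal R).map (algebraMap R B) = maximalIdeal B)
    (hdense : ∀ (n : ℕ) (b : B), ∃ r, b - algebraMap R B r ∈ maximalIdeal B ^ n) {I : Ideal R}
    (hI : I ≤ maximalIdeal R) {S : Submonoid R} {s : R} (hsm : s ∈ maximalIdeal R) (hsS : s ∈ S)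
    (hS : ∀ n, 1 ≤ n → ∃ k, 1 ≤ k ∧
      sat (S : Set R) ((I ^ k).relIntClosure N) ⊆ (I ^ n).relIntClosure N) {q : Ideal B}
    (hq : q ∈ (Module.annihilator B (B ⊗[R] N)).minimalPrimes) :
    ∃ p : Ideal B, p.IsPrime ∧ p ≠ maximalIdeal B ∧ q ≤ p ∧ I.map (algebraMap R B) ≤ p := by
  by_contra! hcon
  have hqp := hq.1.1
  obtain ⟨y, hyq, e, hy⟩ := exists_smul_pow_le_of_mem_minimalPrimes hq
  have hIB : I.map (algebraMap R B) ≤ maximalIdeal B := hB ▸ Ideal.map_mono hI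
  have key : ∀ n, 1 ≤ n → (maximalIdeal B ^ n).RelIntDep (B ⊗[R] N) y := by
    intro n hn
    obtain ⟨k, hk, hkS⟩ := hS n hn
    have hrad : algebraMap R B s ∈ ((I.map (algebraMap R B)) ^ k ⊔ q ^ e).radical := by
      rw [Ideal.radical_eq_sInf]
      refine Submodule.mem_sInf.2 fun P ⟨hP, hPp⟩ => ?_
      by_cases hPm : P = maximalIdeal B
      · rw [hPm, ← hB]
        exact Ideal.mem_map_of_mem _ hsm
      · exact absurd (hPp.le_of_pow_le (le_sup_left.trans hP))
          (hcon P hPp hPm (hPp.le_of_pow_le (le_sup_right.trans hP)))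
    obtain ⟨c, hc⟩ := hrad
    obtain ⟨a, ha, b, hb, hab⟩ := Submodule.mem_sup.1 hc
    let 𝔞 : Ideal R :=
      { carrier := {r | ∀ m : N, (r * s ^ c) • m ∈ I ^ k • (⊤ : Submodule R N)}
        zero_mem' := fun m => by rw [zero_mul, zero_smul]; exact zero_mem _
        add_mem' := fun hr ht m => by rw [add_mul, add_smul]; exact add_mem (hr m) (ht m)
        smul_mem' := fun t r hr m => by
          rw [smul_eq_mul, mul_assoc, mul_smul]
          exact Submodule.smul_mem _ _ (hr m) }
    have hy𝔞 : y ∈ 𝔞.map (algebraMap R B) := by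
      refine mem_map_of_forall_smul_mem (N := N) (J := I ^ k) (𝔞 := 𝔞) (s := s ^ c) (fun r hr => hr)
        fun u => ?_
      rw [map_pow, ← hab, mul_add, add_smul, Module.mem_annihilator.1 (hy b hb) u, add_zero,
        mul_smul, Ideal.map_pow]
      exact Submodule.smul_mem _ _ (Submodule.smul_mem_smul ha (Submodule.mem_top : u ∈ ⊤))
    obtain ⟨r, hr, hyr⟩ := exists_mem_add_mem_pow_maximalIdeal hdense hy𝔞 n
    have h1 : (I ^ n).RelIntDep N r := by
      refine hkS ⟨s ^ c, pow_mem hsS c, ?_⟩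
      rw [mul_comm]
      exact relIntDep_of_smul_mem hr
    have h2 := relIntDep_mono (J' := maximalIdeal B ^ n)
      (by rw [Ideal.map_pow]; exact Ideal.pow_right_mono hIB n)
      ((relIntDep_baseChange_iff (B := B)).2 h1)
    have h3 : (maximalIdeal B ^ n).RelIntDep (B ⊗[R] N) (y - algebraMap R B r) :=
      relIntDep_of_mem hyr
    have h4 := add_mem (mem_relIntClosureIdeal.2 h3) (mem_relIntClosureIdeal.2 h2)
    rw [sub_add_cancel] at h4
    exact mem_relIntClosureIdeal.1 h4
  refine hyq (mem_of_forall_exists_relIntDep (M := B ⊗[R] N) hq.1.2 le_rfl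
    (le_maximalIdeal hqp.ne_top) fun k => ⟨1, fun h => ?_, ?_⟩)
  · exact (Ideal.ne_top_iff_one _).1 (Ideal.IsPrime.ne_top inferInstance) h
  · rw [one_mul]
    exact relIntDep_mono (Ideal.pow_le_pow_right k.le_succ) (key (k + 1) (by omega))

theorem subsingleton_coh_of_sat_subset [Module.FaithfullyFlat R B]
    [IsPrecomplete (maximalIdeal B) B]
    (hB : (maximalIdeal R).map (algebraMap R B) = maximalIdeal B)
    (hdense : ∀ (n : ℕ) (b : B), ∃ r, b - algebraMap R B r ∈ maximalIdeal B ^ n) {d : ℕ}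
    (hd : Order.krullDim (Module.support R N) = (d : WithBot (WithTop ℕ))) {ι : Type} [Finite ι]
    (x : ι → R) {S : Submonoid R} (hSm : ((maximalIdeal R : Set R) ∩ (S : Set R)).Nonempty)
    (hS : ∀ n, 1 ≤ n → ∃ k, 1 ≤ k ∧ sat (S : Set R)
      ((Ideal.span (Set.range x) ^ k).relIntClosure N) ⊆
        (Ideal.span (Set.range x) ^ n).relIntClosure N) : Subsingleton (Coh x N d) := by
  obtain ⟨s, hsm, hsS⟩ := hSm
  by_cases hI : Ideal.span (Set.range x) = ⊤
  · refine ⟨fun u v => ?_⟩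
    have h : ∀ w : Coh x N d, w = 0 := fun w => by
      obtain ⟨n, hn⟩ := exists_pow_smul_eq_zero x d w (a := 1) (hI ▸ Submodule.mem_top)
      rwa [one_pow, one_smul] at hn
    rw [h u, h v]
  have hIm := le_maximalIdeal hI
  rw [subsingleton_coh_baseChange_iff B x d N]
  refine subsingleton_coh_of_forall_exists_prime _ (fun j => ?_) d _ fun q hq =>
    ⟨coheight_le_of_mem_support_baseChange hd hB hq, fun hqd => ?_⟩
  · rw [← hB]
    exact Ideal.mem_map_of_mem _ (hIm (Ideal.subset_span ⟨j, rfl⟩))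
  · rw [Module.support_eq_zeroLocus] at hq
    obtain ⟨q₁, hq₁, hle⟩ := Ideal.exists_minimalPrimes_le
      (show Module.annihilator B (B ⊗[R] N) ≤ q.asIdeal from hq)
    have hq₁p := hq₁.1.1
    obtain ⟨p, hp, hpm, hqp, hIp⟩ := exists_prime_of_sat_subset hB hdense hIm hsm hsS hS hq₁
    refine ⟨p, hp, hpm, ?_, fun j => hIp (Ideal.mem_map_of_mem _ (Ideal.subset_span ⟨j, rfl⟩))⟩
    have hq₁s : (⟨q₁, hq₁p⟩ : PrimeSpectrum B) ∈ Module.support B (B ⊗[R] N) := by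
      rw [Module.support_eq_zeroLocus]
      exact hq₁.1.2
    have h1 := coheight_le_of_mem_support_baseChange hd hB hq₁s
    have h2 : ¬ (⟨q₁, hq₁p⟩ : PrimeSpectrum B) < q := fun hlt => by
      have h3 := Order.coheight_strictAnti hlt (by rw [hqd]; exact ENat.natCast_lt_top d)
      rw [hqd] at h3
      exact absurd (h1.trans_lt h3) (lt_irrefl _)
    have h4 : (⟨q₁, hq₁p⟩ : PrimeSpectrum B) = q :=
      (eq_or_lt_of_le (show (⟨q₁, hq₁p⟩ : PrimeSpectrum B) ≤ q from hle)).resolve_right h2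
    rw [← h4]
    exact hqp

end Forward

section Saturation
open IsLocalRing

variable {R : Type} [CommRing R] [IsLocalRing R]

/-- In a finite module over a Noetherian `R`-algebra, some element of the maximal ideal of `R`
kills only torsion with respect to that ideal. -/
lemma exists_mem_maximalIdeal_pow_smul_eq_zero {𝒜 Q : Type} [CommRing 𝒜] [IsNoetherianRing 𝒜]
    [Algebra R 𝒜] [AddCommGroup Q] [Module 𝒜 Q] [Module.Finite 𝒜 Q] :
    ∃ s ∈ maximalIdeal R, ∀ v ∈ maximalIdeal R, ∃ M : ℕ, ∀ z : Q,
      algebraMap R 𝒜 s • z = 0 → algebraMap R 𝒜 (v ^ M) • z = 0 := by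
  classical
  let T : Set (Ideal R) := {p | (∃ P ∈ associatedPrimes 𝒜 Q, P.comap (algebraMap R 𝒜) = p) ∧
    p ≠ maximalIdeal R}
  have hT : T.Finite := ((associatedPrimes.finite 𝒜 Q).image
    fun P => P.comap (algebraMap R 𝒜)).subset fun p ⟨⟨P, hP, h⟩, _⟩ => ⟨P, hP, h⟩
  have hTp : ∀ p ∈ T, p.IsPrime := by
    rintro _ ⟨⟨P, hP, rfl⟩, -⟩
    have := hP.isPrime
    infer_instance
  obtain ⟨s, hsm, hs⟩ : ∃ s ∈ maximalIdeal R, ∀ p ∈ T, s ∉ p := by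
    by_contra! hcon
    have hsub : ((maximalIdeal R : Ideal R) : Set R) ⊆ ⋃ p ∈ T, (id p : Ideal R) := fun s hs => by
      obtain ⟨p, hp, hsp⟩ := hcon s hs
      exact Set.mem_biUnion hp hsp
    obtain ⟨p, hp, hle⟩ := (Ideal.subset_union_prime_finite hT (f := id) ⊥ ⊥
      fun p hp _ _ => hTp p hp).1 hsub
    exact hp.2 (le_antisymm (le_maximalIdeal (hTp p hp).ne_top) hle)
  refine ⟨s, hsm, fun v hv => ?_⟩
  let K : Submodule 𝒜 Q := LinearMap.ker (LinearMap.lsmul 𝒜 Q (algebraMap R 𝒜 s))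
  have hrad : algebraMap R 𝒜 v ∈ (Module.annihilator 𝒜 K).radical := by
    rw [← Ideal.sInf_minimalPrimes]
    refine Submodule.mem_sInf.2 fun P (hP : P ∈ (Module.annihilator 𝒜 K).minimalPrimes) => ?_
    have hPK := Module.associatedPrimes.minimalPrimes_annihilator_subset_associatedPrimes 𝒜 K hP
    have hPQ : P ∈ associatedPrimes 𝒜 Q :=
      associatedPrimes.subset_of_injective K.injective_subtype hPK
    have hsP : algebraMap R 𝒜 s ∈ P := hP.1.2 (Module.mem_annihilator.2 fun z => Subtype.ext z.2)
    have h1 : Ideal.comap (algebraMap R 𝒜) P = maximalIdeal R := by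
      by_contra hne
      exact hs _ ⟨⟨P, hPQ, rfl⟩, hne⟩ hsP
    exact (h1 ▸ hv : v ∈ Ideal.comap (algebraMap R 𝒜) P)
  obtain ⟨M, hM⟩ := hrad
  refine ⟨M, fun z hz => ?_⟩
  rw [map_pow]
  exact congr_arg Subtype.val (Module.mem_annihilator.1 hM ⟨z, hz⟩)

variable [IsNoetherianRing R] {N : Type} [AddCommGroup N] [Module R N] [Module.Finite R N]

lemma exists_mem_maximalIdeal_pow_smul_mem_succ (I : Ideal R) :
    ∃ s ∈ maximalIdeal R, ∀ v ∈ maximalIdeal R, ∃ M : ℕ, ∀ (j : ℕ) (m : N),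
      m ∈ I ^ j • (⊤ : Submodule R N) → s • m ∈ I ^ (j + 1) • (⊤ : Submodule R N) →
        v ^ M • m ∈ I ^ (j + 1) • (⊤ : Submodule R N) := by
  let F : I.Filtration N := I.stableFiltration ⊤
  let F' : I.Filtration N := I.stableFiltration (I • ⊤)
  have hF' : ∀ j, F'.N j = I ^ (j + 1) • (⊤ : Submodule R N) := fun j => by
    rw [pow_succ, mul_smul]
    rfl
  have hfg : F.submodule.FG := (Ideal.Filtration.submodule_fg_iff_stable F
    fun i => IsNoetherian.noetherian _).2 (Ideal.stableFiltration_stable I ⊤)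
  let K : Submodule (reesAlgebra I) (PolynomialModule R N ⧸ F'.submodule) :=
    F.submodule.map F'.submodule.mkQ
  have hK : Module.Finite (reesAlgebra I) K := Module.Finite.iff_fg.2 (hfg.map _)
  have hsingle : ∀ (j : ℕ) (m : N),
      PolynomialModule.single R j m ∈ F'.submodule ↔ m ∈ I ^ (j + 1) • (⊤ : Submodule R N) := by
    intro j m
    rw [Ideal.Filtration.mem_submodule]
    refine ⟨fun h => ?_, fun h i => ?_⟩
    · have := h j
      rwa [hF', PolynomialModule.coeff_single, Finsupp.single_eq_same] at this
    · rw [PolynomialModule.coeff_single, Finsupp.single_apply]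
      split_ifs with hij
      · rw [← hij, hF']
        exact h
      · exact zero_mem _
  have hsmul : ∀ (r : R) (j : ℕ) (m : N),
      algebraMap R (reesAlgebra I) r • PolynomialModule.single R j m =
        PolynomialModule.single R j (r • m) := by
    intro r j m
    rw [Subalgebra.smul_def]
    refine (PolynomialModule.monomial_smul_single 0 r j m).trans ?_
    rw [zero_add]
  obtain ⟨s, hs, h⟩ := exists_mem_maximalIdeal_pow_smul_eq_zero (R := R) (𝒜 := reesAlgebra I)
    (Q := K)
  refine ⟨s, hs, fun v hv => ?_⟩
  obtain ⟨M, hM⟩ := h v hv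
  refine ⟨M, fun j m hm hsm => ?_⟩
  have hmF : PolynomialModule.single R j m ∈ F.submodule := by
    rw [Ideal.Filtration.mem_submodule]
    intro i
    rw [PolynomialModule.coeff_single, Finsupp.single_apply]
    split_ifs with hij
    · rw [← hij]
      exact hm
    · exact zero_mem _
  have key : ∀ r : R, algebraMap R (reesAlgebra I) r •
      (⟨F'.submodule.mkQ (PolynomialModule.single R j m), Submodule.mem_map_of_mem hmF⟩ : K) = 0 ↔
        r • m ∈ I ^ (j + 1) • (⊤ : Submodule R N) := by
    intro r
    rw [← Subtype.coe_inj, ← hsingle, ← hsmul, ← Submodule.Quotient.mk_eq_zero]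
    rfl
  exact (key _).1 (hM _ ((key s).2 hsm))

lemma exists_mem_maximalIdeal_pow_smul_mem (I : Ideal R) :
    ∃ s ∈ maximalIdeal R, ∀ v ∈ maximalIdeal R, ∀ c j : ℕ, ∃ M : ℕ, ∀ m : N,
      s ^ c • m ∈ I ^ j • (⊤ : Submodule R N) → v ^ M • m ∈ I ^ j • (⊤ : Submodule R N) := by
  obtain ⟨s, hs, h⟩ := exists_mem_maximalIdeal_pow_smul_mem_succ (N := N) I
  refine ⟨s, hs, fun v hv c j => ?_⟩
  obtain ⟨M, hM⟩ := h v hv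
  have h1 : ∀ i ≤ j, ∀ m : N, s • m ∈ I ^ j • (⊤ : Submodule R N) →
      v ^ (i * M) • m ∈ I ^ i • (⊤ : Submodule R N) := by
    intro i
    induction i with
    | zero => intro _ m _; simp
    | succ i ih =>
      intro hi m hm
      rw [Nat.succ_mul, add_comm (i * M), pow_add v, mul_smul]
      refine hM i _ (ih (by omega) m hm) ?_
      rw [smul_comm]
      exact Submodule.smul_mem _ _ (Submodule.smul_mono_left (Ideal.pow_le_pow_right hi) hm)
  refine ⟨c * (j * M), ?_⟩
  induction c with
  | zero => intro m hm; simpa using hm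
  | succ c ih =>
    intro m hm
    rw [pow_succ, mul_smul] at hm
    have h2 := ih _ hm
    rw [smul_comm] at h2
    have h3 := h1 j le_rfl _ h2
    rwa [← mul_smul, ← pow_add, add_comm, ← Nat.succ_mul] at h3

/-- Saturating the relative integral closures of all powers of `I` by the powers of one suitable
element of the maximal ideal only adds elements of the saturation by the maximal ideal. -/
theorem exists_mem_maximalIdeal_saturation (I : Ideal R) :
    ∃ s ∈ maximalIdeal R, ∀ (k c : ℕ) (x : R), (I ^ k).RelIntDep N (s ^ c * x) →
      ∃ n, ∀ v ∈ maximalIdeal R ^ n, (I ^ k).RelIntDep N (v * x) := by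
  obtain ⟨s, hs, h⟩ := exists_mem_maximalIdeal_pow_smul_mem (N := N) I
  refine ⟨s, hs, fun k c x hx => ?_⟩
  obtain ⟨e, he⟩ := relIntDep_iff.1 hx
  let C : Ideal R := Submodule.comap (LinearMap.mulRight R x) (relIntClosureIdeal (I ^ k) N)
  have hC : ∀ v, v ∈ C ↔ (I ^ k).RelIntDep N (v * x) := fun v => Iff.rfl
  have hle : maximalIdeal R ≤ C.radical := by
    intro v hv
    obtain ⟨M, hM⟩ := exists_pow_mul_relIntDep (J := I ^ k) (v := v) (x := x) (e := e) (N := N)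
      fun j => by
        obtain ⟨M, hM⟩ := h v hv (c * (j + e)) (k * j)
        refine ⟨M, fun m => ?_⟩
        rw [mul_smul, ← pow_mul]
        refine hM _ ?_
        rw [← mul_smul, pow_mul s, ← mul_pow, pow_mul I]
        exact he j m
    exact ⟨M, hM⟩
  obtain ⟨n, hn⟩ := Ideal.exists_pow_le_of_le_radical_of_fg hle (IsNoetherian.noetherian _)
  exact ⟨n, fun v hv => (hC v).1 (hn hv)⟩

end Saturation

section Chevalley
open IsLocalRing

variable {A : Type} [CommRing A] [IsLocalRing A] [IsNoetherianRing A]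

lemma mem_of_forall_mem_sup_pow_maximalIdeal {J : Ideal A} {z : A}
    (h : ∀ n, z ∈ J ⊔ maximalIdeal A ^ n) : z ∈ J := by
  rw [← Ideal.Quotient.eq_zero_iff_mem]
  refine IsHausdorff.haus (inferInstance : IsHausdorff (maximalIdeal A) (A ⧸ J)) _ fun n => ?_
  rw [SModEq.zero]
  obtain ⟨a, ha, b, hb, hab⟩ := Submodule.mem_sup.1 (h n)
  have h1 : (Ideal.Quotient.mk J z : A ⧸ J) = b • (1 : A ⧸ J) := by
    rw [← hab, map_add, Ideal.Quotient.eq_zero_iff_mem.2 ha, zero_add, Algebra.smul_def, mul_one]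
    rfl
  rw [h1]
  exact Submodule.smul_mem_smul hb Submodule.mem_top

lemma exists_stable_sup_pow_maximalIdeal (𝔍 : ℕ → Ideal A) (h𝔍 : Antitone 𝔍) (L : ℕ) :
    ∃ k, ∀ k', ∀ y ∈ 𝔍 k, ∃ b ∈ 𝔍 k', b - y ∈ maximalIdeal A ^ L := by
  have hart : IsArtinianRing (A ⧸ maximalIdeal A ^ (L + 1)) := by
    refine quotient_artinian_of_mem_minimalPrimes_of_isLocalRing _
      ⟨⟨inferInstance, Ideal.pow_le_self L.succ_ne_zero⟩, fun P hP _ => ?_⟩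
    have := hP.1
    exact this.le_of_pow_le hP.2
  let π := Ideal.Quotient.mk (maximalIdeal A ^ (L + 1))
  obtain ⟨k, hk⟩ := IsArtinian.monotone_stabilizes
    (R := A ⧸ maximalIdeal A ^ (L + 1)) (M := A ⧸ maximalIdeal A ^ (L + 1))
    ⟨fun k => OrderDual.toDual ((𝔍 k).map π), fun a b hab => Ideal.map_mono (h𝔍 hab)⟩
  refine ⟨k, fun k' y hy => ?_⟩
  have h1 : (𝔍 k).map π = (𝔍 (max k k')).map π :=
    hk (max k k') (le_max_left _ _)
  have h2 : π y ∈ (𝔍 (max k k')).map π := h1 ▸ Ideal.mem_map_of_mem π hy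
  obtain ⟨b, hb, hby⟩ := (Ideal.mem_map_iff_of_surjective π Ideal.Quotient.mk_surjective).1 h2
  exact ⟨b, h𝔍 (le_max_right _ _) hb, Ideal.pow_le_pow_right L.le_succ (Ideal.Quotient.eq.1 hby)⟩

/-- **Chevalley's theorem** for a decreasing sequence of ideals of a complete local ring. -/
theorem exists_le_iInf_sup_pow_maximalIdeal [IsPrecomplete (maximalIdeal A) A] (𝔍 : ℕ → Ideal A)
    (h𝔍 : Antitone 𝔍) (L : ℕ) : ∃ k, 𝔍 k ≤ (⨅ i, 𝔍 i) ⊔ maximalIdeal A ^ L := by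
  choose κ hκ using exists_stable_sup_pow_maximalIdeal 𝔍 h𝔍
  let ν : ℕ → ℕ := fun n => max n (κ n)
  refine ⟨ν L, fun y hy => ?_⟩
  have hstep : ∀ n a, a ∈ 𝔍 (ν n) → ∃ b ∈ 𝔍 (ν (n + 1)), b - a ∈ maximalIdeal A ^ n :=
    fun n a ha => hκ n _ a (h𝔍 (le_max_right _ _) ha)
  choose! g hg hg' using hstep
  let f : ℕ → A := fun n => Nat.rec y (fun n a => g (L + n) a) n
  have hf : ∀ n, f n ∈ 𝔍 (ν (L + n)) := by
    intro n
    induction n with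
    | zero => exact hy
    | succ n ih => exact hg (L + n) _ ih
  have hf' : ∀ n, f (n + 1) - f n ∈ maximalIdeal A ^ (L + n) := fun n => hg' (L + n) _ (hf n)
  have hdiff : ∀ m k, f (m + k) - f m ∈ maximalIdeal A ^ (L + m) := by
    intro m k
    induction k with
    | zero => simp
    | succ k ih =>
      have := add_mem (Ideal.pow_le_pow_right (by omega) (hf' (m + k))) ih
      rwa [sub_add_sub_cancel] at this
  obtain ⟨z, hz⟩ := IsPrecomplete.prec (inferInstance : IsPrecomplete (maximalIdeal A) A) (f := f)
    fun {m n} hmn => by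
      rw [SModEq.sub_mem, smul_eq_mul, Ideal.mul_top, ← neg_sub, neg_mem_iff]
      obtain ⟨k, rfl⟩ := Nat.exists_eq_add_of_le hmn
      exact Ideal.pow_le_pow_right (by omega) (hdiff m k)
  have hz' : ∀ n, f n - z ∈ maximalIdeal A ^ n := fun n => by
    have := hz n
    rwa [SModEq.sub_mem, smul_eq_mul, Ideal.mul_top] at this
  have hzJ : ∀ i, z ∈ 𝔍 i := by
    intro i
    refine mem_of_forall_mem_sup_pow_maximalIdeal fun n => ?_
    have h1 : f (max i n) ∈ 𝔍 i :=
      h𝔍 (((le_max_left i n).trans (Nat.le_add_left _ L)).trans (le_max_left _ _)) (hf _)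
    have h2 := Ideal.pow_le_pow_right (le_max_right i n) (hz' (max i n))
    rw [← sub_sub_cancel (f (max i n)) z]
    exact sub_mem (Submodule.mem_sup_left h1) (Submodule.mem_sup_right h2)
  have h1 : y - z ∈ maximalIdeal A ^ L := by
    have h2 := hdiff 0 L
    rw [zero_add] at h2
    have h3 := sub_mem (hz' L) h2
    rwa [sub_sub_sub_cancel_left] at h3
  rw [← add_sub_cancel z y]
  exact add_mem (Submodule.mem_sup_left (Submodule.mem_iInf _ |>.2 hzJ))
    (Submodule.mem_sup_right h1)

variable (M : Type) [AddCommGroup M] [Module A M] [Module.Finite A M]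

/-- The saturation, by the powers of the maximal ideal, of a relative integral closure. -/
def satClosure (J : Ideal A) : Ideal A where
  carrier := {y | ∃ n, ∀ v ∈ maximalIdeal A ^ n, J.RelIntDep M (v * y)}
  zero_mem' := ⟨0, fun v _ => by
    rw [mul_zero]
    exact mem_relIntClosureIdeal.1 (zero_mem _)⟩
  add_mem' := by
    rintro y z ⟨n, hn⟩ ⟨n', hn'⟩
    refine ⟨max n n', fun v hv => ?_⟩
    rw [mul_add]
    exact mem_relIntClosureIdeal.1 (add_mem
      (mem_relIntClosureIdeal.2 (hn v (Ideal.pow_le_pow_right (le_max_left _ _) hv)))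
      (mem_relIntClosureIdeal.2 (hn' v (Ideal.pow_le_pow_right (le_max_right _ _) hv))))
  smul_mem' := by
    rintro r y ⟨n, hn⟩
    refine ⟨n, fun v hv => ?_⟩
    rw [smul_eq_mul, mul_left_comm]
    exact mem_relIntClosureIdeal.1 (Ideal.mul_mem_left _ r (mem_relIntClosureIdeal.2 (hn v hv)))

variable {M}

lemma mem_satClosure {J : Ideal A} {y : A} :
    y ∈ satClosure M J ↔ ∃ n, ∀ v ∈ maximalIdeal A ^ n, J.RelIntDep M (v * y) := Iff.rfl

lemma relIntDep_of_mem_radical_annihilator (J : Ideal A) {y : A}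
    (hy : y ∈ (Module.annihilator A M).radical) : J.RelIntDep M y := by
  obtain ⟨c, hc⟩ := hy
  refine relIntDep_iff.2 ⟨c, fun j m => ?_⟩
  rw [pow_add, mul_smul, Module.mem_annihilator.1 hc m, smul_zero]
  exact zero_mem _

lemma exists_pow_mul_satClosure_le (J : Ideal A) :
    ∃ n, maximalIdeal A ^ n * satClosure M J ≤ relIntClosureIdeal J M := by
  obtain ⟨G, hG⟩ := IsNoetherian.noetherian (satClosure M J)
  have h : ∀ y : G, ∃ n, ∀ v ∈ maximalIdeal A ^ n, J.RelIntDep M (v * y) := fun y =>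
    mem_satClosure.1 (hG ▸ Submodule.subset_span y.2)
  choose n hn using h
  refine ⟨Finset.univ.sup n, Ideal.mul_le.2 fun v hv y hy => ?_⟩
  rw [← hG] at hy
  refine Submodule.span_induction (p := fun y _ => v * y ∈ relIntClosureIdeal J M) ?_ ?_ ?_ ?_ hy
  · intro y hy
    exact hn ⟨y, hy⟩ v (Ideal.pow_le_pow_right (Finset.le_sup (Finset.mem_univ _)) hv)
  · rw [mul_zero]
    exact zero_mem _
  · intro y z _ _ h h'
    rw [mul_add]
    exact add_mem h h'
  · intro r y _ h
    rw [smul_eq_mul, mul_left_comm]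
    exact Ideal.mul_mem_left _ r h

/-- Over a complete local ring, saturating the integral closures of the powers of `I` does not
change their topology as soon as no minimal prime of the module becomes primary to the maximal
ideal after adding `I`. -/
theorem exists_satClosure_le [IsPrecomplete (maximalIdeal A) A] {I : Ideal A}
    (hI : ∀ q ∈ (Module.annihilator A M).minimalPrimes,
      ∃ p : Ideal A, p.IsPrime ∧ p ≠ maximalIdeal A ∧ q ≤ p ∧ I ≤ p) (n : ℕ) :
    ∃ k, n ≤ k ∧ satClosure M (I ^ k) ≤ relIntClosureIdeal (I ^ n) M := by
  have hanti : Antitone fun k => satClosure M (I ^ k) := by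
    rintro k k' hk y ⟨c, hc⟩
    exact ⟨c, fun v hv => relIntDep_mono (Ideal.pow_le_pow_right hk) (hc v hv)⟩
  have hinf : (⨅ k, satClosure M (I ^ k)) ≤ (Module.annihilator A M).radical := by
    intro y hy
    rw [← Ideal.sInf_minimalPrimes]
    refine Submodule.mem_sInf.2 fun q (hq : q ∈ (Module.annihilator A M).minimalPrimes) => ?_
    obtain ⟨p, hp, hpm, hqp, hIp⟩ := hI q hq
    have hqp' := hq.1.1
    refine mem_of_forall_exists_relIntDep (M := M) hq.1.2 hIp hqp fun k => ?_
    obtain ⟨c, hc⟩ := mem_satClosure.1 ((Submodule.mem_iInf _).1 hy k)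
    obtain ⟨v, hv, hvp⟩ := Set.not_subset.1 fun h : maximalIdeal A ^ c ≤ p =>
      hpm (le_antisymm (le_maximalIdeal hp.ne_top) (hp.le_of_pow_le h))
    exact ⟨v, hvp, hc v hv⟩
  obtain ⟨a, ha⟩ := exists_pow_mul_satClosure_le (M := M) (I ^ n)
  obtain ⟨c, hc⟩ := Ideal.exists_pow_inf_eq_pow_smul (maximalIdeal A) (satClosure M (I ^ n))
  obtain ⟨k, hk⟩ := exists_le_iInf_sup_pow_maximalIdeal _ hanti (c + a)
  refine ⟨max n k, le_max_left _ _, fun y hy => ?_⟩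
  obtain ⟨z, hz, b, hb, rfl⟩ := Submodule.mem_sup.1 (hk (hanti (le_max_right n k) hy))
  have hbn : b ∈ satClosure M (I ^ n) := by
    have h1 := sub_mem (hanti (le_max_left n k) hy) ((Submodule.mem_iInf _).1 hz n)
    rwa [add_sub_cancel_left] at h1
  refine add_mem (relIntDep_of_mem_radical_annihilator _ (hinf hz)) (ha ?_)
  have h2 : b ∈ maximalIdeal A ^ (c + a) • (⊤ : Submodule A A) ⊓ satClosure M (I ^ n) :=
    ⟨by rwa [smul_eq_mul, Ideal.mul_top], hbn⟩
  rw [hc _ (Nat.le_add_right c a), Nat.add_sub_cancel_left] at h2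
  exact Submodule.smul_mono le_rfl inf_le_right h2

end Chevalley

section Converse
open IsLocalRing TensorProduct

variable {R B : Type} [CommRing R] [IsLocalRing R] [IsNoetherianRing R] [CommRing B]
  [IsLocalRing B] [IsNoetherianRing B] [Algebra R B] {N : Type} [AddCommGroup N] [Module R N]
  [Module.Finite R N]

theorem exists_sat_subset_of_subsingleton_coh [Module.FaithfullyFlat R B]
    [IsPrecomplete (maximalIdeal B) B]
    (hB : (maximalIdeal R).map (algebraMap R B) = maximalIdeal B) {d : ℕ}
    (hd : Order.krullDim (Module.support R N) = (d : WithBot (WithTop ℕ)))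
    (hN : ∀ q ∈ (Module.annihilator B (B ⊗[R] N)).minimalPrimes,
      ringKrullDim (B ⧸ q) = (d : WithBot (WithTop ℕ))) {ι : Type} [Finite ι]
    (x : ι → R) (hsub : Subsingleton (Coh x N d)) :
    ∃ S : Submonoid R, ((maximalIdeal R : Set R) ∩ (S : Set R)).Nonempty ∧
      ∀ n, 1 ≤ n → ∃ k, 1 ≤ k ∧ sat (S : Set R)
        ((Ideal.span (Set.range x) ^ k).relIntClosure N) ⊆
          (Ideal.span (Set.range x) ^ n).relIntClosure N := by
  by_cases hI : Ideal.span (Set.range x) = ⊤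
  · refine ⟨Submonoid.powers 0, ⟨0, zero_mem _, Submonoid.mem_powers 0⟩, fun n _ =>
      ⟨1, le_rfl, fun y _ => relIntDep_of_mem ?_⟩⟩
    rw [hI, Ideal.top_pow]
    exact Submodule.mem_top
  have hIm := le_maximalIdeal hI
  rw [subsingleton_coh_baseChange_iff B x d N] at hsub
  have hxB : ∀ j, algebraMap R B (x j) ∈ maximalIdeal B := fun j => by
    rw [← hB]
    exact Ideal.mem_map_of_mem _ (hIm (Ideal.subset_span ⟨j, rfl⟩))
  have key := exists_satClosure_le (M := B ⊗[R] N)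
    (I := (Ideal.span (Set.range x)).map (algebraMap R B)) fun q hq => by
      have hqp := hq.1.1
      have hqs : (⟨q, hqp⟩ : PrimeSpectrum B) ∈ Module.support B (B ⊗[R] N) := by
        rw [Module.support_eq_zeroLocus]
        exact hq.1.2
      obtain ⟨p, hp, hpm, hqp, hxp⟩ := exists_prime_of_subsingleton_coh _ hxB (B ⊗[R] N)
        (fun q hq => coheight_le_of_mem_support_baseChange hd hB hq) hsub hqs
        (WithBot.coe_injective
          ((ringKrullDim_quotient_eq_coheight ⟨q, hqp⟩).symm.trans (hN q hq)))
      refine ⟨p, hp, hpm, hqp, Ideal.map_le_iff_le_comap.2 (Ideal.span_le.2 ?_)⟩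
      rintro _ ⟨j, rfl⟩
      exact hxp j
  obtain ⟨s, hs, hsat⟩ := exists_mem_maximalIdeal_saturation (N := N) (Ideal.span (Set.range x))
  refine ⟨Submonoid.powers s, ⟨s, hs, Submonoid.mem_powers s⟩, fun n hn => ?_⟩
  obtain ⟨k, hk, hle⟩ := key n
  refine ⟨k, hn.trans hk, ?_⟩
  rintro y ⟨_, ⟨c, rfl⟩, hy⟩
  obtain ⟨e, he⟩ := hsat k c y hy
  refine (relIntDep_baseChange_iff (B := B)).1 ?_
  rw [Ideal.map_pow]
  refine mem_relIntClosureIdeal.1 (hle (mem_satClosure.2 ⟨e, fun v hv => ?_⟩))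
  rw [← hB, ← Ideal.map_pow] at hv
  rw [← Ideal.map_pow]
  refine Submodule.span_induction (p := fun v _ => v * algebraMap R B y ∈
    relIntClosureIdeal ((Ideal.span (Set.range x) ^ k).map (algebraMap R B)) (B ⊗[R] N))
    ?_ ?_ ?_ ?_ hv
  · rintro _ ⟨r, hr, rfl⟩
    rw [← map_mul]
    exact relIntDep_baseChange_iff.2 (he r hr)
  · rw [zero_mul]
    exact zero_mem _
  · intro u v _ _ hu hv
    rw [add_mul]
    exact add_mem hu hv
  · intro b v _ hv
    rw [smul_eq_mul, mul_assoc]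
    exact Ideal.mul_mem_left _ b hv

end Converse

section Completion
open IsLocalRing TensorProduct

variable {R : Type} [CommRing R] [IsLocalRing R] [IsNoetherianRing R]

lemma exists_sub_algebraMap_mem_pow_maximalIdeal (n : ℕ) (b : AdicCompletion (maximalIdeal R) R) :
    ∃ r, b - algebraMap R (AdicCompletion (maximalIdeal R) R) r ∈
      maximalIdeal (AdicCompletion (maximalIdeal R) R) ^ n := by
  obtain ⟨r, hr⟩ := Submodule.mkQ_surjective _ (AdicCompletion.eval (maximalIdeal R) R n b)
  refine ⟨r, ?_⟩
  rw [AdicCompletion.maximalIdeal_eq_map, ← Ideal.map_pow, ← Submodule.restrictScalars_mem R,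
    ← Ideal.smul_top_eq_map,
    AdicCompletion.pow_smul_top_eq_ker_eval (maximalIdeal R).fg_of_isNoetherianRing,
    LinearMap.mem_ker, map_sub, ← hr, sub_eq_zero]
  rfl

lemma mem_mAss_of_mem_minimalPrimes_annihilator {A M : Type} [CommRing A] [IsNoetherianRing A]
    [AddCommGroup M] [Module A M] [Module.Finite A M] {q : Ideal A}
    (hq : q ∈ (Module.annihilator A M).minimalPrimes) : q ∈ mAss A M := by
  refine ⟨Module.associatedPrimes.minimalPrimes_annihilator_subset_associatedPrimes A M hq,
    fun p hp hpq => hq.2 ⟨hp.isPrime, ?_⟩ hpq⟩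
  rw [← Submodule.annihilator_top]
  exact IsAssociatedPrime.annihilator_le hp

end Completion

end TorsionCohomology

/-- For a Noetherian local ring `(R, 𝔪)` and `N` finitely generated of dimension `d`:
if there is a multiplicative set `S` meeting `𝔪` whose `S`-topology on the `(I^n)^{(N)}_a`
is equivalent to the `(I^n)^{(N)}_a`-topology, then `H^d_I(N) = 0`; conversely if `N` is
quasi-unmixed and `H^d_I(N) = 0` then such an `S` exists. -/
theorem localCohomology_top_vanishing_iff_sat_topology {R : Type} [CommRing R] [IsLocalRing R]
    [IsNoetherianRing R] (N : Type) [AddCommGroup N] [Module R N] [Module.Finite R N]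
    (d : ℕ) (hd : Order.krullDim (Module.support R N) = (d : WithBot (WithTop ℕ)))
    (I : Ideal R) :
    ((∃ S : Submonoid R,
        ((IsLocalRing.maximalIdeal R : Set R) ∩ (S : Set R)).Nonempty ∧
        ∀ n : ℕ, 1 ≤ n → ∃ k : ℕ, 1 ≤ k ∧
          sat (S : Set R) ((I ^ k).relIntClosure N) ⊆ (I ^ n).relIntClosure N) →
      Subsingleton ((localCohomology I d).obj (ModuleCat.of R N))) ∧
    (QuasiUnmixed R N →
      Subsingleton ((localCohomology I d).obj (ModuleCat.of R N)) →
      ∃ S : Submonoid R,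
        ((IsLocalRing.maximalIdeal R : Set R) ∩ (S : Set R)).Nonempty ∧
        ∀ n : ℕ, 1 ≤ n → ∃ k : ℕ, 1 ≤ k ∧
          sat (S : Set R) ((I ^ k).relIntClosure N) ⊆ (I ^ n).relIntClosure N) := by
  obtain ⟨n, x, rfl⟩ := Submodule.fg_iff_exists_fin_generating_family.1
    (IsNoetherian.noetherian I)
  have hB := (AdicCompletion.maximalIdeal_eq_map (R := R)).symm
  have := TorsionCohomology.isNoetherianRing_completion (IsLocalRing.maximalIdeal R)
  have := AdicCompletion.flat_of_isNoetherian (IsLocalRing.maximalIdeal R)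
  have := Module.FaithfullyFlat.of_flat_of_isLocalHom (A := R)
    (B := AdicCompletion (IsLocalRing.maximalIdeal R) R)
  have hiff := TorsionCohomology.subsingleton_localCohomology_iff_coh x d N
  refine ⟨fun ⟨S, hSm, hS⟩ => hiff.2 ?_, fun hN hsub => ?_⟩
  · exact TorsionCohomology.subsingleton_coh_of_sat_subset hB
      TorsionCohomology.exists_sub_algebraMap_mem_pow_maximalIdeal hd x hSm hS
  · refine TorsionCohomology.exists_sat_subset_of_subsingleton_coh hB hd (fun q hq => ?_) x
      (hiff.1 hsub)
    have h := TorsionCohomology.mem_mAss_of_mem_minimalPrimes_annihilator hq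
    rw [mAss, LinearEquiv.AssociatedPrimes.eq
      (AdicCompletion.ofTensorProductEquivOfFiniteNoetherian _ N)] at h
    exact (hN q h).trans hd
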